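/- arXiv:1405.4363 — 4 statements merged into one kernel-verified Lean document; each statement's English description precedes it below -/
import Mathlib

section
/- Let m ≥ 3 be an integer and let s be a zero-sum sequence over ⟦−m, m⟧ of length 2m − 2. Then s is minimal if and only if one of the following holds: (i) m is odd and s consists of m repeated m − 2 times together with −(m − 2) repeated m times, or of −m repeated m − 2 times together with m − 2 repeated m times; (ii) s consists of m repeated m − 2 times, −(m − 1) repeated m − 1 times, and 1 once, or of −m repeated m − 2 times, m − 1 repeated m − 1 times, and −1 once. -/
/-- A minimal zero-sum sequence over `X`: a non-empty multiset of elements of `X`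
whose sum is `0` and such that no non-empty proper sub-multiset has sum `0`. -/
def IsMinZeroSumSeq {G : Type*} [AddCommGroup G] (X : Set G) (s : Multiset G) : Prop :=
  s ≠ 0 ∧ (∀ x ∈ s, x ∈ X) ∧ s.sum = 0 ∧ ∀ t < s, t ≠ 0 → t.sum ≠ 0

/-- The Davenport constant of a subset `X` of an abelian group: the supremum of the
lengths of minimal zero-sum sequences over `X` (0 if there are none). -/
noncomputable def davenport {G : Type*} [AddCommGroup G] (X : Set G) : ℕ∞ :=
  ⨆ (s : Multiset G) (_ : IsMinZeroSumSeq X s), (Multiset.card s : ℕ∞)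

def vis {G : Type*} [AddCommGroup G] : G → List G → List G
  | _, [] => []
  | t, x :: l => t :: vis (t + x) l

theorem vis_length {G : Type*} [AddCommGroup G] (l : List G) :
    ∀ t : G, (vis t l).length = l.length := by
  induction l with
  | nil => intro t; rfl
  | cons x l ih => intro t; simp [vis, ih]

theorem vis_append {G : Type*} [AddCommGroup G] (l l' : List G) :
    ∀ t : G, vis t (l ++ l') = vis t l ++ vis (t + l.sum) l' := by
  induction l with
  | nil => intro t; simp [vis]
  | cons x l ih => intro t; simp [vis, ih, add_assoc]

theorem mem_vis {G : Type*} [AddCommGroup G] (l : List G) :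
    ∀ t v : G, v ∈ vis t l → ∃ l1 l2, l = l1 ++ l2 ∧ l2 ≠ [] ∧ v = t + l1.sum := by
  induction l with
  | nil => intro t v h; simp [vis] at h
  | cons x l ih =>
    intro t v h
    simp only [vis, List.mem_cons] at h
    rcases h with h | h
    · exact ⟨[], x :: l, rfl, by simp, by simp [h]⟩
    · obtain ⟨l1, l2, h1, h2, h3⟩ := ih _ _ h
      exact ⟨x :: l1, l2, by simp [h1], h2, by simp [h3, add_assoc]⟩

theorem vis_nodup {G : Type*} [AddCommGroup G] (l : List G) :
    ∀ t : G, (∀ l1 l2 l3, l = l1 ++ l2 ++ l3 → l2 ≠ [] → l3 ≠ [] → l2.sum ≠ 0) →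
      (vis t l).Nodup := by
  induction l with
  | nil => intro t _; simp [vis]
  | cons x l ih =>
    intro t h
    simp only [vis, List.nodup_cons]
    refine ⟨fun hm => ?_, ih _ fun l1 l2 l3 e h2 h3 => h (x :: l1) l2 l3 (by simp [e]) h2 h3⟩
    obtain ⟨l1, l2, h1, h2, h3⟩ := mem_vis _ _ _ hm
    refine h [] (x :: l1) l2 (by simp [h1]) (by simp) h2 ?_
    rw [List.sum_cons]
    rw [add_assoc] at h3
    simpa using h3

/-- Coercion fact: a middle block followed by a nonempty block is a proper submultiset. -/
theorem mid_lt {G : Type*} (l1 l2 l3 : List G) (h3 : l3 ≠ []) :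
    (l2 : Multiset G) < ((l1 ++ l2 ++ l3 : List G) : Multiset G) := by
  refine lt_of_le_of_ne ?_ ?_
  · rw [← Multiset.coe_add, ← Multiset.coe_add]
    exact (Multiset.le_add_left _ _).trans (Multiset.le_add_right _ _)
  · intro h
    have := congrArg Multiset.card h
    have := List.length_pos_iff.2 h3
    simp at *
    omega

theorem min_nodup (s : Multiset ℤ) (hmin : ∀ t < s, t ≠ 0 → t.sum ≠ 0) (l : List ℤ)
    (hl : (l : Multiset ℤ) = s) (t : ℤ) : (vis t l).Nodup := by
  apply vis_nodup
  intro l1 l2 l3 e h2 h3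
  have := hmin (l2 : Multiset ℤ) (by rw [← hl, e]; exact mid_lt _ _ _ h3) (by simpa using h2)
  simpa using this

theorem greedy (a b : ℤ) (n : ℕ) : ∀ (R : Multiset ℤ) (u : ℤ), Multiset.card R = n →
    (∀ x ∈ R, -b ≤ x ∧ x ≤ a) → 1 - b ≤ u → u ≤ a → 1 - b ≤ u + R.sum → u + R.sum ≤ a →
    ∃ l : List ℤ, (l : Multiset ℤ) = R ∧ ∀ v ∈ vis u l, 1 - b ≤ v ∧ v ≤ a := by
  induction n with
  | zero =>
    intro R u hc _ _ _ _ _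
    exact ⟨[], by simpa using (Multiset.card_eq_zero.1 hc).symm, by simp [vis]⟩
  | succ n ih =>
    intro R u hc hR h1 h2 h3 h4
    have key : ∃ x ∈ R, 1 - b ≤ u + x ∧ u + x ≤ a := by
      have hne : ∃ x, x ∈ R := Multiset.card_pos_iff_exists_mem.1 (by omega)
      rcases le_or_gt u 0 with hu | hu
      · by_cases h : ∃ x ∈ R, 0 ≤ x
        · obtain ⟨x, hx, h0⟩ := h
          exact ⟨x, hx, by omega, by have := hR x hx; omega⟩
        · push Not at h
          obtain ⟨x, hx⟩ := hne
          obtain ⟨R', rfl⟩ := Multiset.exists_cons_of_mem hx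
          have : R'.sum ≤ 0 := by
            simpa using Multiset.sum_le_card_nsmul R' 0 fun y hy =>
              (h y (Multiset.mem_cons_of_mem hy)).le
          rw [Multiset.sum_cons] at h3 h4
          have := h x hx
          exact ⟨x, hx, by omega, by omega⟩
      · by_cases h : ∃ x ∈ R, x ≤ 0
        · obtain ⟨x, hx, h0⟩ := h
          exact ⟨x, hx, by have := hR x hx; omega, by omega⟩
        · push Not at h
          obtain ⟨x, hx⟩ := hne
          obtain ⟨R', rfl⟩ := Multiset.exists_cons_of_mem hx
          have : 0 ≤ R'.sum := Multiset.sum_nonneg fun y hy =>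
            (h y (Multiset.mem_cons_of_mem hy)).le
          rw [Multiset.sum_cons] at h3 h4
          have := h x hx
          exact ⟨x, hx, by omega, by omega⟩
    obtain ⟨x, hx, hx1, hx2⟩ := key
    obtain ⟨R', rfl⟩ := Multiset.exists_cons_of_mem hx
    rw [Multiset.sum_cons] at h3 h4
    obtain ⟨l, hl, hv⟩ := ih R' (u + x) (by simpa using hc)
      (fun y hy => hR y (Multiset.mem_cons_of_mem hy)) hx1 hx2 (by omega) (by omega)
    refine ⟨x :: l, by rw [← Multiset.cons_coe, hl], ?_⟩
    intro v hv'
    simp only [vis, List.mem_cons] at hv'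
    rcases hv' with rfl | hv'
    · exact ⟨h1, h2⟩
    · exact hv v hv'

theorem walk (a b : ℤ) (s : Multiset ℤ) (hsum : s.sum = 0)
    (hR : ∀ x ∈ s, -b ≤ x ∧ x ≤ a) (L : List ℤ) (hL : (L : Multiset ℤ) ≤ s) (t : ℤ)
    (h1 : 1 - b ≤ t) (h2 : t ≤ a) (h3 : 1 - b ≤ t + L.sum) (h4 : t + L.sum ≤ a) :
    ∃ L' : List ℤ, ((L ++ L' : List ℤ) : Multiset ℤ) = s ∧
      ∀ v ∈ vis (t + L.sum) L', 1 - b ≤ v ∧ v ≤ a := by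
  obtain ⟨R, rfl⟩ := Multiset.le_iff_exists_add.1 hL
  rw [Multiset.sum_add, Multiset.sum_coe] at hsum
  obtain ⟨l, hl, hv⟩ := greedy a b _ R (t + L.sum) rfl
    (fun x hx => hR x (Multiset.mem_add.2 (Or.inr hx))) h3 h4 (by omega) (by omega)
  exact ⟨l, by rw [← Multiset.coe_add, hl], hv⟩

theorem window_card (a b : ℤ) (V : List ℤ) (hV : V.Nodup) (hab : 0 ≤ a + b)
    (h : ∀ v ∈ V, 1 - b ≤ v ∧ v ≤ a) : (V.length : ℤ) ≤ a + b := by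
  have h1 : V.toFinset ⊆ Finset.Icc (1 - b) a := by
    intro v hv
    simpa using h v (by simpa using hv)
  have h2 := Finset.card_le_card h1
  rw [List.toFinset_card_of_nodup hV, Int.card_Icc] at h2
  omega

theorem lambert (a b : ℤ) (ha : 1 ≤ a) (hb : 1 ≤ b) (s : Multiset ℤ) (hsum : s.sum = 0)
    (hmin : ∀ t < s, t ≠ 0 → t.sum ≠ 0) (hR : ∀ x ∈ s, -b ≤ x ∧ x ≤ a) :
    (Multiset.card s : ℤ) ≤ a + b := by
  obtain ⟨L, hL, hv⟩ := walk a b s hsum hR [] (by simp) 0 (by omega) (by omega)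
    (by simp; omega) (by simp; omega)
  have := window_card a b _ (min_nodup s hmin L (by simpa using hL) 0) (by omega)
    (by simpa using hv)
  rw [vis_length] at this
  rw [← hL]; simpa using this

/-- One swap is impossible at full length. -/
theorem one_swap (a b : ℤ) (s : Multiset ℤ) (hsum : s.sum = 0)
    (hmin : ∀ t < s, t ≠ 0 → t.sum ≠ 0) (hR : ∀ x ∈ s, -b ≤ x ∧ x ≤ a)
    (x y t : ℤ) (hx : x ∈ s) (hy : y ∈ s) (hxy : x ≠ y)
    (h1 : 1 - b ≤ t) (h2 : t ≤ a) (h3 : 1 - b ≤ t + x) (h4 : t + x ≤ a)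
    (h5 : 1 - b ≤ t + y) (h6 : t + y ≤ a) (h7 : 1 - b ≤ t + x + y) (h8 : t + x + y ≤ a) :
    (Multiset.card s : ℤ) < a + b := by
  obtain ⟨L, hL, hv⟩ := walk a b s hsum hR [x, y]
    ((Multiset.le_iff_subset (by simpa using hxy)).2 (by
      intro z hz; simp at hz; rcases hz with rfl | rfl <;> assumption)) t h1 h2
    (by simp; omega) (by simp; omega)
  have n1 := min_nodup s hmin _ hL t
  have n2 := min_nodup s hmin (y :: x :: L) (by rw [← hL]; simp [List.Perm.swap]) t
  have hc : Multiset.card s = L.length + 2 := by rw [← hL]; simp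
  have e1 : t + [x, y].sum = t + x + y := by simp; ring
  have e2 : t + y + x = t + x + y := by ring
  rw [e1] at hv
  simp only [List.cons_append, List.nil_append, vis, e2] at n1 n2
  have := window_card a b (t :: (t + x) :: (t + y) :: vis (t + x + y) L) (by
    simp only [List.nodup_cons, List.mem_cons] at *
    have : t + x ≠ t + y := by omega
    tauto) (by omega) (by
    simp only [List.mem_cons]
    rintro v (rfl | rfl | rfl | h)
    · omega
    · omega
    · omega
    · exact hv v h)
  simp [vis_length] at this
  omega

theorem two_swap (a b : ℤ) (s : Multiset ℤ) (hsum : s.sum = 0)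
    (hmin : ∀ t < s, t ≠ 0 → t.sum ≠ 0) (hR : ∀ x ∈ s, -b ≤ x ∧ x ≤ a) (hba : b = a - 1)
    (x y : ℤ) (ha : a ∈ s) (hb : -b ∈ s) (hx : x ∈ s) (hy : -y ∈ s) (hx1 : 1 ≤ x) (hxb : x < b)
    (hy1 : 1 ≤ y) (hyb : y < b) :
    (Multiset.card s : ℤ) < a + b - 1 := by
  obtain ⟨L, hL, hv⟩ := walk a b s hsum hR [x, a, -b, -y]
    ((Multiset.le_iff_subset (by simp; omega)).2 (by
      intro z hz; simp at hz; rcases hz with rfl | rfl | rfl | rfl <;> assumption)) (-x)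
      (by omega) (by omega)
    (by simp; omega) (by simp; omega)
  have n1 := min_nodup s hmin _ hL (-x)
  have n2 := min_nodup s hmin (a :: x :: -b :: -y :: L) (by
    rw [← hL]; exact Multiset.coe_eq_coe.2 (List.Perm.swap _ _ _)) (-x)
  have p3 : (-y :: -b :: L).Perm (-b :: -y :: L) := List.Perm.swap _ _ _
  have n3 := min_nodup s hmin (x :: a :: -y :: -b :: L) (by
    rw [← hL]; exact Multiset.coe_eq_coe.2 ((p3.cons a).cons x)) (-x)
  have n4 := min_nodup s hmin (a :: x :: -y :: -b :: L) (by
    rw [← hL]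
    exact Multiset.coe_eq_coe.2 ((List.Perm.swap _ _ _).trans ((p3.cons a).cons x))) (-x)
  have hc : Multiset.card s = L.length + 4 := by rw [← hL]; simp
  have e1 : -x + [x, a, -b, -y].sum = 1 - y := by simp; omega
  have e2 : -x + x = 0 := by ring
  have e3 : 0 + a = a := by ring
  have e4 : -x + a + x = a := by ring
  have e5 : a + -b = 1 := by omega
  have e6 : 1 + -y = 1 - y := by omega
  have e7 : a + -y + -b = 1 - y := by omega
  rw [e1] at hv
  simp only [List.cons_append, List.nil_append, vis, e2, e3, e4, e5, e6, e7] at n1 n2 n3 n4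
  have := window_card a b (-x :: 0 :: (-x + a) :: a :: 1 :: (a + -y) :: vis (1 - y) L) (by
    simp only [List.nodup_cons, List.mem_cons] at *
    have : 0 ≠ -x + a := by omega
    have : 1 ≠ a + -y := by omega
    tauto) (by omega) (by
    simp only [List.mem_cons]
    rintro v (rfl | rfl | rfl | rfl | rfl | rfl | h)
    · omega
    · omega
    · omega
    · omega
    · omega
    · omega
    · exact hv v h)
  simp [vis_length] at this
  omega

theorem dav (n : ℕ) (hn : 1 ≤ n) (P : Multiset ℤ)
    (hP : ∀ T < P, T ≠ 0 → ¬ (n : ℤ) ∣ T.sum) :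
    Multiset.card P ≤ n ∧
      (Multiset.card P = n → ∀ x ∈ P, ∀ y ∈ P, (n : ℤ) ∣ x - y) := by
  have : NeZero n := ⟨by omega⟩
  have nd : ∀ l : List ℤ, (l : Multiset ℤ) = P → (vis (0 : ZMod n) (l.map (↑))).Nodup := by
    intro l hl
    apply vis_nodup
    intro l1 l2 l3 e h2 h3 h0
    obtain ⟨l12, k3, rfl, e12, rfl⟩ := List.map_eq_append_iff.1 e
    obtain ⟨k1, k2, rfl, rfl, rfl⟩ := List.map_eq_append_iff.1 e12
    refine hP (k2 : Multiset ℤ) (by rw [← hl]; exact mid_lt _ _ _ (by simpa using h3))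
      (by simpa using h2) ?_
    rw [Multiset.sum_coe, ← ZMod.intCast_zmod_eq_zero_iff_dvd]
    rw [← h0]
    exact map_list_sum (Int.castRingHom (ZMod n)) k2
  constructor
  · have h := nd P.toList (by simp)
    have := h.length_le_card
    simpa [vis_length, ZMod.card] using this
  · intro hc x hx y hy
    by_cases hxy : x = y
    · simp [hxy]
    obtain ⟨P', rfl⟩ := Multiset.exists_cons_of_mem hx
    have hy' : y ∈ P' := by
      rcases Multiset.mem_cons.1 hy with h | h
      · exact absurd h.symm hxy
      · exact h
    obtain ⟨P'', rfl⟩ := Multiset.exists_cons_of_mem hy'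
    obtain ⟨l, rfl⟩ : ∃ l : List ℤ, (l : Multiset ℤ) = P'' := ⟨P''.toList, by simp⟩
    have n1 := nd (x :: y :: l) rfl
    have n2 := nd (y :: x :: l) (by simp [List.Perm.swap])
    have hf : (vis (0 : ZMod n) ((x :: y :: l).map (↑))).toFinset = Finset.univ := by
      rw [← Finset.card_eq_iff_eq_univ, List.toFinset_card_of_nodup n1, vis_length, ZMod.card]
      simpa using hc
    have hm : (y : ZMod n) ∈ vis (0 : ZMod n) ((x :: y :: l).map (↑)) := by
      rw [← List.mem_toFinset, hf]; simp
    simp only [List.map_cons, vis, zero_add, List.mem_cons, List.nodup_cons] at hm n2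
    have e : (x : ZMod n) + y = y + x := add_comm _ _
    rw [e] at hm
    have : (y : ZMod n) = x := by
      have h0 : ¬ (0 : ZMod n) = y := by tauto
      have h0' : ¬ (y : ZMod n) = 0 := fun h => h0 h.symm
      tauto
    exact (ZMod.intCast_eq_intCast_iff_dvd_sub _ _ _).1 this

theorem half (b : ℕ) (hb : 1 ≤ b) (P : Multiset ℤ) (q : ℕ) (hpos : ∀ x ∈ P, 0 < x)
    (hsum : P.sum = q * b)
    (hmin : ∀ t < P + Multiset.replicate q (-(b : ℤ)), t ≠ 0 → t.sum ≠ 0) :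
    Multiset.card P ≤ b ∧
      (Multiset.card P = b → ∀ x ∈ P, ∀ y ∈ P, (b : ℤ) ∣ x - y) := by
  apply dav b hb
  rintro T hT hT0 ⟨k, hk⟩
  obtain ⟨U, rfl⟩ := Multiset.le_iff_exists_add.1 hT.le
  have hU : 0 ≤ U.sum := Multiset.sum_nonneg fun y hy => (hpos y (by simp [hy])).le
  have hT1 : 0 ≤ T.sum := Multiset.sum_nonneg fun y hy => (hpos y (by simp [hy])).le
  rw [Multiset.sum_add] at hsum
  have hb' : (0 : ℤ) < b := by omega
  have hk0 : 0 ≤ k := by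
    by_contra h
    nlinarith
  have hkq : k ≤ q := by
    by_contra h
    nlinarith
  lift k to ℕ using hk0
  refine hmin (T + Multiset.replicate k (-(b : ℤ))) ?_ ?_ ?_
  · apply lt_of_le_of_ne
    · exact add_le_add hT.le ((Multiset.replicate_le_replicate _).2 (by exact_mod_cast hkq))
    · intro h
      have h1 := congrArg Multiset.card h
      have h2 := Multiset.card_lt_card hT
      simp at h1 h2
      omega
  · intro h
    simp at h
    exact hT0 h.1
  · simp [hk]; ring

theorem neg_neg_map (s : Multiset ℤ) : (s.map (fun x => -x)).map (fun x => -x) = s := by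
  rw [Multiset.map_map]; simp

theorem neg_sum (s : Multiset ℤ) : (s.map (fun x => -x)).sum = -s.sum :=
  Multiset.sum_map_neg' s

theorem neg_min (s : Multiset ℤ) (hmin : ∀ t < s, t ≠ 0 → t.sum ≠ 0) :
    ∀ t < s.map (fun x => -x), t ≠ 0 → t.sum ≠ 0 := by
  intro t ht h0 h1
  refine hmin (t.map (fun x => -x)) ?_ (by simpa using h0) (by rw [neg_sum, h1]; rfl)
  have := Multiset.map_lt_map (f := fun x : ℤ => -x) ht
  rwa [neg_neg_map] at this

theorem split_le_add (t A B : Multiset ℤ) (h : t ≤ A + B) : ∃ u ≤ A, ∃ v ≤ B, t = u + v := by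
  refine ⟨t ∩ A, Multiset.inter_le_right, t - A, tsub_le_iff_left.2 h, ?_⟩
  rw [add_comm, Multiset.sub_add_inter]

theorem rev_one (m : ℕ) (hm : 3 ≤ m) (hodd : Odd m) :
    ∀ t < Multiset.replicate (m - 2) (m : ℤ) + Multiset.replicate m (-((m : ℤ) - 2)),
      t ≠ 0 → t.sum ≠ 0 := by
  intro t ht h0 hs
  obtain ⟨u, hu, v, hv, rfl⟩ := split_le_add _ _ _ ht.le
  obtain ⟨i, hi, rfl⟩ := Multiset.le_replicate_iff.1 hu
  obtain ⟨j, hj, rfl⟩ := Multiset.le_replicate_iff.1 hv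
  have hc := Multiset.card_lt_card ht
  simp at hc hs h0
  obtain ⟨n, rfl⟩ : ∃ n, m = n + 2 := ⟨m - 2, by omega⟩
  have hs' : i * (n + 2) = j * n := by
    push_cast at hs
    have : (i : ℤ) * (n + 2) = j * n := by linarith
    exact_mod_cast this
  have hcop : Nat.Coprime n (n + 2) := by
    have h2 : Odd n := by
      rcases hodd with ⟨k, hk⟩
      exact ⟨k - 1, by omega⟩
    simpa using (Nat.coprime_two_right.2 h2)
  have hd : n ∣ i := hcop.dvd_of_dvd_mul_right (hs' ▸ Dvd.intro_left j rfl)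
  obtain ⟨k, rfl⟩ := hd
  simp at hi hj hc
  have hk : k = 0 ∨ k = 1 := by
    by_contra h
    have : 2 ≤ k := by omega
    nlinarith
  have hjk : j = k * (n + 2) := by
    have : n * j = n * (k * (n + 2)) := by nlinarith
    exact Nat.eq_of_mul_eq_mul_left (by omega) this
  rcases hk with rfl | rfl
  · simp at hjk h0
    exact h0 (by simp [hjk])
  · simp at hjk
    subst hjk
    omega

theorem rev_two (m : ℕ) (hm : 3 ≤ m) :
    ∀ t < Multiset.replicate (m - 2) (m : ℤ) + Multiset.replicate (m - 1) (-((m : ℤ) - 1))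
        + {(1 : ℤ)},
      t ≠ 0 → t.sum ≠ 0 := by
  intro t ht h0 hs
  obtain ⟨w, hw, e, he, rfl⟩ := split_le_add _ _ _ ht.le
  obtain ⟨u, hu, v, hv, rfl⟩ := split_le_add _ _ _ hw
  obtain ⟨i, hi, rfl⟩ := Multiset.le_replicate_iff.1 hu
  obtain ⟨j, hj, rfl⟩ := Multiset.le_replicate_iff.1 hv
  obtain ⟨k, hk, rfl⟩ := Multiset.le_replicate_iff.1
    (show e ≤ Multiset.replicate 1 (1 : ℤ) by simpa using he)
  have hc := Multiset.card_lt_card ht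
  simp at hc hs h0
  obtain ⟨n, rfl⟩ : ∃ n, m = n + 2 := ⟨m - 2, by omega⟩
  have hs' : (i : ℤ) + k = (j - i) * (n + 1) := by
    push_cast at hs
    linarith
  have h3 : (i : ℤ) ≤ n := by omega
  have h4 : (k : ℤ) ≤ 1 := by omega
  have h5 : (j : ℤ) - i = 0 ∨ (j : ℤ) - i = 1 := by
    have : -1 < (j : ℤ) - i := by
      by_contra h
      nlinarith
    have : (j : ℤ) - i < 2 := by
      by_contra h
      nlinarith
    omega
  rcases h5 with h5 | h5
  · rw [h5] at hs'
    have hi0 : i = 0 := by omega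
    have hk0 : k = 0 := by omega
    have hj0 : j = 0 := by omega
    subst hi0 hk0 hj0
    simp at h0
  · rw [h5] at hs'
    omega

theorem core (m : ℕ) (hm : 3 ≤ m) (s : Multiset ℤ) (hsum : s.sum = 0)
    (hmin : ∀ t < s, t ≠ 0 → t.sum ≠ 0) (hcard : Multiset.card s = 2 * m - 2)
    (h0 : (0 : ℤ) ∉ s) (a b : ℤ)
    (ha : a ∈ s) (hb : -b ∈ s) (hb1 : 1 ≤ b) (hba : b ≤ a) (ham : a ≤ m)
    (hR : ∀ x ∈ s, -b ≤ x ∧ x ≤ a) :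
    (Odd m ∧ s = Multiset.replicate (m - 2) (m : ℤ) + Multiset.replicate m (-((m : ℤ) - 2))) ∨
    s = Multiset.replicate (m - 2) (m : ℤ) + Multiset.replicate (m - 1) (-((m : ℤ) - 1))
        + {(1 : ℤ)} := by
  have hlam := lambert a b (by omega) hb1 s hsum hmin hR
  have pair : ∀ x, 1 ≤ x → x ∈ s → -x ∈ s → False := by
    intro x hx h1 h2
    have hle : (([x, -x] : List ℤ) : Multiset ℤ) ≤ s :=
      (Multiset.le_iff_subset (by simp; omega)).2 (by
        intro z hz; simp at hz; rcases hz with rfl | rfl <;> assumption)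
    refine hmin _ (lt_of_le_of_ne hle ?_) (by simp) (by simp)
    intro h
    have := congrArg Multiset.card h
    simp at this
    omega
  have hne : b ≠ a := fun h => pair b hb1 (h ▸ ha) hb
  have ha' : a = m := by omega
  -- the positive and the negative part
  obtain ⟨P, Q, hPQ, hP, hQ⟩ : ∃ P Q : Multiset ℤ, s = P + Q ∧ (∀ x ∈ P, 0 < x) ∧
      ∀ x ∈ Q, x < 0 := by
    refine ⟨s.filter (0 < ·), s.filter (fun x => ¬ 0 < x),
      (Multiset.filter_add_not _ _).symm, ?_, ?_⟩
    · intro x hx; exact (Multiset.mem_filter.1 hx).2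
    · intro x hx
      have h1 := Multiset.mem_filter.1 hx
      have : x ≠ 0 := fun h => h0 (h ▸ h1.1)
      omega
  have hPs : ∀ x ∈ P, x ∈ s := fun x hx => by rw [hPQ]; simp [hx]
  have hQs : ∀ x ∈ Q, x ∈ s := fun x hx => by rw [hPQ]; simp [hx]
  have haP : a ∈ P := by
    rw [hPQ, Multiset.mem_add] at ha
    rcases ha with h | h
    · exact h
    · have := hQ _ h; omega
  have hcardPQ : Multiset.card P + Multiset.card Q = 2 * m - 2 := by
    rw [← hcard, hPQ, Multiset.card_add]
  have hsumPQ : P.sum + Q.sum = 0 := by rw [← Multiset.sum_add, ← hPQ, hsum]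
  have hb2 : b = m - 1 ∨ b = m - 2 := by omega
  rcases hb2 with hb2 | hb2
  · right
    have hdich : (∀ x ∈ P, x = a) ∨ (∀ y ∈ Q, y = -b) := by
      by_contra hcon
      push Not at hcon
      obtain ⟨⟨x, hx, hxa⟩, y, hy, hyb⟩ := hcon
      have h1 := hR x (hPs x hx)
      have h2 := hR y (hQs y hy)
      have h3 := hP x hx
      have h4 := hQ y hy
      have h5 : x ≠ b := fun h => pair b hb1 (h ▸ hPs x hx) hb
      have := two_swap a b s hsum hmin hR (by omega) x (-y) ha hb (hPs x hx)
        (by simpa using hQs y hy) (by omega) (by omega) (by omega) (by omega)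
      omega
    rcases hdich with hall | hall
    · exfalso
      have hPr := Multiset.eq_replicate_card.2 hall
      set p := Multiset.card P with hp
      have hmin' := neg_min s hmin
      rw [hPQ, hPr, add_comm, Multiset.map_add, Multiset.map_replicate, ha'] at hmin'
      have hPsum : P.sum = p * m := by rw [hPr, ha']; simp
      obtain ⟨h1, h2⟩ := half m (by omega) (Q.map (fun x => -x)) p (by
        intro x hx
        obtain ⟨y, hy, rfl⟩ := Multiset.mem_map.1 hx
        have := hQ y hy
        omega) (by rw [neg_sum, ← hPsum]; omega) hmin'
      rw [Multiset.card_map] at h1 h2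
      have hQb : -Q.sum ≤ Multiset.card Q * b := by
        have := Multiset.sum_le_card_nsmul (Q.map (fun x => -x)) b (by
          intro x hx
          obtain ⟨y, hy, rfl⟩ := Multiset.mem_map.1 hx
          have := hR y (hQs y hy)
          omega)
        rw [neg_sum, Multiset.card_map] at this
        simpa using this
      have hlt : m ≤ Multiset.card Q := by
        by_contra hcon
        have e1 : (m : ℤ) - 1 ≤ p := by omega
        have e2 : (Multiset.card Q : ℤ) ≤ m - 1 := by omega
        nlinarith
      have hbQ : -b ∈ Q := by
        rw [hPQ, Multiset.mem_add] at hb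
        rcases hb with h | h
        · have := hP _ h; omega
        · exact h
      have hQm : Multiset.card Q = m := by omega
      have hQall : ∀ y ∈ Q, y = -b := by
        intro y hy
        obtain ⟨k, hk⟩ := h2 hQm (-y) (Multiset.mem_map_of_mem _ hy) (- -b)
          (Multiset.mem_map_of_mem _ hbQ)
        have e1 := hR y (hQs y hy)
        have e2 := hQ y hy
        have e3 : -1 < k := by
          by_contra h
          nlinarith
        have e4 : k < 1 := by
          by_contra h
          nlinarith
        have : k = 0 := by omega
        subst this
        omega
      have hQr := Multiset.eq_replicate_card.2 hQall
      have hQsum : Q.sum = -(m * b) := by rw [hQr, hQm]; simp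
      have e1 : (p : ℤ) = m - 2 := by omega
      rw [hPsum, hQsum, e1, hb2] at hsumPQ
      nlinarith
    · have hQr := Multiset.eq_replicate_card.2 hall
      set q := Multiset.card Q with hq
      obtain ⟨n, rfl⟩ : ∃ n, m = n + 1 := ⟨m - 1, by omega⟩
      have hbn : b = n := by push_cast at hb2; omega
      have hQsum : Q.sum = -(q * n) := by rw [hQr, hbn]; simp
      rw [hPQ, hQr, hbn] at hmin
      obtain ⟨h1, h2⟩ := half n (by omega) P q hP (by omega) hmin
      have hPb : P.sum ≤ Multiset.card P * a := by
        have := Multiset.sum_le_card_nsmul P a (fun x hx => (hR x (hPs x hx)).2)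
        simpa using this
      have hPn : Multiset.card P = n := by
        by_contra hcon
        have e1 : (Multiset.card P : ℤ) ≤ n - 1 := by omega
        have e2 : (n : ℤ) + 1 ≤ q := by omega
        push_cast at ha'
        rw [ha'] at hPb
        nlinarith
      have hqn : q = n := by omega
      have hPall : ∀ x ∈ P, x = 1 ∨ x = a := by
        intro x hx
        obtain ⟨k, hk⟩ := h2 hPn a haP x hx
        have e1 := hR x (hPs x hx)
        have e2 := hP x hx
        push_cast at ha'
        have e3 : -1 < k := by
          by_contra h
          nlinarith
        have e4 : k < 2 := by
          by_contra h
          nlinarith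
        have : k = 0 ∨ k = 1 := by omega
        rcases this with rfl | rfl <;> omega
      have hdec : P = P.filter (· = a) + P.filter (fun x => ¬ x = a) :=
        (Multiset.filter_add_not _ _).symm
      have r1 : P.filter (· = a) = Multiset.replicate (Multiset.card (P.filter (· = a))) a :=
        Multiset.eq_replicate_card.2 fun x hx => (Multiset.mem_filter.1 hx).2
      have r2 : P.filter (fun x => ¬ x = a) =
          Multiset.replicate (Multiset.card (P.filter (fun x => ¬ x = a))) 1 :=
        Multiset.eq_replicate_card.2 fun x hx => by
          have := Multiset.mem_filter.1 hx
          have := hPall x this.1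
          tauto
      generalize Multiset.card (P.filter (· = a)) = i at r1
      generalize Multiset.card (P.filter (fun x => ¬ x = a)) = j at r2
      rw [r1, r2] at hdec
      have c1 : i + j = n := by rw [← hPn, hdec]; simp
      have c2 : P.sum = i * a + j := by rw [hdec]; simp
      have c3 : (i : ℤ) * (n + 1) + j = n * n := by
        push_cast at ha'
        rw [c2, hQsum, hqn, ha'] at hsumPQ
        linarith
      have c4 : (i : ℤ) = n - 1 := by
        have hj : (j : ℤ) = n - i := by omega
        rw [hj] at c3
        have : (n : ℤ) * (i - (n - 1)) = 0 := by linarith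
        rcases mul_eq_zero.1 this with h | h <;> omega
      have hi : i = n + 1 - 2 := by omega
      have hj : j = 1 := by omega
      rw [hPQ, hQr, hdec, hi, hj, hqn, hbn, ha']
      simp only [Nat.add_sub_cancel, Multiset.replicate_one]
      push_cast
      rw [add_sub_cancel_right, add_right_comm]
  · left
    have hPall : ∀ x ∈ P, x = a := by
      intro x hx
      by_contra hxa
      have h1 := hR x (hPs x hx)
      have h3 := hP x hx
      have := one_swap a b s hsum hmin hR x (-b) 1 (hPs x hx) hb (by omega) (by omega) (by omega)
        (by omega) (by omega) (by omega) (by omega) (by omega) (by omega)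
      omega
    have hQall : ∀ y ∈ Q, y = -b := by
      intro y hy
      by_contra hyb
      have h1 := hR y (hQs y hy)
      have h3 := hQ y hy
      have := one_swap a b s hsum hmin hR a y 0 ha (hQs y hy) (by omega) (by omega) (by omega)
        (by omega) (by omega) (by omega) (by omega) (by omega) (by omega)
      omega
    have hPr := Multiset.eq_replicate_card.2 hPall
    have hQr := Multiset.eq_replicate_card.2 hQall
    generalize Multiset.card P = p at *
    generalize Multiset.card Q = q at *
    have hPsum : P.sum = p * m := by rw [hPr, ha']; simp
    have hQsum : Q.sum = -(q * (m - 2)) := by rw [hQr, hb2]; simp; ring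
    have hp : (p : ℤ) = m - 2 := by
      have hq : (q : ℤ) = 2 * m - 2 - p := by omega
      rw [hPsum, hQsum, hq] at hsumPQ
      have : (2 * (m : ℤ) - 2) * (p - (m - 2)) = 0 := by linarith
      rcases mul_eq_zero.1 this with h | h <;> omega
    have hp' : p = m - 2 := by omega
    have hq' : q = m := by omega
    have hs : s = Multiset.replicate (m - 2) (m : ℤ) +
        Multiset.replicate m (-((m : ℤ) - 2)) := by
      rw [hPQ, hPr, hQr, hp', hq', ha', hb2]
    refine ⟨?_, hs⟩
    by_contra hev
    obtain ⟨k, hk⟩ := Nat.not_odd_iff_even.1 hev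
    refine hmin (Multiset.replicate (k - 1) (m : ℤ) +
      Multiset.replicate k (-((m : ℤ) - 2))) ?_ ?_ ?_
    · apply lt_of_le_of_ne
      · rw [hs]
        exact add_le_add ((Multiset.replicate_le_replicate _).2 (by omega))
          ((Multiset.replicate_le_replicate _).2 (by omega))
      · intro h
        have := congrArg Multiset.card h
        rw [hcard] at this
        simp at this
        omega
    · intro h
      have := congrArg Multiset.card h
      simp at this
      omega
    · obtain ⟨n, rfl⟩ : ∃ n, k = n + 1 := ⟨k - 1, by omega⟩
      subst hk
      simp
      ring

theorem fwd (m : ℕ) (hm : 3 ≤ m) (s : Multiset ℤ)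
    (hmem : ∀ x ∈ s, x ∈ Set.Icc (-(m : ℤ)) m) (hsum : s.sum = 0)
    (hcard : Multiset.card s = 2 * m - 2) (hmin : ∀ t < s, t ≠ 0 → t.sum ≠ 0) :
    ((Odd m ∧
        (s = Multiset.replicate (m - 2) (m : ℤ) + Multiset.replicate m (-((m : ℤ) - 2)) ∨
         s = Multiset.replicate (m - 2) (-(m : ℤ)) + Multiset.replicate m ((m : ℤ) - 2))) ∨
       (s = Multiset.replicate (m - 2) (m : ℤ) +
              Multiset.replicate (m - 1) (-((m : ℤ) - 1)) + {(1 : ℤ)} ∨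
        s = Multiset.replicate (m - 2) (-(m : ℤ)) +
              Multiset.replicate (m - 1) ((m : ℤ) - 1) + {(-1 : ℤ)})) := by
  have h0 : (0 : ℤ) ∉ s := by
    intro h
    refine hmin {0} (lt_of_le_of_ne (Multiset.singleton_le.2 h) ?_) (by simp) (by simp)
    intro h
    have := congrArg Multiset.card h
    simp at this
    omega
  have hne : s ≠ 0 := by
    rintro rfl
    simp at hcard
    omega
  obtain ⟨a, ha, hamax⟩ := s.toFinset.exists_max_image id (by simpa using hne)
  obtain ⟨c, hc, hcmin⟩ := s.toFinset.exists_min_image id (by simpa using hne)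
  simp only [Multiset.mem_toFinset, id] at ha hamax hc hcmin
  have ha1 : 1 ≤ a := by
    by_contra h
    have h1 : ∀ x ∈ s, x ≤ -1 := by
      intro x hx
      have := hamax x hx
      have : x ≠ 0 := fun h => h0 (h ▸ hx)
      omega
    have := Multiset.sum_le_card_nsmul s (-1) h1
    simp at this
    omega
  have hc1 : c ≤ -1 := by
    by_contra h
    have h1 : ∀ x ∈ s, 1 ≤ x := by
      intro x hx
      have := hcmin x hx
      have : x ≠ 0 := fun h => h0 (h ▸ hx)
      omega
    have := Multiset.card_nsmul_le_sum h1
    simp at this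
    omega
  have ham := hmem a ha
  have hcm := hmem c hc
  rw [Set.mem_Icc] at ham hcm
  rcases le_total (-c) a with hle | hle
  · have := core m hm s hsum hmin hcard h0 a (-c) ha (by simpa using hc) (by omega) hle ham.2
      (fun x hx => ⟨by have := hcmin x hx; omega, hamax x hx⟩)
    tauto
  · have := core m hm (s.map (fun x => -x)) (by rw [neg_sum, hsum]; rfl) (neg_min s hmin)
      (by simpa using hcard) (by simpa using h0) (-c) a (Multiset.mem_map_of_mem _ hc)
      (Multiset.mem_map_of_mem _ ha) ha1 hle (by omega) (by
        intro x hx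
        obtain ⟨y, hy, rfl⟩ := Multiset.mem_map.1 hx
        have := hcmin y hy
        have := hamax y hy
        omega)
    rcases this with ⟨ho, h⟩ | h
    · left
      refine ⟨ho, Or.inr ?_⟩
      have := congrArg (Multiset.map (fun x => -x)) h
      rw [neg_neg_map] at this
      rw [this]
      simp
    · right
      right
      have := congrArg (Multiset.map (fun x => -x)) h
      rw [neg_neg_map] at this
      rw [this]
      simp

theorem inverse_length_2m_sub_2 (m : ℕ) (hm : 3 ≤ m) (s : Multiset ℤ)
    (hmem : ∀ x ∈ s, x ∈ Set.Icc (-(m : ℤ)) m) (hsum : s.sum = 0)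
    (hcard : Multiset.card s = 2 * m - 2) :
    IsMinZeroSumSeq (Set.Icc (-(m : ℤ)) m) s ↔
      ((Odd m ∧
        (s = Multiset.replicate (m - 2) (m : ℤ) + Multiset.replicate m (-((m : ℤ) - 2)) ∨
         s = Multiset.replicate (m - 2) (-(m : ℤ)) + Multiset.replicate m ((m : ℤ) - 2))) ∨
       (s = Multiset.replicate (m - 2) (m : ℤ) +
              Multiset.replicate (m - 1) (-((m : ℤ) - 1)) + {(1 : ℤ)} ∨
        s = Multiset.replicate (m - 2) (-(m : ℤ)) +
              Multiset.replicate (m - 1) ((m : ℤ) - 1) + {(-1 : ℤ)})) := by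
  constructor
  · rintro ⟨_, _, _, hmin⟩
    exact fwd m hm s hmem hsum hcard hmin
  · intro h
    refine ⟨?_, hmem, hsum, ?_⟩
    · rintro rfl
      simp at hcard
      omega
    · rcases h with ⟨ho, h | h⟩ | h | h
      · rw [h]; exact rev_one m hm ho
      · rw [h]
        have := neg_min _ (rev_one m hm ho)
        simpa using this
      · rw [h]; exact rev_two m hm
      · rw [h]
        have := neg_min _ (rev_two m hm)
        simpa using this
end

section
/- Let d and m₁, …, m_d be positive integers. Then D(⟦−m₁, m₁⟧ × ⋯ × ⟦−m_d, m_d⟧) ≤ ∏_{i=1}^{d} (2(d + 1/d − 1)·m_i + 1). -/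
open scoped ENNReal


section Steinitz

open Finset

variable {ι : Type*} [DecidableEq ι]

/-- A nontrivial relation among too many vectors. -/
lemma exists_rel {W : Type*} [AddCommGroup W] [Module ℝ W] [FiniteDimensional ℝ W]
    (w : ι → W) (T : Finset ι) (h : Module.finrank ℝ W < T.card) :
    ∃ γ : ι → ℝ, (∀ i, i ∉ T → γ i = 0) ∧ ∑ i ∈ T, γ i • w i = 0 ∧ ∃ i ∈ T, γ i ≠ 0 := by
  have h1 : ¬ LinearIndepOn ℝ w (T : Set ι) := by
    intro hli
    have := LinearIndependent.fintype_card_le_finrank hli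
    simp at this
    omega
  rw [linearIndepOn_finset_iff] at h1
  push Not at h1
  obtain ⟨f, hf, i, hi, hne⟩ := h1
  refine ⟨fun i => if i ∈ T then f i else 0, fun i hi => by simp [hi], ?_, i, hi, by simp [hi, hne]⟩
  rw [← hf]
  exact Finset.sum_congr rfl fun i hi => by simp [hi]

/-- Sparsify a direction. -/
lemma sparsify {W : Type*} [AddCommGroup W] [Module ℝ W] [FiniteDimensional ℝ W]
    (w : ι → W) (P F : Finset ι) (hFP : F ⊆ P)
    (hind : ∀ γ : ι → ℝ, (∀ i, i ∉ F → γ i = 0) → ∑ i ∈ P, γ i • w i = 0 → ∀ i, γ i = 0) :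
    ∀ (N : ℕ) (δ : ι → ℝ), (P.filter fun i => i ∈ F ∨ δ i ≠ 0).card = N →
      (∀ i ∈ P, i ∉ F → δ i ≤ 0) →
      ∃ δ' : ι → ℝ, (∀ i ∈ P, i ∉ F → δ' i ≤ 0) ∧ ∑ i ∈ P, δ' i • w i = ∑ i ∈ P, δ i • w i ∧
        (P.filter fun i => i ∈ F ∨ δ' i ≠ 0).card ≤ Module.finrank ℝ W := by
  intro N
  induction N using Nat.strong_induction_on with
  | _ N ih =>
  intro δ hN hδ
  by_cases hle : (P.filter fun i => i ∈ F ∨ δ i ≠ 0).card ≤ Module.finrank ℝ W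
  · exact ⟨δ, hδ, rfl, hle⟩
  push Not at hle
  set T := P.filter fun i => i ∈ F ∨ δ i ≠ 0 with hT
  have hTP : T ⊆ P := Finset.filter_subset _ _
  -- a relation with a positive entry outside F
  obtain ⟨γ, hγT, hγs, e, heP, heF, hepos⟩ : ∃ γ : ι → ℝ, (∀ i, i ∉ T → γ i = 0) ∧
      ∑ i ∈ P, γ i • w i = 0 ∧ ∃ e ∈ T, e ∉ F ∧ 0 < γ e := by
    obtain ⟨γ, h1, h2, i, hi, hne⟩ := exists_rel w T hle
    have h2' : ∑ i ∈ P, γ i • w i = 0 := by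
      rw [← h2]; symm
      exact Finset.sum_subset hTP fun x _ hx => by simp [h1 x hx]
    have : ∃ e ∈ T, e ∉ F ∧ γ e ≠ 0 := by
      by_contra hcon
      push Not at hcon
      refine hne (hind γ (fun j hj => ?_) h2' i)
      by_cases hjT : j ∈ T
      · exact hcon j hjT hj
      · exact h1 j hjT
    obtain ⟨e, heT, heF, hene⟩ := this
    rcases lt_or_gt_of_ne hene with h | h
    · refine ⟨fun i => - γ i, fun i hi => by simp [h1 i hi], ?_, e, heT, heF, by simpa using h⟩
      simp [h2']
    · exact ⟨γ, h1, h2', e, heT, heF, h⟩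
  -- ratio
  obtain ⟨j, hj, hmin⟩ := Finset.exists_min_image (T.filter fun i => i ∉ F ∧ 0 < γ i)
    (fun i => - δ i / γ i) ⟨e, by simp [heP, heF, hepos]⟩
  rw [Finset.mem_filter] at hj
  obtain ⟨hjT, hjF, hjpos⟩ := hj
  set t := - δ j / γ j with ht
  have ht0 : 0 ≤ t := div_nonneg (by have := hδ j (hTP hjT) hjF; linarith) hjpos.le
  have hj0 : δ j + t * γ j = 0 := by rw [ht, div_mul_cancel₀ _ hjpos.ne']; ring
  have hlt : (P.filter fun i => i ∈ F ∨ (δ i + t * γ i) ≠ 0).card < N := by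
    rw [← hN]
    apply Finset.card_lt_card
    rw [Finset.ssubset_iff_of_subset]
    · exact ⟨j, hjT, by simp [hjF, hj0]⟩
    · intro i hi
      rw [Finset.mem_filter] at hi
      by_contra hiT
      have hd : ¬ (i ∈ F ∨ δ i ≠ 0) := fun h => hiT (by rw [hT, Finset.mem_filter]; exact ⟨hi.1, h⟩)
      push Not at hd
      rcases hi.2 with h | h
      · exact hd.1 h
      · exact h (by rw [hd.2, hγT i hiT]; simp)
  have hneg : ∀ i ∈ P, i ∉ F → δ i + t * γ i ≤ 0 := by
    intro i hi hiF
    have h0 := hδ i hi hiF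
    by_cases hiT : i ∈ T
    · by_cases hp : 0 < γ i
      · have := hmin i (by simp [hiT, hiF, hp])
        rw [le_div_iff₀ hp] at this
        change δ i + t * γ i ≤ 0
        linarith
      · push Not at hp
        change δ i + t * γ i ≤ 0
        nlinarith
    · simp [hγT i hiT, h0]
  obtain ⟨δ', h1, h2, h3⟩ := ih _ hlt (fun i => δ i + t * γ i) rfl hneg
  refine ⟨δ', h1, ?_, h3⟩
  rw [h2]
  simp only [add_smul, Finset.sum_add_distrib, mul_smul, ← Finset.smul_sum, hγs, smul_zero, add_zero]

/-- Move along a direction until the first hit. -/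
lemma first_hit (P : Finset ι) (lo : ℝ) (x δ : ι → ℝ)
    (hx : ∀ i ∈ P, lo ≤ x i ∧ x i ≤ 1) (hδ : ∀ i ∈ P, δ i ≠ 0 → lo < x i ∧ x i < 1)
    (hne : ∃ i ∈ P, δ i ≠ 0) :
    ∃ s : ℝ, (∀ i ∈ P, lo ≤ x i + s * δ i ∧ x i + s * δ i ≤ 1) ∧
      ∃ i ∈ P, δ i ≠ 0 ∧ (x i + s * δ i = lo ∨ x i + s * δ i = 1) := by
  let r : ι → ℝ := fun i => if 0 < δ i then (1 - x i) / δ i else (x i - lo) / (- δ i)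
  obtain ⟨e, heP, hene⟩ := hne
  obtain ⟨j, hj, hmin⟩ := Finset.exists_min_image (P.filter fun i => δ i ≠ 0) r
    ⟨e, by simp [heP, hene]⟩
  rw [Finset.mem_filter] at hj
  have hrpos : ∀ i ∈ P, δ i ≠ 0 → 0 < r i := by
    intro i hi hd
    obtain ⟨h1, h2⟩ := hδ i hi hd
    simp only [r]
    split_ifs with h
    · exact div_pos (by linarith) h
    · exact div_pos (by linarith) (by have := lt_of_le_of_ne (not_lt.mp h) hd; linarith)
  refine ⟨r j, ?_, j, hj.1, hj.2, ?_⟩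
  · intro i hi
    by_cases hd : δ i = 0
    · simpa [hd] using hx i hi
    · have hm := hmin i (by simp [hi, hd])
      have hp := hrpos j hj.1 hj.2
      obtain ⟨h1, h2⟩ := hδ i hi hd
      rcases lt_or_gt_of_ne hd with h | h
      · have : r i = (x i - lo) / (- δ i) := by simp [r, not_lt.mpr h.le]
        rw [this, le_div_iff₀ (by linarith)] at hm
        constructor <;> nlinarith
      · have : r i = (1 - x i) / (δ i) := by simp [r, h]
        rw [this, le_div_iff₀ (by linarith)] at hm
        constructor <;> nlinarith
  · rcases lt_or_gt_of_ne hj.2 with h | h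
    · left
      have : r j = (x j - lo) / (- δ j) := by simp [r, not_lt.mpr h.le]
      rw [this, div_neg, neg_mul, div_mul_cancel₀ _ hj.2]; ring
    · right
      have : r j = (1 - x j) / (δ j) := by simp [r, h]
      rw [this]; field_simp; ring

/-- Reduce to independent floating coordinates or hit the lower bound. -/
lemma reduce {W : Type*} [AddCommGroup W] [Module ℝ W]
    (w : ι → W) (P : Finset ι) (lo : ℝ) :
    ∀ (N : ℕ) (x : ι → ℝ), (P.filter fun i => x i < 1).card = N →
      (∀ i ∈ P, lo ≤ x i ∧ x i ≤ 1) →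
      ∃ x' : ι → ℝ, (∀ i ∈ P, lo ≤ x' i ∧ x' i ≤ 1) ∧
        ∑ i ∈ P, x' i • w i = ∑ i ∈ P, x i • w i ∧
        (P.filter fun i => x' i < 1).card ≤ N ∧
        ((∃ i ∈ P, x' i = lo) ∨ ((∀ i ∈ P, lo < x' i) ∧
          ∀ γ : ι → ℝ, (∀ i, i ∉ (P.filter fun i => x' i < 1) → γ i = 0) →
            ∑ i ∈ P, γ i • w i = 0 → ∀ i, γ i = 0)) := by
  intro N
  induction N using Nat.strong_induction_on with
  | _ N ih =>
  intro x hN hx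
  by_cases hlo : ∃ i ∈ P, x i = lo
  · exact ⟨x, hx, rfl, hN.le, Or.inl hlo⟩
  have hlo' : ∀ i ∈ P, lo < x i := by
    push Not at hlo
    exact fun i hi => lt_of_le_of_ne (hx i hi).1 (Ne.symm (hlo i hi))
  by_cases hind : ∀ γ : ι → ℝ, (∀ i, i ∉ (P.filter fun i => x i < 1) → γ i = 0) →
            ∑ i ∈ P, γ i • w i = 0 → ∀ i, γ i = 0
  · exact ⟨x, hx, rfl, hN.le, Or.inr ⟨hlo', hind⟩⟩
  push Not at hind
  obtain ⟨γ, h1, h2, j, hj⟩ := hind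
  have hsup : ∀ i, γ i ≠ 0 → i ∈ P ∧ x i < 1 := by
    intro i hi
    by_contra hcon
    exact hi (h1 i (by simpa using hcon))
  obtain ⟨s, hs, k, hkP, hk, hhit⟩ := first_hit P lo x γ hx
    (fun i hi hd => ⟨hlo' i hi, (hsup i hd).2⟩) ⟨j, (hsup j hj).1, hj⟩
  have hsum : ∑ i ∈ P, (x i + s * γ i) • w i = ∑ i ∈ P, x i • w i := by
    simp only [add_smul, Finset.sum_add_distrib, mul_smul, ← Finset.smul_sum, h2, smul_zero, add_zero]
  have hsubset : (P.filter fun i => x i + s * γ i < 1) ⊆ (P.filter fun i => x i < 1) := by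
    intro i hi
    rw [Finset.mem_filter] at hi ⊢
    by_cases hg : γ i = 0
    · simpa [hg] using hi
    · exact hsup i hg
  rcases hhit with h | h
  · exact ⟨fun i => x i + s * γ i, hs, hsum, hN ▸ Finset.card_le_card hsubset, Or.inl ⟨k, hkP, h⟩⟩
  · have hlt : (P.filter fun i => x i + s * γ i < 1).card < N := by
      rw [← hN]
      apply Finset.card_lt_card
      rw [Finset.ssubset_iff_of_subset hsubset]
      exact ⟨k, by simpa using hsup k hk, by simp [h]⟩
    obtain ⟨x', a, b, c, e⟩ := ih _ hlt (fun i => x i + s * γ i) rfl hs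
    exact ⟨x', a, b.trans hsum, c.trans hlt.le, e⟩

/-- Main descent lemma. -/
lemma descent [Fintype ι] {W : Type*} [NormedAddCommGroup W] [NormedSpace ℝ W] [FiniteDimensional ℝ W]
    (w : ι → W) (q : W) (P : Finset ι) (lo : ℝ) (hlo : 0 ≤ lo) (x : ι → ℝ) (t : ℝ) (ht : 0 ≤ t)
    (hx : ∀ i ∈ P, lo ≤ x i ∧ x i ≤ 1) (heq : ∑ i ∈ P, x i • w i + t • q = 0)
    (hc : (P.filter fun i => x i < 1).card ≤ Module.finrank ℝ W) :
    ∃ (x' : ι → ℝ) (t' : ℝ), 0 ≤ t' ∧ t' ≤ t ∧ (∀ i ∈ P, lo ≤ x' i ∧ x' i ≤ 1) ∧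
      ∑ i ∈ P, x' i • w i + t' • q = 0 ∧
      (P.filter fun i => x' i < 1).card ≤ Module.finrank ℝ W ∧
      (t' = 0 ∨ ∃ i ∈ P, x' i = lo) := by
  -- the compact set
  let K : Set ((ι → ℝ) × ℝ) := ((Set.univ.pi fun _ => Set.Icc 0 1) ×ˢ Set.Icc 0 t) ∩
    ({z | ∀ i ∈ P, lo ≤ z.1 i} ∩ {z | ∑ i ∈ P, z.1 i • w i + z.2 • q = 0} ∩
      ⋃ F ∈ (P.powerset.filter fun F => F.card ≤ Module.finrank ℝ W),
        {z | ∀ i ∈ P, i ∉ F → z.1 i = 1})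
  have hKmem : ∀ (y : ι → ℝ) (s : ℝ), 0 ≤ s → s ≤ t → (∀ i ∈ P, lo ≤ y i ∧ y i ≤ 1) →
      ∑ i ∈ P, y i • w i + s • q = 0 → (P.filter fun i => y i < 1).card ≤ Module.finrank ℝ W →
      ((fun i => if i ∈ P then y i else 0), s) ∈ K := by
    intro y s h0 h1 h2 h3 h4
    refine ⟨⟨?_, h0, h1⟩, ⟨?_, ?_⟩, ?_⟩
    · intro i _
      by_cases hi : i ∈ P
      · simpa [hi] using ⟨hlo.trans (h2 i hi).1, (h2 i hi).2⟩
      · simp [hi]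
    · intro i hi
      simpa [hi] using (h2 i hi).1
    · simp only [Set.mem_ofPred_eq]
      rw [← h3]
      congr 1
      exact Finset.sum_congr rfl fun i hi => by simp [hi]
    · simp only [Set.mem_iUnion]
      refine ⟨P.filter fun i => y i < 1, by simp [h4], ?_⟩
      intro i hi hiF
      simp only [hi, if_true]
      simp only [Finset.mem_filter, hi, true_and, not_lt] at hiF
      exact le_antisymm (h2 i hi).2 hiF
  have hKc : IsCompact K := by
    apply IsCompact.inter_right
    · exact (isCompact_univ_pi fun _ => isCompact_Icc).prod isCompact_Icc
    · refine IsClosed.inter (IsClosed.inter ?_ ?_) ?_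
      · simp only [Set.ofPred_forall]
        exact isClosed_biInter fun i _ => isClosed_le continuous_const (by fun_prop)
      · exact isClosed_eq (by fun_prop) continuous_const
      · apply Set.Finite.isClosed_biUnion (Finset.finite_toSet _)
        intro F _
        simp only [Set.ofPred_forall]
        exact isClosed_iInter fun i => isClosed_iInter fun _ => isClosed_iInter fun _ =>
          isClosed_eq (by fun_prop) continuous_const
  obtain ⟨⟨y, s⟩, hyK, hmin⟩ := hKc.exists_isMinOn ⟨_, hKmem x t ht le_rfl hx heq hc⟩
    (f := fun z => z.2) (by fun_prop)
  obtain ⟨⟨hy1, hs0, hst⟩, ⟨hylo, hyeq⟩, hyF⟩ := hyK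
  simp only [Set.mem_iUnion] at hyF
  obtain ⟨F0, hF0, hyF⟩ := hyF
  rw [Finset.mem_filter, Finset.mem_powerset] at hF0
  have hybd : ∀ i ∈ P, lo ≤ y i ∧ y i ≤ 1 := fun i hi => ⟨hylo i hi, (hy1 i trivial).2⟩
  have hycard : (P.filter fun i => y i < 1).card ≤ Module.finrank ℝ W := by
    refine le_trans (Finset.card_le_card ?_) hF0.2
    intro i hi
    rw [Finset.mem_filter] at hi
    by_contra hn
    have := hyF i hi.1 hn
    simp only at this
    linarith [hi.2]
  simp only [Set.mem_ofPred_eq] at hyeq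
  obtain ⟨z, hz, hzs, hzc, hzo⟩ := reduce w P lo _ y rfl hybd
  have hzeq : ∑ i ∈ P, z i • w i + s • q = 0 := by rw [hzs]; exact hyeq
  refine ⟨z, s, hs0, hst, hz, hzeq, hzc.trans hycard, ?_⟩
  rcases hzo with h | ⟨hzlo, hind⟩
  · exact Or.inr h
  left
  by_contra hsne
  have hspos : 0 < s := lt_of_le_of_ne hs0 (Ne.symm hsne)
  obtain ⟨δ, hδ1, hδ2, hδ3⟩ := sparsify w P _ (Finset.filter_subset _ _) hind _ (fun i => - z i) rfl
    (fun i hi _ => by have := (hz i hi).1; linarith)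
  -- a small step
  obtain ⟨ε, hε0, hε1, hε⟩ : ∃ ε : ℝ, 0 < ε ∧ ε ≤ 1 ∧ ∀ i ∈ P, lo ≤ z i + ε * δ i ∧ z i + ε * δ i ≤ 1 := by
    have hev : ∀ᶠ ε in nhdsWithin (0:ℝ) (Set.Ioi 0), ∀ i ∈ P, lo ≤ z i + ε * δ i ∧ z i + ε * δ i ≤ 1 := by
      rw [Filter.eventually_all_finset]
      intro i hi
      have hcont : Filter.Tendsto (fun ε : ℝ => z i + ε * δ i) (nhdsWithin (0:ℝ) (Set.Ioi 0)) (nhds (z i)) := by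
        have : Continuous (fun ε : ℝ => z i + ε * δ i) := by fun_prop
        have h := this.tendsto 0
        simp only [zero_mul, add_zero] at h
        exact h.mono_left nhdsWithin_le_nhds
      have h1 := hcont.eventually (lt_mem_nhds (hzlo i hi))
      by_cases hlt : z i < 1
      · have h2 := hcont.eventually (gt_mem_nhds hlt)
        filter_upwards [h1, h2] with ε a b using ⟨a.le, b.le⟩
      · have hd := hδ1 i hi (by simp [hlt])
        filter_upwards [h1, self_mem_nhdsWithin] with ε a b
        refine ⟨a.le, ?_⟩
        have hb : 0 < ε := b
        have := (hz i hi).2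
        nlinarith
    have h3 : ∀ᶠ ε in nhdsWithin (0:ℝ) (Set.Ioi 0), ε ≤ 1 :=
      nhdsWithin_le_nhds (Iic_mem_nhds one_pos)
    obtain ⟨ε, a, b, c⟩ := (hev.and (h3.and self_mem_nhdsWithin)).exists
    exact ⟨ε, c, b, a⟩
  have hmem := hKmem (fun i => z i + ε * δ i) (s - ε * s) (by nlinarith) (by nlinarith) hε ?_ ?_
  · have := hmin hmem
    simp only [Set.mem_ofPred_eq] at this
    nlinarith
  · simp only [add_smul, Finset.sum_add_distrib, mul_smul, ← Finset.smul_sum, hδ2, sub_smul]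
    simp only [neg_smul, Finset.sum_neg_distrib, smul_neg]
    have h4 : ∑ i ∈ P, z i • w i = - (s • q) := eq_neg_of_add_eq_zero_left hzeq
    rw [h4]
    simp
  · refine le_trans (Finset.card_le_card ?_) hδ3
    intro i hi
    rw [Finset.mem_filter] at hi ⊢
    refine ⟨hi.1, ?_⟩
    by_cases hd : δ i = 0
    · left
      simpa [hd, hi.1] using hi.2
    · exact Or.inr hd

/-- Norm bound certified by a fractional relation. -/
lemma norm_bound {E : Type*} [NormedAddCommGroup E] [NormedSpace ℝ E]
    (v : ι → E) (hv : ∀ i, ‖v i‖ ≤ 1) (P : Finset ι) (u : E) (hu : ‖u‖ ≤ 1) (x : ι → ℝ) (μ lo : ℝ)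
    (hμ : 0 ≤ μ) (hx : ∀ i ∈ P, lo ≤ x i ∧ x i ≤ 1) (heq : ∑ i ∈ P, x i • v i + μ • u = 0) :
    ‖∑ i ∈ P, v i‖ ≤ (P.filter fun i => x i < 1).card * (1 - lo) + μ := by
  have h1 : ∑ i ∈ P, v i = ∑ i ∈ P, (1 - x i) • v i - μ • u := by
    simp only [sub_smul, Finset.sum_sub_distrib, one_smul]
    rw [eq_neg_of_add_eq_zero_left heq]
    abel
  have h2 : ∑ i ∈ P, (1 - x i) • v i = ∑ i ∈ P.filter (fun i => x i < 1), (1 - x i) • v i := by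
    symm
    apply Finset.sum_subset (Finset.filter_subset _ _)
    intro i hi hn
    have : x i = 1 := by
      simp only [Finset.mem_filter, hi, true_and, not_lt] at hn
      exact le_antisymm (hx i hi).2 hn
    simp [this]
  rw [h1, h2]
  refine (norm_sub_le _ _).trans (add_le_add ?_ ?_)
  · rw [← nsmul_eq_mul, ← Finset.sum_const]
    refine (norm_sum_le _ _).trans (Finset.sum_le_sum fun i hi => ?_)
    rw [Finset.mem_filter] at hi
    have := hx i hi.1
    rw [norm_smul, Real.norm_eq_abs, abs_of_nonneg (by linarith)]
    nlinarith [hv i, norm_nonneg (v i)]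
  · rw [norm_smul, Real.norm_eq_abs, abs_of_nonneg hμ]
    nlinarith [norm_nonneg u]

/-- The invariant of the construction. -/
def SteinitzInv {E : Type*} [NormedAddCommGroup E] [NormedSpace ℝ E] (v : ι → E) (d k : ℕ)
    (P : Finset ι) : Prop :=
  ∃ (u : E) (x : ι → ℝ) (μ : ℝ), ‖u‖ ≤ 1 ∧ 0 ≤ μ ∧ μ ≤ 1 / (d : ℝ) ∧
    (∀ i ∈ P, 0 ≤ x i ∧ x i ≤ 1) ∧ ∑ i ∈ P, x i • v i + μ • u = 0 ∧
    (P.filter fun i => x i < 1).card ≤ k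

lemma SteinitzInv.nice {E : Type*} [NormedAddCommGroup E] [NormedSpace ℝ E] {v : ι → E}
    (hv : ∀ i, ‖v i‖ ≤ 1) {e : ℕ} {P : Finset ι} (h : SteinitzInv v (e + 1) e P) :
    ‖∑ i ∈ P, v i‖ ≤ ((e + 1 : ℕ) : ℝ) + 1 / ((e + 1 : ℕ) : ℝ) - 1 := by
  obtain ⟨u, x, μ, hu, hμ, hμ', hx, heq, hc⟩ := h
  have := norm_bound v hv P u hu x μ 0 hμ hx heq
  have hc' : ((P.filter fun i => x i < 1).card : ℝ) ≤ e := by exact_mod_cast hc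
  push_cast at *
  linarith

lemma card_filter_erase (P : Finset ι) (x : ι → ℝ) (i : ι) (hi : i ∈ P) (h : x i < 1) (k : ℕ)
    (hc : (P.filter fun i => x i < 1).card ≤ k + 1) :
    ((P.erase i).filter fun i => x i < 1).card ≤ k := by
  rw [Finset.filter_erase, Finset.card_erase_of_mem (by simp [hi, h])]
  omega

lemma step [Fintype ι] {E : Type*} [NormedAddCommGroup E] [NormedSpace ℝ E]
    [FiniteDimensional ℝ E] {v : ι → E} (hv : ∀ i, ‖v i‖ ≤ 1) {e : ℕ}
    (hE : Module.finrank ℝ E = e + 1) {P : Finset ι} (hP : P.Nonempty) (h : SteinitzInv v (e + 1) (e + 1) P) :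
    ∃ l ∈ P, ‖∑ i ∈ P.erase l, v i‖ ≤ ((e + 1 : ℕ) : ℝ) + 1 / ((e + 1 : ℕ) : ℝ) - 1 ∧
      SteinitzInv v (e + 1) (e + 1) (P.erase l) := by
  have key : ∀ l ∈ P, SteinitzInv v (e + 1) e (P.erase l) →
      ∃ l ∈ P, ‖∑ i ∈ P.erase l, v i‖ ≤ ((e + 1 : ℕ) : ℝ) + 1 / ((e + 1 : ℕ) : ℝ) - 1 ∧
      SteinitzInv v (e + 1) (e + 1) (P.erase l) := by
    intro l hl hI
    refine ⟨l, hl, hI.nice hv, ?_⟩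
    obtain ⟨u, x, μ, hu, hμ, hμ', hx, heq, hc⟩ := hI
    exact ⟨u, x, μ, hu, hμ, hμ', hx, heq, by omega⟩
  have hdpos : (0 : ℝ) < 1 / ((e + 1 : ℕ) : ℝ) := by positivity
  have hsumerase : ∀ (x : ι → ℝ) (l : ι), l ∈ P →
      ∑ i ∈ P.erase l, x i • v i + x l • v l = ∑ i ∈ P, x i • v i :=
    fun x l hl => Finset.sum_erase_add P (fun i => x i • v i) hl
  obtain ⟨u, x0, μ0, hu, hμ0, hμ0', hx0, heq0, hc0⟩ := h
  obtain ⟨x, μ, hμ, hμle, hx, heq, hc, hout⟩ := descent v u P 0 le_rfl x0 μ0 hμ0 hx0 heq0 (by omega)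
  rw [hE] at hc
  rcases hout with hz | ⟨i, hi, hi0⟩
  swap
  · -- a coordinate vanishes
    refine key i hi ⟨u, x, μ, hu, hμ, hμle.trans hμ0', fun j hj => hx j (Finset.mem_of_mem_erase hj), ?_,
      card_filter_erase P x i hi (by rw [hi0]; norm_num) e hc⟩
    rw [← heq, ← hsumerase x i hi, hi0]
    simp
  · -- the extra vector vanishes
    subst hz
    simp only [zero_smul, add_zero] at heq
    obtain ⟨i, hi, himin⟩ := Finset.exists_min_image P x hP
    by_cases hsmall : x i ≤ 1 / ((e + 1 : ℕ) : ℝ)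
    · refine key i hi ⟨v i, x, x i, hv i, (hx i hi).1, hsmall,
        fun j hj => hx j (Finset.mem_of_mem_erase hj), by rw [hsumerase x i hi, heq], ?_⟩
      by_cases h1 : x i < 1
      · exact card_filter_erase P x i hi h1 e hc
      · have : ((P.erase i).filter fun i => x i < 1) = ∅ := by
          rw [Finset.filter_eq_empty_iff]
          intro j hj
          have := himin j (Finset.mem_of_mem_erase hj)
          linarith
        rw [this]; simp
    · push Not at hsmall
      have hlt1 : 1 / ((e + 1 : ℕ) : ℝ) < 1 := lt_of_lt_of_le hsmall (hx i hi).2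
      have hfst : ∀ y : ι → ℝ, (∑ i ∈ P, y i • ((v i, (1 : ℝ)) : E × ℝ)) =
          (∑ i ∈ P, y i • v i, ∑ i ∈ P, y i) := by
        intro y
        ext
        · simp [Prod.fst_sum]
        · simp [Prod.snd_sum]
      have hfin : Module.finrank ℝ (E × ℝ) = e + 2 := by
        rw [Module.finrank_prod, hE, Module.finrank_self]
      obtain ⟨y, t, ht0, _, hy, hyeq, hyc, hyo⟩ := descent (fun i => ((v i, (1 : ℝ)) : E × ℝ)) ((0 : E), (-1 : ℝ)) P
        (1 / ((e + 1 : ℕ) : ℝ)) hdpos.le x (∑ i ∈ P, x i)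
        (Finset.sum_nonneg fun i hi => (hx i hi).1)
        (fun j hj => ⟨hsmall.le.trans (himin j hj), (hx j hj).2⟩)
        (by rw [hfst, heq]; simp) (by omega)
      rw [hfst] at hyeq
      rw [hfin] at hyc
      have hy1 : ∑ i ∈ P, y i • v i = 0 := by
        have := congrArg Prod.fst hyeq; simpa using this
      have hy2 : ∑ i ∈ P, y i = t := by
        have := congrArg Prod.snd hyeq; simp at this; linarith
      rcases hyo with h | ⟨l, hl, hll⟩
      · exfalso
        have := Finset.sum_pos (fun i hi => lt_of_lt_of_le hdpos (hy i hi).1) hP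
        linarith
      · have hcc := card_filter_erase P y l hl (by rw [hll]; exact hlt1) (e + 1) hyc
        have heq' : ∑ i ∈ P.erase l, y i • v i + (1 / ((e + 1 : ℕ) : ℝ)) • v l = 0 := by
          rw [← hll, hsumerase y l hl, hy1]
        refine ⟨l, hl, ?_, v l, y, 1 / ((e + 1 : ℕ) : ℝ), hv l, hdpos.le, le_rfl,
          fun j hj => ⟨hdpos.le.trans (hy j (Finset.mem_of_mem_erase hj)).1,
            (hy j (Finset.mem_of_mem_erase hj)).2⟩, heq', hcc⟩
        have hb := norm_bound v hv (P.erase l) (v l) (hv l) y (1 / ((e + 1 : ℕ) : ℝ)) (1 / ((e + 1 : ℕ) : ℝ))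
          hdpos.le (fun j hj => hy j (Finset.mem_of_mem_erase hj)) heq'
        refine hb.trans ?_
        have hcc' : (((P.erase l).filter fun i => y i < 1).card : ℝ) ≤ ((e + 1 : ℕ) : ℝ) := by
          exact_mod_cast hcc
        have h3 : ((e + 1 : ℕ) : ℝ) * (1 - 1 / ((e + 1 : ℕ) : ℝ)) = ((e + 1 : ℕ) : ℝ) - 1 := by
          field_simp
        nlinarith

lemma chain_exists [Fintype ι] {E : Type*} [NormedAddCommGroup E] [NormedSpace ℝ E]
    [FiniteDimensional ℝ E] {v : ι → E} (hv : ∀ i, ‖v i‖ ≤ 1) {e : ℕ}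
    (hE : Module.finrank ℝ E = e + 1) : ∀ (N : ℕ) (P : Finset ι), P.card = N →
    ‖∑ i ∈ P, v i‖ ≤ ((e + 1 : ℕ) : ℝ) + 1 / ((e + 1 : ℕ) : ℝ) - 1 →
    SteinitzInv v (e + 1) (e + 1) P →
    ∃ C : Finset (Finset ι), C.card = N ∧ (∀ A ∈ C, A ⊆ P ∧ A.Nonempty ∧
      ‖∑ i ∈ A, v i‖ ≤ ((e + 1 : ℕ) : ℝ) + 1 / ((e + 1 : ℕ) : ℝ) - 1) ∧
      ∀ A ∈ C, ∀ B ∈ C, A ⊆ B ∨ B ⊆ A := by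
  intro N
  induction N with
  | zero => intro P _ _ _; exact ⟨∅, by simp⟩
  | succ N ih =>
    intro P hN hnice hI
    have hP : P.Nonempty := Finset.card_pos.mp (by omega)
    obtain ⟨l, hl, hn, hI'⟩ := step hv hE hP hI
    obtain ⟨C, h1, h2, h3⟩ := ih (P.erase l) (by rw [Finset.card_erase_of_mem hl]; omega) hn hI'
    refine ⟨insert P C, ?_, ?_, ?_⟩
    · rw [Finset.card_insert_of_notMem, h1]
      intro hPC
      exact Finset.notMem_erase l P ((h2 P hPC).1 hl)
    · intro A hA
      rcases Finset.mem_insert.mp hA with rfl | hA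
      · exact ⟨subset_rfl, hP, hnice⟩
      · exact ⟨(h2 A hA).1.trans (Finset.erase_subset _ _), (h2 A hA).2⟩
    · intro A hA B hB
      rcases Finset.mem_insert.mp hA with hA' | hA' <;>
        rcases Finset.mem_insert.mp hB with hB' | hB'
      · exact Or.inl (by rw [hA', hB'])
      · exact Or.inr (by rw [hA']; exact (h2 B hB').1.trans (Finset.erase_subset _ _))
      · exact Or.inl (by rw [hB']; exact (h2 A hA').1.trans (Finset.erase_subset _ _))
      · exact h3 A hA' B hB'

end Steinitz

lemma davenport_box_nat (e : ℕ) (m : Fin (e + 1) → ℕ) (hm : ∀ i, 0 < m i)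
    (s : Multiset (Fin (e + 1) → ℤ))
    (hs : IsMinZeroSumSeq {v : Fin (e + 1) → ℤ | ∀ i, v i ∈ Set.Icc (-(m i : ℤ)) (m i)} s) :
    (Multiset.card s : ℝ) ≤
      ∏ i, (2 * (((e + 1 : ℕ) : ℝ) + 1 / ((e + 1 : ℕ) : ℝ) - 1) * (m i : ℝ) + 1) := by
  obtain ⟨hs0, hsX, hsum, hmin⟩ := hs
  obtain ⟨n, v, rfl⟩ : ∃ (n : ℕ) (v : Fin n → (Fin (e + 1) → ℤ)),
      s = (Finset.univ : Finset (Fin n)).val.map v := by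
    induction s using Quotient.inductionOn with
    | h l => exact ⟨l.length, l.get, by rw [Fin.univ_val_map, List.ofFn_get]; rfl⟩
  set c : ℝ := ((e + 1 : ℕ) : ℝ) + 1 / ((e + 1 : ℕ) : ℝ) - 1 with hc
  have hc0 : 0 ≤ c := by
    rw [hc]; push_cast
    have : (0:ℝ) ≤ 1 / ((e : ℝ) + 1) := by positivity
    have : (0:ℝ) ≤ (e : ℝ) := by positivity
    linarith
  have hmpos : ∀ j, (0 : ℝ) < m j := fun j => by exact_mod_cast hm j
  let w : Fin n → (Fin (e + 1) → ℝ) := fun i j => (v i j : ℝ) / m j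
  have hw : ∀ i, ‖w i‖ ≤ 1 := by
    intro i
    rw [pi_norm_le_iff_of_nonneg zero_le_one]
    intro j
    have := hsX (v i) (by simp) j
    rw [Set.mem_Icc] at this
    simp only [w]
    rw [Real.norm_eq_abs, abs_div, abs_of_pos (hmpos j), div_le_one (hmpos j), abs_le]
    exact ⟨by exact_mod_cast this.1, by exact_mod_cast this.2⟩
  have hsum' : ∑ i, v i = 0 := hsum
  have hwsum : ∀ (A : Finset (Fin n)) (j), (∑ i ∈ A, w i) j = (((∑ i ∈ A, v i) j : ℤ) : ℝ) / m j := by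
    intro A j
    simp [w, Finset.sum_apply, Finset.sum_div]
  have hw0 : ∑ i, w i = 0 := by
    ext j
    rw [hwsum, hsum']
    simp
  obtain ⟨C, hC1, hC2, hC3⟩ := chain_exists hw (e := e) (by simp) n Finset.univ (by simp)
    (by rw [hw0, norm_zero]; exact hc0)
    ⟨0, fun _ => 1, 0, by simp, le_rfl, by positivity, by simp, by simpa using hw0, by simp⟩
  let Y : Finset (Fin (e + 1) → ℤ) := Fintype.piFinset fun j => Finset.Icc (-⌊c * m j⌋) ⌊c * m j⌋
  have hmaps : ∀ A ∈ C, ∑ i ∈ A, v i ∈ Y := by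
    intro A hA
    rw [Fintype.mem_piFinset]
    intro j
    have h1 := (norm_le_pi_norm (∑ i ∈ A, w i) j).trans (hC2 A hA).2.2
    rw [hwsum, Real.norm_eq_abs, abs_div, abs_of_pos (hmpos j), div_le_iff₀ (hmpos j), ← hc, abs_le] at h1
    rw [Finset.mem_Icc]
    refine ⟨?_, Int.le_floor.mpr h1.2⟩
    rw [neg_le]
    apply Int.le_floor.mpr
    push_cast
    linarith [h1.1]
  have hnosub : ∀ A B : Finset (Fin n), A.Nonempty → A ⊆ B → ∑ i ∈ A, v i = ∑ i ∈ B, v i → A = B := by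
    intro A B hA hAB heq
    by_contra hne
    have hss : A ⊂ B := Finset.ssubset_iff_subset_ne.mpr ⟨hAB, hne⟩
    have hD : (B \ A).Nonempty := Finset.sdiff_nonempty.mpr hss.2
    have hz : ∑ i ∈ B \ A, v i = 0 := by
      have := Finset.sum_sdiff (f := v) hAB
      rw [heq] at this
      simpa using this
    refine hmin ((B \ A).val.map v) ?_ ?_ hz
    · apply lt_of_le_of_ne
      · exact Multiset.map_le_map (Finset.val_le_iff.mpr (Finset.subset_univ _))
      · intro h
        have h2 := congrArg Multiset.card h
        simp only [Multiset.card_map, Finset.card_val] at h2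
        have h3 : B \ A = Finset.univ := Finset.eq_univ_of_card _ (by simpa using h2)
        obtain ⟨a, ha⟩ := hA
        have : a ∈ B \ A := by rw [h3]; exact Finset.mem_univ a
        exact (Finset.mem_sdiff.mp this).2 ha
    · intro h
      rw [Multiset.map_eq_zero, Finset.val_eq_zero] at h
      exact hD.ne_empty h
  have hinj : Set.InjOn (fun A : Finset (Fin n) => ∑ i ∈ A, v i) C := by
    intro A hA B hB h
    rcases hC3 A hA B hB with hs | hs
    · exact hnosub A B (hC2 A hA).2.1 hs h
    · exact (hnosub B A (hC2 B hB).2.1 hs h.symm).symm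
  have hcard := Finset.card_le_card_of_injOn _ hmaps hinj
  rw [hC1, Fintype.card_piFinset] at hcard
  have h5 : (Multiset.card ((Finset.univ : Finset (Fin n)).val.map v) : ℝ) = n := by simp
  rw [h5]
  refine le_trans (b := ((∏ j, (Finset.Icc (-⌊c * m j⌋) ⌊c * m j⌋).card : ℕ) : ℝ)) (by exact_mod_cast hcard) ?_
  push_cast
  apply Finset.prod_le_prod
  · intro j _; positivity
  · intro j _
    rw [Int.card_Icc]
    have h6 : 0 ≤ ⌊c * m j⌋ := Int.floor_nonneg.mpr (mul_nonneg hc0 (hmpos j).le)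
    have h7 : (((⌊c * m j⌋ + 1 - -⌊c * m j⌋).toNat : ℤ) : ℝ) = ((⌊c * m j⌋ + 1 - -⌊c * m j⌋ : ℤ) : ℝ) := by
      rw [Int.toNat_of_nonneg (by linarith)]
    rw [Int.cast_natCast] at h7
    rw [h7]
    push_cast
    have := Int.floor_le (c * m j)
    linarith

theorem davenport_box_upper (d : ℕ) (hd : 0 < d) (m : Fin d → ℕ) (hm : ∀ i, 0 < m i) :
    ((davenport {v : Fin d → ℤ | ∀ i, v i ∈ Set.Icc (-(m i : ℤ)) (m i)} : ℕ∞) : ℝ≥0∞) ≤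
      ENNReal.ofReal (∏ i, (2 * ((d : ℝ) + 1 / d - 1) * (m i : ℝ) + 1)) := by
  obtain ⟨e, rfl⟩ : ∃ e, d = e + 1 := ⟨d - 1, by omega⟩
  set R : ℝ := ∏ i, (2 * (((e + 1 : ℕ) : ℝ) + 1 / ((e + 1 : ℕ) : ℝ) - 1) * (m i : ℝ) + 1) with hR
  have h1 : davenport {v : Fin (e + 1) → ℤ | ∀ i, v i ∈ Set.Icc (-(m i : ℤ)) (m i)} ≤ ((⌊R⌋₊ : ℕ) : ℕ∞) := by
    unfold davenport
    refine iSup₂_le fun s hs => ?_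
    exact_mod_cast Nat.le_floor (davenport_box_nat e m hm s hs)
  have hR0 : 0 ≤ R := by
    apply Finset.prod_nonneg
    intro i _
    have h2 : (0:ℝ) ≤ ((e + 1 : ℕ) : ℝ) + 1 / ((e + 1 : ℕ) : ℝ) - 1 := by
      push_cast
      have : (0:ℝ) ≤ 1 / ((e : ℝ) + 1) := by positivity
      have : (0:ℝ) ≤ (e : ℝ) := by positivity
      linarith
    have := mul_nonneg h2 (Nat.cast_nonneg (α := ℝ) (m i))
    linarith
  refine (ENat.toENNReal_le.mpr h1).trans ?_
  rw [ENat.toENNReal_coe, ← ENNReal.ofReal_natCast]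
  exact ENNReal.ofReal_le_ofReal (Nat.floor_le hR0)
end

section
/- For every integer m ≥ 2, (2m − 1)² ≤ D(⟦−m, m⟧²) ≤ (2m + 1)(4m + 1). -/
namespace Dav

/-- No element of `A` lies in the open cone spanned by `-a` and `d`. -/
def NoCone {ι : Type*} (x y : ι → ℚ) (A : Finset ι) (ax ay dx dy : ℚ) : Prop :=
  ∀ g ∈ A, ∀ α γ : ℚ, 0 < α → 0 < γ → ¬ (x g = -α * ax + γ * dx ∧ y g = -α * ay + γ * dy)

/-- Conclusion of the pivot lemma. -/
def StepC {ι : Type*} [DecidableEq ι] (x y : ι → ℚ) (A : Finset ι) (ax ay l₀ : ℚ) : Prop :=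
  (∃ d ∈ A, ∃ e ∈ A, d ≠ e ∧ ∃ p q : ℚ, 0 ≤ p ∧ p ≤ 1 ∧ 0 ≤ q ∧ q ≤ 1 ∧
      ∑ i ∈ A, x i = p * x d + q * x e ∧ ∑ i ∈ A, y i = p * y d + q * y e) ∨
  (∃ c ∈ A, ∃ d ∈ A, c ≠ d ∧ ∃ l q : ℚ, 0 ≤ l ∧ l ≤ l₀ ∧ 0 ≤ q ∧ q ≤ 1 ∧
      ∑ i ∈ A, x i - x c + l * ax = q * x d ∧ ∑ i ∈ A, y i - y c + l * ay = q * y d ∧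
      ((|∑ i ∈ A, x i| ≤ 1 → |∑ i ∈ A, x i - x c| ≤ 1) ∨
        NoCone x y ((A.erase c).erase d) ax ay (x d) (y d)))

lemma exists_min3 (p q r : ℚ) : ∃ t, t ≤ p ∧ t ≤ q ∧ t ≤ r ∧ (t = p ∨ t = q ∨ t = r) := by
  rcases le_total p q with h | h <;> rcases le_total p r with h' | h' <;>
    rcases le_total q r with h'' | h''
  all_goals first
    | exact ⟨p, le_refl _, by linarith, by linarith, Or.inl rfl⟩
    | exact ⟨q, by linarith, le_refl _, by linarith, Or.inr (Or.inl rfl)⟩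
    | exact ⟨r, by linarith, by linarith, le_refl _, Or.inr (Or.inr rfl)⟩

/-- coordinates of a vector with respect to a basis -/
lemma coords (ax ay bx b_y ex ey : ℚ) (hD : ax * b_y - ay * bx ≠ 0) :
    ex = -(-(ex * b_y - ey * bx) / (ax * b_y - ay * bx)) * ax
        - (-(ax * ey - ay * ex) / (ax * b_y - ay * bx)) * bx ∧
    ey = -(-(ex * b_y - ey * bx) / (ax * b_y - ay * bx)) * ay
        - (-(ax * ey - ay * ex) / (ax * b_y - ay * bx)) * b_y := by
  constructor
  · rw [show -(-(ex * b_y - ey * bx) / (ax * b_y - ay * bx)) * ax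
        - (-(ax * ey - ay * ex) / (ax * b_y - ay * bx)) * bx =
        (ex * (ax * b_y - ay * bx)) / (ax * b_y - ay * bx) by ring, mul_div_cancel_right₀ _ hD]
  · rw [show -(-(ex * b_y - ey * bx) / (ax * b_y - ay * bx)) * ay
        - (-(ax * ey - ay * ex) / (ax * b_y - ay * bx)) * b_y =
        (ey * (ax * b_y - ay * bx)) / (ax * b_y - ay * bx) by ring, mul_div_cancel_right₀ _ hD]

set_option linter.unusedSectionVars false

variable {ι : Type*} [DecidableEq ι]

lemma sum_alpha (x y : ι → ℚ) (A : Finset ι) (u v : ℚ) :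
    ∑ i ∈ A, (x i * u + y i * v) = (∑ i ∈ A, x i) * u + (∑ i ∈ A, y i) * v := by
  rw [Finset.sum_add_distrib, Finset.sum_mul, Finset.sum_mul]

/-- There is an element with positive `α`-coordinate. -/
lemma exists_alpha_pos (x y : ι → ℚ) (A : Finset ι) (ax ay bx b_y l m : ℚ)
    (hD : ax * b_y - ay * bx ≠ 0) (hl : 0 < l)
    (hx : ∑ i ∈ A, x i + l * ax = m * bx) (hy : ∑ i ∈ A, y i + l * ay = m * b_y) :
    ∃ e ∈ A, 0 < -(x e * b_y - y e * bx) / (ax * b_y - ay * bx) := by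
  by_contra hcon
  push Not at hcon
  have h1 := Finset.sum_le_sum hcon
  have h2 := sum_alpha x y A (-b_y / (ax * b_y - ay * bx)) (bx / (ax * b_y - ay * bx))
  have h3 : ∑ i ∈ A, -(x i * b_y - y i * bx) / (ax * b_y - ay * bx) = l := by
    rw [show (∑ i ∈ A, -(x i * b_y - y i * bx) / (ax * b_y - ay * bx)) =
      ∑ i ∈ A, (x i * (-b_y / (ax * b_y - ay * bx)) + y i * (bx / (ax * b_y - ay * bx))) from
      Finset.sum_congr rfl (fun i _ => by ring), h2]
    rw [show ∑ i ∈ A, x i = m * bx - l * ax by linarith,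
      show ∑ i ∈ A, y i = m * b_y - l * ay by linarith]
    rw [show (m * bx - l * ax) * (-b_y / (ax * b_y - ay * bx)) +
      (m * b_y - l * ay) * (bx / (ax * b_y - ay * bx)) =
      (l * (ax * b_y - ay * bx)) / (ax * b_y - ay * bx) by ring, mul_div_cancel_right₀ _ hD]
  simp only [Finset.sum_const_zero] at h1
  linarith

lemma stepB (x y : ι → ℚ) (A : Finset ι) (ax ay l₀ l m : ℚ) (b : ι) (hb : b ∈ A)
    (hD : ax * y b - ay * x b ≠ 0) (hl : 0 < l) (hl0 : l ≤ l₀) (hm : 0 ≤ m) (hm1 : m ≤ 1)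
    (hx : ∑ i ∈ A, x i + l * ax = m * x b) (hy : ∑ i ∈ A, y i + l * ay = m * y b)
    (hno : ∀ g ∈ A, ∀ α γ : ℚ, 0 < α → 0 ≤ γ →
      ¬ (x g = -α * ax + γ * x b ∧ y g = -α * ay + γ * y b)) :
    StepC x y A ax ay l₀ := by
  classical
  set al : ι → ℚ := fun e => -(x e * y b - y e * x b) / (ax * y b - ay * x b) with hal
  set be : ι → ℚ := fun e => -(ax * y e - ay * x e) / (ax * y b - ay * x b) with hbe
  have hc : ∀ e, x e = - al e * ax - be e * x b ∧ y e = - al e * ay - be e * y b :=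
    fun e => coords ax ay (x b) (y b) (x e) (y e) hD
  obtain ⟨e₀, he₀, hpos₀⟩ := exists_alpha_pos x y A ax ay (x b) (y b) l m hD hl hx hy
  obtain ⟨e, he, hmin⟩ := Finset.exists_min_image (A.filter (fun e => 0 < al e))
    (fun e => be e / al e) ⟨e₀, Finset.mem_filter.2 ⟨he₀, hpos₀⟩⟩
  obtain ⟨heA, hpos⟩ := Finset.mem_filter.1 he
  have hbpos : 0 < be e := by
    by_contra hneg
    exact hno e heA (al e) (-be e) hpos (by linarith)
      ⟨by rw [neg_mul (be e), ← sub_eq_add_neg]; exact (hc e).1,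
       by rw [neg_mul (be e), ← sub_eq_add_neg]; exact (hc e).2⟩
  have hbe_ne : b ≠ e := by
    intro h
    have : al b = 0 := by simp only [hal]; rw [mul_comm (x b), sub_self]; simp
    rw [← h] at hpos
    linarith
  obtain ⟨hex, hey⟩ := hc e
  obtain ⟨t, ht1, ht2, ht3, ht⟩ := exists_min3 (l / al e) ((1 - m) / be e) 1
  have ht0 : 0 ≤ t := by
    rcases ht with h | h | h
    · rw [h]; positivity
    · rw [h]; exact div_nonneg (by linarith) hbpos.le
    · rw [h]; norm_num
  have h1 : t * al e ≤ l := (le_div_iff₀ hpos).1 ht1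
  have h2 : t * be e ≤ 1 - m := (le_div_iff₀ hbpos).1 ht2
  have h3 : 0 ≤ t * be e := by positivity
  have h4 : 0 ≤ t * al e := by positivity
  have tx : t * x e = -(t * al e) * ax - (t * be e) * x b := by rw [hex]; ring
  have ty : t * y e = -(t * al e) * ay - (t * be e) * y b := by rw [hey]; ring
  rcases ht with h | h | h
  · -- a is exhausted
    left
    have h5 : t * al e = l := by rw [h]; field_simp
    refine ⟨b, hb, e, heA, hbe_ne, m + t * be e, t, by linarith, by linarith, ht0, ht3, ?_, ?_⟩
    · rw [tx, h5]; linarith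
    · rw [ty, h5]; linarith
  · -- b is exhausted
    right
    have h5 : t * be e = 1 - m := by rw [h]; field_simp
    rw [h5] at tx ty
    refine ⟨b, hb, e, heA, hbe_ne, l - t * al e, t, by linarith, by linarith, ht0, ht3, ?_, ?_,
      Or.inr ?_⟩
    · rw [tx]; linarith
    · rw [ty]; linarith
    · intro g hg α γ hα hγ hg'
      have hgA : g ∈ A := Finset.mem_of_mem_erase (Finset.mem_of_mem_erase hg)
      have hag : al g = α + γ * al e := by
        simp only [hal]
        rw [hg'.1, hg'.2]
        field_simp
        ring
      have hbg : be g = γ * be e := by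
        simp only [hbe]
        rw [hg'.1, hg'.2]
        field_simp
        ring
      have hgp : 0 < al g := by rw [hag]; positivity
      have := hmin g (Finset.mem_filter.2 ⟨hgA, hgp⟩)
      rw [div_le_div_iff₀ hpos hgp, hag, hbg] at this
      have : 0 < α * be e := by positivity
      nlinarith
  · -- e is exhausted
    right
    rw [h] at h1 h2 tx ty
    refine ⟨e, heA, b, hb, hbe_ne.symm, l - al e, m + be e, by linarith, by linarith, by linarith,
      by linarith, ?_, ?_, Or.inr ?_⟩
    · linarith
    · linarith
    · intro g hg α γ hα hγ hg'
      exact hno g (Finset.mem_of_mem_erase (Finset.mem_of_mem_erase hg)) α γ hα hγ.le hg'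

end Dav

namespace Dav

set_option linter.unusedSectionVars false

variable {ι : Type*} [DecidableEq ι]

lemma xmono (xa xb l m l' m' : ℚ) (ha : |xa| ≤ 1) (hb : |xb| ≤ 1) (h : |m * xb - l * xa| ≤ 1)
    (h1 : 0 ≤ l') (h2 : l' ≤ l) (h3 : l ≤ 1) (h4 : 0 ≤ m') (h5 : m' ≤ m) (h6 : m ≤ 1) :
    |m' * xb - l' * xa| ≤ 1 := by
  rw [abs_le] at *
  obtain ⟨ha1, ha2⟩ := ha
  obtain ⟨hb1, hb2⟩ := hb
  obtain ⟨hh1, hh2⟩ := h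
  rcases le_total 0 xa with sa | sa <;> rcases le_total 0 xb with sb | sb
  · have e1 : 0 ≤ m' * xb := by positivity
    have e2 : 0 ≤ l' * xa := by positivity
    have e3 : m' * xb ≤ 1 := by nlinarith
    have e4 : l' * xa ≤ 1 := by nlinarith
    constructor <;> linarith
  · have e1 : m * xb ≤ m' * xb := by nlinarith
    have e2 : l' * xa ≤ l * xa := by nlinarith
    have e3 : m' * xb ≤ 0 := by nlinarith
    have e4 : 0 ≤ l' * xa := by nlinarith
    constructor <;> linarith
  · have e1 : m' * xb ≤ m * xb := by nlinarith
    have e2 : l * xa ≤ l' * xa := by nlinarith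
    have e3 : 0 ≤ m' * xb := by nlinarith
    have e4 : l' * xa ≤ 0 := by nlinarith
    constructor <;> linarith
  · have e1 : m' * xb ≤ 0 := by nlinarith
    have e2 : l' * xa ≤ 0 := by nlinarith
    have e3 : -1 ≤ m' * xb := by nlinarith
    have e4 : -1 ≤ l' * xa := by nlinarith
    constructor <;> linarith

lemma step1 (x y : ι → ℚ) (A : Finset ι) (ax ay l₀ l : ℚ)
    (ha : 0 < ax ^ 2 + ay ^ 2) (hl : 0 < l) (hl0 : l ≤ l₀)
    (hx : ∑ i ∈ A, x i + l * ax = 0) (hy : ∑ i ∈ A, y i + l * ay = 0)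
    (hanti : ∀ e ∈ A, ∀ k : ℚ, 0 < k → ¬ (x e = -k * ax ∧ y e = -k * ay)) :
    StepC x y A ax ay l₀ := by
  have hscr : ∑ i ∈ A, (x i * (-ay) + y i * ax) = 0 := by
    rw [sum_alpha, show ∑ i ∈ A, x i = - l * ax by linarith,
      show ∑ i ∈ A, y i = - l * ay by linarith]
    ring
  have hsdot : ∑ i ∈ A, (x i * ax + y i * ay) = - l * (ax ^ 2 + ay ^ 2) := by
    rw [sum_alpha, show ∑ i ∈ A, x i = - l * ax by linarith,
      show ∑ i ∈ A, y i = - l * ay by linarith]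
    ring
  have hex : ∃ e ∈ A, 0 < x e * (-ay) + y e * ax := by
    by_contra hcon
    push Not at hcon
    have hz := (Finset.sum_eq_zero_iff_of_nonpos hcon).1 hscr
    have : 0 ≤ ∑ i ∈ A, (x i * ax + y i * ay) := by
      refine Finset.sum_nonneg (fun i hi => ?_)
      by_contra hneg
      push Not at hneg
      have hzi := hz i hi
      refine hanti i hi (-(x i * ax + y i * ay) / (ax ^ 2 + ay ^ 2))
        (div_pos (by linarith) ha) ⟨?_, ?_⟩
      · rw [show -(-(x i * ax + y i * ay) / (ax ^ 2 + ay ^ 2)) * ax =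
          ((x i * ax + y i * ay) * ax) / (ax ^ 2 + ay ^ 2) by ring, eq_div_iff ha.ne']
        linear_combination (-ay) * hzi
      · rw [show -(-(x i * ax + y i * ay) / (ax ^ 2 + ay ^ 2)) * ay =
          ((x i * ax + y i * ay) * ay) / (ax ^ 2 + ay ^ 2) by ring, eq_div_iff ha.ne']
        linear_combination ax * hzi
    have : 0 < l * (ax ^ 2 + ay ^ 2) := by positivity
    linarith
  obtain ⟨e₀, he₀, hpos₀⟩ := hex
  obtain ⟨b, hbf, hmin⟩ := Finset.exists_min_image
    (A.filter (fun e => 0 < x e * (-ay) + y e * ax))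
    (fun e => (x e * ax + y e * ay) / (x e * (-ay) + y e * ax))
    ⟨e₀, Finset.mem_filter.2 ⟨he₀, hpos₀⟩⟩
  obtain ⟨hb, hpos⟩ := Finset.mem_filter.1 hbf
  refine stepB x y A ax ay l₀ l 0 b hb ?_ hl hl0 le_rfl zero_le_one (by linarith) (by linarith) ?_
  · intro h
    nlinarith
  · intro g hg α γ hα hγ hg'
    rcases hγ.eq_or_lt with h0 | h0
    · refine hanti g hg α hα ⟨?_, ?_⟩
      · rw [hg'.1, ← h0]; ring
      · rw [hg'.2, ← h0]; ring
    · have e1 : x g * (-ay) + y g * ax = γ * (x b * (-ay) + y b * ax) := by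
        rw [hg'.1, hg'.2]; ring
      have e2 : x g * ax + y g * ay = -α * (ax ^ 2 + ay ^ 2) + γ * (x b * ax + y b * ay) := by
        rw [hg'.1, hg'.2]; ring
      have hgp : 0 < x g * (-ay) + y g * ax := by rw [e1]; positivity
      have h1 := hmin g (Finset.mem_filter.2 ⟨hg, hgp⟩)
      rw [div_le_div_iff₀ hpos hgp, e1, e2] at h1
      have : 0 < α * (ax ^ 2 + ay ^ 2) * (x b * (-ay) + y b * ax) := by positivity
      nlinarith

lemma step0 (x y : ι → ℚ) (A : Finset ι) (ax ay l₀ l m : ℚ) (b : ι) (hb : b ∈ A)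
    (hA : ∀ b ∈ A, ∃ d ∈ A, d ≠ b) (hX : ∀ i ∈ A, |x i| ≤ 1) (hax : |ax| ≤ 1)
    (hl : 0 ≤ l) (hl0 : l ≤ l₀) (hl1 : l ≤ 1) (hm : 0 ≤ m) (hm1 : m ≤ 1)
    (hx : ∑ i ∈ A, x i + l * ax = m * x b) (hy : ∑ i ∈ A, y i + l * ay = m * y b)
    (e : ι) (he : e ∈ A) (k : ℚ) (hk : 0 < k) (hex : x e = -k * ax) (hey : y e = -k * ay) :
    StepC x y A ax ay l₀ := by
  by_cases heb : e = b
  · subst heb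
    obtain ⟨d, hd, hdb⟩ := hA e he
    by_cases h : m + l / k ≤ 1
    · left
      refine ⟨e, he, d, hd, hdb.symm, m + l / k, 0, by positivity, h, le_rfl, zero_le_one, ?_, ?_⟩
      · have : (l / k) * x e = - l * ax := by rw [hex]; field_simp
        linarith
      · have : (l / k) * y e = - l * ay := by rw [hey]; field_simp
        linarith
    · right
      push Not at h
      have h1 : (1 - m) * k < l := by
        rw [← lt_div_iff₀ hk]; linarith
      have h2 : 0 ≤ (1 - m) * k := mul_nonneg (by linarith) hk.le
      have ex : ∑ i ∈ A, x i - x e + (l - (1 - m) * k) * ax = 0 * x d := by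
        have : (1 - m) * x e = (1 - m) * (- k * ax) := by rw [hex]
        linarith
      have ey : ∑ i ∈ A, y i - y e + (l - (1 - m) * k) * ay = 0 * y d := by
        have : (1 - m) * y e = (1 - m) * (- k * ay) := by rw [hey]
        linarith
      refine ⟨e, he, d, hd, hdb.symm, l - (1 - m) * k, 0, by linarith, by linarith, le_rfl,
        zero_le_one, ex, ey, Or.inl ?_⟩
      intro _
      rw [show ∑ i ∈ A, x i - x e = -((l - (1 - m) * k) * ax) by linarith, abs_neg, abs_mul]
      have : |l - (1 - m) * k| ≤ 1 := by rw [abs_le]; constructor <;> linarith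
      exact mul_le_one₀ this (abs_nonneg _) hax
  · by_cases h : k ≤ l
    · right
      refine ⟨e, he, b, hb, heb, l - k, m, by linarith, by linarith, hm, hm1, by linarith,
        by linarith, Or.inl ?_⟩
      intro hP
      rw [show ∑ i ∈ A, x i = m * x b - l * ax by linarith] at hP ⊢
      have := xmono ax (x b) l m (l - k) m hax (hX b hb) hP (by linarith) (by linarith) hl1 hm
        le_rfl hm1
      rw [hex, show m * x b - l * ax - -k * ax = m * x b - (l - k) * ax by ring]
      exact this
    · left
      push Not at h
      refine ⟨b, hb, e, he, fun h => heb h.symm, m, l / k, hm, hm1, by positivity, ?_, ?_, ?_⟩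
      · rw [div_le_one hk]; exact h.le
      · have : (l / k) * x e = - l * ax := by rw [hex]; field_simp
        linarith
      · have : (l / k) * y e = - l * ay := by rw [hey]; field_simp
        linarith

end Dav

namespace Dav

set_option linter.unusedSectionVars false

variable {ι : Type*} [DecidableEq ι]

lemma step2 (x y : ι → ℚ) (A : Finset ι) (ax ay l₀ l m : ℚ) (b : ι) (hb : b ∈ A)
    (hA : ∀ b ∈ A, ∃ d ∈ A, d ≠ b) (hX : ∀ i ∈ A, |x i| ≤ 1) (hax : |ax| ≤ 1)
    (ha : 0 < ax ^ 2 + ay ^ 2)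
    (hl : 0 ≤ l) (hl0 : l ≤ l₀) (hl1 : l ≤ 1) (hm : 0 ≤ m) (hm1 : m ≤ 1)
    (hD : ax * y b - ay * x b ≠ 0)
    (hx : ∑ i ∈ A, x i + l * ax = m * x b) (hy : ∑ i ∈ A, y i + l * ay = m * y b)
    (hanti : ∀ e ∈ A, ∀ k : ℚ, 0 < k → ¬ (x e = -k * ax ∧ y e = -k * ay))
    (hmin : ∀ g ∈ A, ∀ l' m' : ℚ, ax * y g - ay * x g ≠ 0 → 0 ≤ l' → l' < l → 0 ≤ m' → m' ≤ 1 →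
      ∑ i ∈ A, x i + l' * ax = m' * x g → ∑ i ∈ A, y i + l' * ay = m' * y g → False) :
    StepC x y A ax ay l₀ := by
  rcases hl.eq_or_lt with h0 | hlp
  · left
    obtain ⟨d, hd, hdb⟩ := hA b hb
    subst h0
    exact ⟨b, hb, d, hd, hdb.symm, m, 0, hm, hm1, le_rfl, zero_le_one, by linarith, by linarith⟩
  rcases hm.eq_or_lt with h0 | hmp
  · subst h0
    exact step1 x y A ax ay l₀ l ha hlp hl0 (by linarith) (by linarith) hanti
  by_cases hno : ∀ g ∈ A, ∀ α γ : ℚ, 0 < α → 0 < γ →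
      ¬ (x g = -α * ax + γ * x b ∧ y g = -α * ay + γ * y b)
  · refine stepB x y A ax ay l₀ l m b hb hD hlp hl0 hm hm1 hx hy ?_
    intro g hg α γ hα hγ hg'
    rcases hγ.eq_or_lt with h0 | h0
    · refine hanti g hg α hα ⟨?_, ?_⟩
      · rw [hg'.1, ← h0]; ring
      · rw [hg'.2, ← h0]; ring
    · exact hno g hg α γ hα h0 hg'
  · push Not at hno
    obtain ⟨e, he, α, γ, hα, hγ, hex, hey⟩ := hno
    have heb : b ≠ e := by
      intro h
      subst h
      have h3 : α * (ax * y b - ay * x b) = 0 := by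
        linear_combination (y b) * hex - (x b) * hey
      rcases mul_eq_zero.1 h3 with h | h
      · exact hα.ne' h
      · exact hD h
    obtain ⟨t, ht1, ht2, ht3, ht⟩ := exists_min3 (l / α) (m / γ) 1
    have ht0 : 0 < t := by
      rcases ht with h | h | h
      · rw [h]; positivity
      · rw [h]; positivity
      · rw [h]; norm_num
    have h1 : t * α ≤ l := (le_div_iff₀ hα).1 ht1
    have h2 : t * γ ≤ m := (le_div_iff₀ hγ).1 ht2
    have h3 : 0 < t * α := by positivity
    have h4 : 0 < t * γ := by positivity
    have tx : t * x e = -(t * α) * ax + (t * γ) * x b := by rw [hex]; ring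
    have ty : t * y e = -(t * α) * ay + (t * γ) * y b := by rw [hey]; ring
    rcases ht with h | h | h
    · left
      have h5 : t * α = l := by rw [h]; field_simp
      refine ⟨b, hb, e, he, heb, m - t * γ, t, by linarith, by linarith, ht0.le, ht3, ?_, ?_⟩
      · rw [tx, h5]; linarith
      · rw [ty, h5]; linarith
    · exfalso
      have h5 : t * γ = m := by rw [h]; field_simp
      refine hmin e he (l - t * α) t ?_ (by linarith) (by linarith) ht0.le ht3 ?_ ?_
      · rw [show ax * y e - ay * x e = γ * (ax * y b - ay * x b) by rw [hex, hey]; ring]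
        exact mul_ne_zero hγ.ne' hD
      · rw [tx, h5]; linarith
      · rw [ty, h5]; linarith
    · right
      rw [h] at h1 h2 tx ty
      refine ⟨e, he, b, hb, heb.symm, l - α, m - γ, by linarith, by linarith, by linarith,
        by linarith, by linarith, by linarith, Or.inl ?_⟩
      intro hP
      rw [show ∑ i ∈ A, x i = m * x b - l * ax by linarith] at hP ⊢
      have := xmono ax (x b) l m (l - α) (m - γ) hax (hX b hb) hP (by linarith) (by linarith) hl1
        (by linarith) (by linarith) hm1
      rw [hex, show m * x b - l * ax - (-α * ax + γ * x b) =
        (m - γ) * x b - (l - α) * ax by ring]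
      exact this

lemma step (x y : ι → ℚ) (A : Finset ι) (ax ay l₀ m : ℚ) (b : ι) (hb : b ∈ A)
    (hA : ∀ b ∈ A, ∃ d ∈ A, d ≠ b) (hX : ∀ i ∈ A, |x i| ≤ 1) (hax : |ax| ≤ 1)
    (hl : 0 ≤ l₀) (hl1 : l₀ ≤ 1) (hm : 0 ≤ m) (hm1 : m ≤ 1)
    (hx : ∑ i ∈ A, x i + l₀ * ax = m * x b) (hy : ∑ i ∈ A, y i + l₀ * ay = m * y b) :
    StepC x y A ax ay l₀ := by
  classical
  by_cases hanti : ∀ e ∈ A, ∀ k : ℚ, 0 < k → ¬ (x e = -k * ax ∧ y e = -k * ay)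
  swap
  · push Not at hanti
    obtain ⟨e, he, k, hk, hex, hey⟩ := hanti
    exact step0 x y A ax ay l₀ l₀ m b hb hA hX hax hl le_rfl hl1 hm hm1 hx hy e he k hk hex hey
  have ha0 : 0 ≤ ax ^ 2 + ay ^ 2 := by positivity
  rcases ha0.eq_or_lt with h0 | ha
  · left
    have h1 : ax = 0 := by nlinarith [sq_nonneg ax, sq_nonneg ay]
    have h2 : ay = 0 := by nlinarith [sq_nonneg ax, sq_nonneg ay]
    obtain ⟨d, hd, hdb⟩ := hA b hb
    subst h1
    subst h2
    exact ⟨b, hb, d, hd, hdb.symm, m, 0, hm, hm1, le_rfl, zero_le_one, by linarith, by linarith⟩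
  rcases hl.eq_or_lt with h0 | hlp
  · left
    obtain ⟨d, hd, hdb⟩ := hA b hb
    subst h0
    exact ⟨b, hb, d, hd, hdb.symm, m, 0, hm, hm1, le_rfl, zero_le_one, by linarith, by linarith⟩
  set PX := ∑ i ∈ A, x i with hPX
  set PY := ∑ i ∈ A, y i with hPY
  have key : ∀ g : ι, ∀ l' m' : ℚ, ax * y g - ay * x g ≠ 0 → PX + l' * ax = m' * x g →
      PY + l' * ay = m' * y g → l' = -(PX * y g - PY * x g) / (ax * y g - ay * x g) ∧
        m' = (ax * PY - ay * PX) / (ax * y g - ay * x g) := by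
    intro g l' m' hD h1 h2
    rw [eq_div_iff hD, eq_div_iff hD]
    constructor
    · linear_combination (y g) * h1 - (x g) * h2
    · linear_combination ay * h1 - ax * h2
  by_cases hV : (A.filter (fun g => ax * y g - ay * x g ≠ 0 ∧ ∃ l' m' : ℚ, 0 ≤ l' ∧ l' ≤ l₀ ∧
      0 ≤ m' ∧ m' ≤ 1 ∧ PX + l' * ax = m' * x g ∧ PY + l' * ay = m' * y g)).Nonempty
  · obtain ⟨c, hc, hcmin⟩ := Finset.exists_min_image _
      (fun g => -(PX * y g - PY * x g) / (ax * y g - ay * x g)) hV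
    obtain ⟨hcA, hcD, l, m', hl', hlu, hm', hmu, hcx, hcy⟩ := Finset.mem_filter.1 hc
    refine step2 x y A ax ay l₀ l m' c hcA hA hX hax ha hl' hlu (by linarith) hm' hmu hcD
      hcx hcy hanti ?_
    intro g hg l'' m'' hgD g1 g2 g3 g4 g5 g6
    have := hcmin g (Finset.mem_filter.2 ⟨hg, hgD, l'', m'', g1, by linarith, g3, g4, g5, g6⟩)
    rw [← (key g l'' m'' hgD g5 g6).1, ← (key c l m' hcD hcx hcy).1] at this
    linarith
  · have hD : ax * y b - ay * x b = 0 := by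
      by_contra hD
      exact hV ⟨b, Finset.mem_filter.2 ⟨hb, hD, l₀, m, hl, le_rfl, hm, hm1, hx, hy⟩⟩
    obtain ⟨k, hkx, hky⟩ : ∃ k : ℚ, x b = k * ax ∧ y b = k * ay := by
      refine ⟨(x b * ax + y b * ay) / (ax ^ 2 + ay ^ 2), ?_, ?_⟩
      · rw [div_mul_eq_mul_div, eq_div_iff ha.ne']
        linear_combination (-ay) * hD
      · rw [div_mul_eq_mul_div, eq_div_iff ha.ne']
        linear_combination ax * hD
    have hk : 0 ≤ k := by
      by_contra hk
      push Not at hk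
      exact hanti b hb (-k) (by linarith) ⟨by rw [hkx]; ring, by rw [hky]; ring⟩
    by_cases h : l₀ ≤ m * k
    · left
      have hk' : 0 < k := by
        rcases hk.eq_or_lt with h0 | h0
        · rw [← h0] at h; linarith
        · exact h0
      obtain ⟨d, hd, hdb⟩ := hA b hb
      have h1 : l₀ / k ≤ m := (div_le_iff₀ hk').2 h
      have h2 : 0 ≤ l₀ / k := by positivity
      refine ⟨b, hb, d, hd, hdb.symm, m - l₀ / k, 0, by linarith, by linarith, le_rfl,
        zero_le_one, ?_, ?_⟩
      · have : (l₀ / k) * x b = l₀ * ax := by rw [hkx]; field_simp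
        linarith
      · have : (l₀ / k) * y b = l₀ * ay := by rw [hky]; field_simp
        linarith
    · push Not at h
      have : 0 ≤ m * k := by positivity
      refine step1 x y A ax ay l₀ (l₀ - m * k) ha (by linarith) (by linarith) ?_ ?_ hanti
      · rw [hkx] at hx; linarith
      · rw [hky] at hy; linarith

end Dav

namespace Dav

set_option linter.unusedSectionVars false

variable {ι : Type*} [DecidableEq ι]

/-- The elements of `A` can be removed one by one so that all remaining sums stay in
`[-1, 1] × [-2, 2]`. -/
inductive Good (x y : ι → ℚ) : Finset ι → Prop
  | empty : Good x y ∅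
  | cons (A : Finset ι) (c : ι) (hc : c ∈ A) (hx : |∑ i ∈ A, x i| ≤ 1)
      (hy : |∑ i ∈ A, y i| ≤ 2) (h : Good x y (A.erase c)) : Good x y A

def PI (x y : ι → ℚ) (A : Finset ι) : Prop :=
  |∑ i ∈ A, x i| ≤ 1 → ∀ a ∈ A, ∀ b ∈ A, a ≠ b → ∀ p q : ℚ, 0 ≤ p → p ≤ 1 → 0 ≤ q → q ≤ 1 →
    ∑ i ∈ A, x i = p * x a + q * x b → ∑ i ∈ A, y i = p * y a + q * y b → Good x y A

def PII (x y : ι → ℚ) (A : Finset ι) : Prop :=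
  |∑ i ∈ A, x i| ≤ 1 → ∀ ax ay l q : ℚ, |ax| ≤ 1 → |ay| ≤ 1 → 0 ≤ l → l ≤ 1 / 2 → ∀ b ∈ A,
    0 ≤ q → q ≤ 1 → ∑ i ∈ A, x i + l * ax = q * x b → ∑ i ∈ A, y i + l * ay = q * y b →
    Good x y A

def PIII (x y : ι → ℚ) (A : Finset ι) : Prop :=
  ∀ ax ay dx dy la ld : ℚ, |ax| ≤ 1 → |ay| ≤ 1 → |dx| ≤ 1 → |dy| ≤ 1 → ax * dx < 0 →
    0 ≤ la → la ≤ 1 / 2 → 0 ≤ ld → ld ≤ 1 / 2 →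
    ∑ i ∈ A, x i = -la * ax - ld * dx → ∑ i ∈ A, y i = -la * ay - ld * dy →
    NoCone x y A ax ay dx dy → Good x y A

lemma abs_mul_le {p u c : ℚ} (hp : 0 ≤ p) (hc : p ≤ c) (hu : |u| ≤ 1) : |p * u| ≤ c := by
  rw [abs_mul, abs_of_nonneg hp]
  nlinarith [abs_nonneg u]

lemma sum_erase' (f : ι → ℚ) (A : Finset ι) (c : ι) (hc : c ∈ A) :
    ∑ i ∈ A.erase c, f i = ∑ i ∈ A, f i - f c := by
  rw [← Finset.add_sum_erase A f hc]; ring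

lemma arithI (xc xd xe p q : ℚ) (hc : |xc| ≤ 1) (hd : |xd| ≤ 1) (he : |xe| ≤ 1)
    (hp : 0 ≤ p) (hp1 : p ≤ 1) (hq : 0 ≤ q) (hpq : q ≤ p)
    (hbig : 1 < |p * xd + q * xe|) (hP : |xc + p * xd + q * xe| ≤ 1) :
    1 / 2 ≤ p ∧ |xc + p * xd + q * xe - xd| ≤ 1 ∧
      |xc + p * xd + q * xe - xd - xc| ≤ 1 := by
  rw [abs_le] at hc hd he hP
  obtain ⟨hc1, hc2⟩ := hc
  obtain ⟨hd1, hd2⟩ := hd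
  obtain ⟨he1, he2⟩ := he
  obtain ⟨hP1, hP2⟩ := hP
  rcases lt_abs.1 hbig with h | h
  · have e1 : p * xd ≤ p := by nlinarith
    have e2 : q * xe ≤ q := by nlinarith
    have sd : 0 < xd := by
      by_contra hs
      push Not at hs
      nlinarith
    have se : 0 < xe := by
      by_contra hs
      push Not at hs
      nlinarith
    have e3 : 0 ≤ q * xe := by positivity
    have e4 : 0 ≤ (1 - p) * xd := mul_nonneg (by linarith) sd.le
    have e5 : (1 - p) * xd ≤ 1 := by nlinarith
    refine ⟨by linarith, abs_le.2 ⟨by linarith, by linarith⟩, abs_le.2 ⟨by linarith, by linarith⟩⟩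
  · have e1 : -p ≤ p * xd := by nlinarith
    have e2 : -q ≤ q * xe := by nlinarith
    have sd : xd < 0 := by
      by_contra hs
      push Not at hs
      nlinarith
    have se : xe < 0 := by
      by_contra hs
      push Not at hs
      nlinarith
    have e3 : q * xe ≤ 0 := by nlinarith
    have e4 : (1 - p) * xd ≤ 0 := by nlinarith
    have e5 : -1 ≤ (1 - p) * xd := by nlinarith
    refine ⟨by linarith, abs_le.2 ⟨by linarith, by linarith⟩, abs_le.2 ⟨by linarith, by linarith⟩⟩

lemma arithII (xc xd ax l q : ℚ) (hc : |xc| ≤ 1) (hd : |xd| ≤ 1) (ha : |ax| ≤ 1)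
    (hl : 0 ≤ l) (hl1 : l ≤ 1 / 2) (hq : 0 ≤ q) (hq1 : q ≤ 1)
    (hbig : 1 < |q * xd - l * ax|) (hP : |xc + q * xd - l * ax| ≤ 1) :
    1 / 2 ≤ q ∧ ax * xd < 0 ∧ |xc + q * xd - l * ax - xd| ≤ 1 := by
  rw [abs_le] at hc hd ha hP
  obtain ⟨hc1, hc2⟩ := hc
  obtain ⟨hd1, hd2⟩ := hd
  obtain ⟨ha1, ha2⟩ := ha
  obtain ⟨hP1, hP2⟩ := hP
  rcases lt_abs.1 hbig with h | h
  · have e1 : q * xd ≤ q := by nlinarith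
    have e2 : -l ≤ l * ax := by nlinarith
    have sd : 0 < xd := by
      by_contra hs
      push Not at hs
      nlinarith
    have sa : ax < 0 := by
      by_contra hs
      push Not at hs
      nlinarith
    refine ⟨by linarith, by nlinarith, abs_le.2 ⟨by linarith, by linarith⟩⟩
  · have e1 : -q ≤ q * xd := by nlinarith
    have e2 : l * ax ≤ l := by nlinarith
    have sd : xd < 0 := by
      by_contra hs
      push Not at hs
      nlinarith
    have sa : 0 < ax := by
      by_contra hs
      push Not at hs
      nlinarith
    refine ⟨by linarith, by nlinarith, abs_le.2 ⟨by linarith, by linarith⟩⟩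

lemma exists_t (α β la ld : ℚ) (hα : 0 < α) (hβ : 0 ≤ β) (hla : 0 ≤ la) (hld : 0 ≤ ld) :
    ∃ t : ℚ, 0 ≤ t ∧ t ≤ 1 ∧ t * α ≤ la ∧ t * β ≤ ld ∧ (t * α = la ∨ t * β = ld ∨ t = 1) := by
  rcases hβ.eq_or_lt with h | h
  · obtain ⟨t, h1, h2, -, h4⟩ := exists_min3 (la / α) 1 1
    rw [le_div_iff₀ hα] at h1
    have h0 : 0 ≤ t := by
      rcases h4 with h | h | h
      · rw [h]; positivity
      · rw [h]; norm_num
      · rw [h]; norm_num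
    refine ⟨t, h0, h2, h1, by rw [← h]; linarith, ?_⟩
    rcases h4 with h | h | h
    · left; rw [h]; field_simp
    · exact Or.inr (Or.inr h)
    · exact Or.inr (Or.inr h)
  · obtain ⟨t, h1, h2, h3, h4⟩ := exists_min3 (la / α) (ld / β) 1
    rw [le_div_iff₀ hα] at h1
    rw [le_div_iff₀ h] at h2
    have h0 : 0 ≤ t := by
      rcases h4 with h | h | h
      · rw [h]; positivity
      · rw [h]; positivity
      · rw [h]; norm_num
    refine ⟨t, h0, h3, h1, h2, ?_⟩
    rcases h4 with h | h | h
    · left; rw [h]; field_simp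
    · right; left; rw [h]; field_simp
    · exact Or.inr (Or.inr h)

lemma finishI' (x y : ι → ℚ) (hX : ∀ i, |x i| ≤ 1) (hY : ∀ i, |y i| ≤ 1)
    (A : Finset ι) (c d e : ι) (hc : c ∈ A) (hd : d ∈ A) (he : e ∈ A)
    (hcd : c ≠ d) (hce : c ≠ e) (hde : d ≠ e) (p q : ℚ)
    (hp1 : p ≤ 1) (hq : 0 ≤ q) (hpq : q ≤ p)
    (hPx : |∑ i ∈ A, x i| ≤ 1) (hPy : |∑ i ∈ A, y i| ≤ 2)
    (ex : ∑ i ∈ A, x i = x c + p * x d + q * x e)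
    (ey : ∑ i ∈ A, y i = y c + p * y d + q * y e)
    (IH1 : ∀ B : Finset ι, B.card < A.card → PI x y B)
    (IH2 : ∀ B : Finset ι, B.card < A.card → PII x y B) : Good x y A := by
  by_cases hbig : |p * x d + q * x e| ≤ 1
  · refine Good.cons A c hc hPx hPy ?_
    refine IH1 _ (Finset.card_erase_lt_of_mem hc) ?_ d (Finset.mem_erase.2 ⟨hcd.symm, hd⟩)
      e (Finset.mem_erase.2 ⟨hce.symm, he⟩) hde p q (by linarith) hp1 hq (by linarith) ?_ ?_
    · rw [sum_erase' x A c hc, ex, show x c + p * x d + q * x e - x c = p * x d + q * x e by ring]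
      exact hbig
    · rw [sum_erase' x A c hc, ex]; ring
    · rw [sum_erase' y A c hc, ey]; ring
  · push Not at hbig
    rw [ex] at hPx
    obtain ⟨h1, h2, h3⟩ := arithI (x c) (x d) (x e) p q (hX c) (hX d) (hX e) (by linarith) hp1 hq
      hpq hbig hPx
    rw [← ex] at hPx
    have hc' : c ∈ A.erase d := Finset.mem_erase.2 ⟨hcd, hc⟩
    refine Good.cons A d hd hPx hPy (Good.cons _ c hc' ?_ ?_ ?_)
    · rw [sum_erase' x A d hd, ex]; exact h2
    · rw [sum_erase' y A d hd, ey]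
      have a1 := abs_le.1 (abs_mul_le hq le_rfl (hY e))
      have a2 := abs_le.1 (abs_mul_le (sub_nonneg.2 hp1) le_rfl (hY d))
      have a3 := abs_le.1 (hY c)
      exact abs_le.2 ⟨by linarith, by linarith⟩
    · refine IH2 _ ?_ ?_ (x d) (y d) (1 - p) q (hX d) (hY d) (by linarith) (by linarith) e
        (Finset.mem_erase.2 ⟨hce.symm, Finset.mem_erase.2 ⟨hde.symm, he⟩⟩) hq (by linarith) ?_ ?_
      · exact (Finset.card_erase_lt_of_mem hc').trans (Finset.card_erase_lt_of_mem hd)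
      · rw [sum_erase' x _ c hc', sum_erase' x A d hd, ex]; exact h3
      · rw [sum_erase' x _ c hc', sum_erase' x A d hd, ex]; ring
      · rw [sum_erase' y _ c hc', sum_erase' y A d hd, ey]; ring

lemma finishI (x y : ι → ℚ) (hX : ∀ i, |x i| ≤ 1) (hY : ∀ i, |y i| ≤ 1)
    (A : Finset ι) (c d e : ι) (hc : c ∈ A) (hd : d ∈ A) (he : e ∈ A)
    (hcd : c ≠ d) (hce : c ≠ e) (hde : d ≠ e) (p q : ℚ)
    (hp : 0 ≤ p) (hp1 : p ≤ 1) (hq : 0 ≤ q) (hq1 : q ≤ 1)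
    (hPx : |∑ i ∈ A, x i| ≤ 1) (hPy : |∑ i ∈ A, y i| ≤ 2)
    (ex : ∑ i ∈ A, x i = x c + p * x d + q * x e)
    (ey : ∑ i ∈ A, y i = y c + p * y d + q * y e)
    (IH1 : ∀ B : Finset ι, B.card < A.card → PI x y B)
    (IH2 : ∀ B : Finset ι, B.card < A.card → PII x y B) : Good x y A := by
  rcases le_total q p with h | h
  · exact finishI' x y hX hY A c d e hc hd he hcd hce hde p q hp1 hq h hPx hPy ex ey IH1 IH2
  · exact finishI' x y hX hY A c e d hc he hd hce hcd hde.symm q p hq1 hp h hPx hPy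
      (by linarith) (by linarith) IH1 IH2

lemma pI (x y : ι → ℚ) (hX : ∀ i, |x i| ≤ 1) (hY : ∀ i, |y i| ≤ 1)
    (A : Finset ι) (IH1 : ∀ B : Finset ι, B.card < A.card → PI x y B)
    (IH2 : ∀ B : Finset ι, B.card < A.card → PII x y B) : PI x y A := by
  intro hPx a ha b hb hab p q hp hp1 hq hq1 ex ey
  have hPy : |∑ i ∈ A, y i| ≤ 2 := by
    rw [ey]
    have a1 := abs_le.1 (abs_mul_le hp hp1 (hY a))
    have a2 := abs_le.1 (abs_mul_le hq hq1 (hY b))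
    exact abs_le.2 ⟨by linarith, by linarith⟩
  have hb' : b ∈ A.erase a := Finset.mem_erase.2 ⟨hab.symm, hb⟩
  have hcard : (A.erase a).card + 1 = A.card := Finset.card_erase_add_one ha
  have hcard' : ((A.erase a).erase b).card + 1 = (A.erase a).card := Finset.card_erase_add_one hb'
  by_cases h3 : A.card ≤ 2
  · have h0 : (A.erase a).erase b = ∅ := Finset.card_eq_zero.1 (by omega)
    have hsx := sum_erase' x _ b hb'
    have hsy := sum_erase' y _ b hb'
    rw [h0, Finset.sum_empty] at hsx hsy
    refine Good.cons A a ha hPx hPy (Good.cons _ b hb' ?_ ?_ ?_)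
    · rw [show ∑ i ∈ A.erase a, x i = x b by linarith]; exact hX b
    · rw [show ∑ i ∈ A.erase a, y i = y b by linarith]; linarith [hY b]
    · rw [h0]; exact Good.empty
  · have hst := step x y (A.erase a) (x a) (y a) (1 - p) q b hb'
      (fun b _ => Finset.exists_mem_ne (by omega) b) (fun i _ => hX i) (hX a) (by linarith)
      (by linarith) hq hq1 (by rw [sum_erase' x A a ha, ex]; ring)
      (by rw [sum_erase' y A a ha, ey]; ring)
    rcases hst with ⟨d, hd, e, he, hde, p', q', h1, h2, h3, h4, h5, h6⟩ |
      ⟨c, hc, d, hd, hcd, l, q', h1, h2, h3, h4, h5, h6, -⟩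
    · rw [Finset.mem_erase] at hd he
      rw [sum_erase' x A a ha] at h5
      rw [sum_erase' y A a ha] at h6
      exact finishI x y hX hY A a d e ha hd.2 he.2 hd.1.symm he.1.symm hde p' q' h1 h2 h3 h4
        hPx hPy (by linarith) (by linarith) IH1 IH2
    · rw [Finset.mem_erase] at hc hd
      rw [sum_erase' x A a ha] at h5
      rw [sum_erase' y A a ha] at h6
      exact finishI x y hX hY A c a d hc.2 ha hd.2 hc.1 hcd hd.1.symm (1 - l) q' (by linarith)
        (by linarith) h3 h4 hPx hPy (by linarith) (by linarith) IH1 IH2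

lemma pII (x y : ι → ℚ) (hX : ∀ i, |x i| ≤ 1) (hY : ∀ i, |y i| ≤ 1)
    (A : Finset ι) (H1 : PI x y A) (IH2 : ∀ B : Finset ι, B.card < A.card → PII x y B)
    (IH3 : ∀ B : Finset ι, B.card < A.card → PIII x y B) : PII x y A := by
  intro hPx ax ay l q hax hay hl hl1 b hb hq hq1 ex ey
  have hPy : |∑ i ∈ A, y i| ≤ 2 := by
    have a1 := abs_le.1 (abs_mul_le hl hl1 hay)
    have a2 := abs_le.1 (abs_mul_le hq hq1 (hY b))
    exact abs_le.2 ⟨by linarith, by linarith⟩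
  have hcard : (A.erase b).card + 1 = A.card := Finset.card_erase_add_one hb
  by_cases h2 : A.card ≤ 1
  · have h0 : A.erase b = ∅ := Finset.card_eq_zero.1 (by omega)
    refine Good.cons A b hb hPx hPy ?_
    rw [h0]; exact Good.empty
  · have hst := step x y A ax ay l q b hb
      (fun b _ => Finset.exists_mem_ne (by omega) b) (fun i _ => hX i) hax hl
      (by linarith) hq hq1 ex ey
    rcases hst with ⟨d, hd, e, he, hde, p', q', h1, h2, h3, h4, h5, h6⟩ |
      ⟨c, hc, d, hd, hcd, l', q', h1, h2, h3, h4, h5, h6, h7⟩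
    · exact H1 hPx d hd e he hde p' q' h1 h2 h3 h4 h5 h6
    · by_cases hbig : |∑ i ∈ A, x i - x c| ≤ 1
      · refine Good.cons A c hc hPx hPy ?_
        refine IH2 _ (Finset.card_erase_lt_of_mem hc) ?_ ax ay l' q' hax hay h1 (by linarith) d
          (Finset.mem_erase.2 ⟨hcd.symm, hd⟩) h3 h4 ?_ ?_
        · rw [sum_erase' x A c hc]; exact hbig
        · rw [sum_erase' x A c hc]; exact h5
        · rw [sum_erase' y A c hc]; exact h6
      · have hN := h7.resolve_left (fun h => hbig (h hPx))
        push Not at hbig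
        have ex' : ∑ i ∈ A, x i = x c + q' * x d - l' * ax := by linarith
        have ey' : ∑ i ∈ A, y i = y c + q' * y d - l' * ay := by linarith
        rw [show ∑ i ∈ A, x i - x c = q' * x d - l' * ax by linarith] at hbig
        rw [ex'] at hPx
        obtain ⟨k1, k2, k3⟩ := arithII (x c) (x d) ax l' q' (hX c) (hX d) hax h1 (by linarith)
          h3 h4 hbig hPx
        rw [← ex'] at hPx
        have hc' : c ∈ A.erase d := Finset.mem_erase.2 ⟨hcd, hc⟩
        refine Good.cons A d hd hPx hPy (Good.cons _ c hc' ?_ ?_ ?_)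
        · rw [sum_erase' x A d hd, ex']; exact k3
        · rw [sum_erase' y A d hd, ey']
          have a1 := abs_le.1 (abs_mul_le h1 le_rfl hay)
          have a2 := abs_le.1 (abs_mul_le (sub_nonneg.2 h4) le_rfl (hY d))
          have a3 := abs_le.1 (hY c)
          exact abs_le.2 ⟨by linarith, by linarith⟩
        · refine IH3 _ ?_ ax ay (x d) (y d) l' (1 - q') hax hay (hX d) (hY d) k2 h1 (by linarith)
            (by linarith) (by linarith) ?_ ?_ ?_
          · exact (Finset.card_erase_lt_of_mem hc').trans (Finset.card_erase_lt_of_mem hd)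
          · rw [sum_erase' x _ c hc', sum_erase' x A d hd, ex']; ring
          · rw [sum_erase' y _ c hc', sum_erase' y A d hd, ey']; ring
          · rw [Finset.erase_right_comm]; exact hN

lemma pIII (x y : ι → ℚ) (hX : ∀ i, |x i| ≤ 1) (hY : ∀ i, |y i| ≤ 1)
    (A : Finset ι) (H2 : PII x y A)
    (IH3 : ∀ B : Finset ι, B.card < A.card → PIII x y B) : PIII x y A := by
  intro ax ay dx dy la ld hax hay hdx hdy had hla hla1 hld hld1 ex ey hN
  rcases A.eq_empty_or_nonempty with h0 | ⟨b, hb⟩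
  · rw [h0]; exact Good.empty
  have hPx : |∑ i ∈ A, x i| ≤ 1 := by
    have a1 := abs_le.1 (abs_mul_le hla hla1 hax)
    have a2 := abs_le.1 (abs_mul_le hld hld1 hdx)
    exact abs_le.2 ⟨by linarith, by linarith⟩
  have hPy : |∑ i ∈ A, y i| ≤ 2 := by
    have a1 := abs_le.1 (abs_mul_le hla hla1 hay)
    have a2 := abs_le.1 (abs_mul_le hld hld1 hdy)
    exact abs_le.2 ⟨by linarith, by linarith⟩
  rcases hla.eq_or_lt with h0 | hlap
  · subst h0
    exact H2 hPx dx dy ld 0 hdx hdy hld hld1 b hb le_rfl zero_le_one (by linarith) (by linarith)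
  by_cases hD : ax * dy - ay * dx = 0
  · have hax0 : ax ≠ 0 := by
      intro h; rw [h] at had; linarith
    obtain ⟨k, hk, hkx, hky⟩ : ∃ k : ℚ, 0 < k ∧ dx = -k * ax ∧ dy = -k * ay := by
      refine ⟨-(ax * dx) / (ax * ax), div_pos (by linarith) (mul_self_pos.2 hax0), ?_, ?_⟩
      · field_simp
      · field_simp
        linarith
    by_cases h : ld * k ≤ la
    · have h1 : 0 ≤ ld * k := by positivity
      refine H2 hPx ax ay (la - ld * k) 0 hax hay (by linarith) (by linarith) b hb le_rfl
        zero_le_one ?_ ?_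
      · rw [ex, hkx]; ring
      · rw [ey, hky]; ring
    · push Not at h
      have h1 : la / k ≤ ld := (div_le_iff₀ hk).2 h.le
      have h2 : 0 ≤ la / k := by positivity
      refine H2 hPx dx dy (ld - la / k) 0 hdx hdy (by linarith) (by linarith) b hb le_rfl
        zero_le_one ?_ ?_
      · have : la / k * dx = -la * ax := by rw [hkx]; field_simp
        linarith
      · have : la / k * dy = -la * ay := by rw [hky]; field_simp
        linarith
  obtain ⟨e, he, hα⟩ := exists_alpha_pos x y A ax ay dx dy la (-ld) hD hlap (by linarith)
    (by linarith)
  obtain ⟨hex, hey⟩ := coords ax ay dx dy (x e) (y e) hD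
  generalize -(x e * dy - y e * dx) / (ax * dy - ay * dx) = α at hα hex hey
  generalize -(ax * y e - ay * x e) / (ax * dy - ay * dx) = β at hex hey
  have hβ : 0 ≤ β := by
    by_contra hneg
    push Not at hneg
    exact hN e he α (-β) hα (by linarith) ⟨by linarith, by linarith⟩
  obtain ⟨t, h0, h1, h2, h3, h4⟩ := exists_t α β la ld hα hβ hla hld
  have tx : t * x e = -(t * α) * ax - (t * β) * dx := by rw [hex]; ring
  have ty : t * y e = -(t * α) * ay - (t * β) * dy := by rw [hey]; ring
  have h5 : 0 ≤ t * α := by positivity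
  have h6 : 0 ≤ t * β := by positivity
  rcases h4 with h | h | h
  · refine H2 hPx dx dy (ld - t * β) t hdx hdy (by linarith) (by linarith) e he h0 h1 ?_ ?_
    · rw [tx, ex, h]; ring
    · rw [ty, ey, h]; ring
  · refine H2 hPx ax ay (la - t * α) t hax hay (by linarith) (by linarith) e he h0 h1 ?_ ?_
    · rw [tx, ex, h]; ring
    · rw [ty, ey, h]; ring
  · subst h
    refine Good.cons A e he hPx hPy ?_
    refine IH3 _ (Finset.card_erase_lt_of_mem he) ax ay dx dy (la - α) (ld - β) hax hay hdx hdy had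
      (by linarith) (by linarith) (by linarith) (by linarith) ?_ ?_ ?_
    · rw [sum_erase' x A e he]; linarith
    · rw [sum_erase' y A e he]; linarith
    · intro g hg
      exact hN g (Finset.mem_of_mem_erase hg)

lemma all_good (x y : ι → ℚ) (hX : ∀ i, |x i| ≤ 1) (hY : ∀ i, |y i| ≤ 1)
    (n : ℕ) : ∀ A : Finset ι, A.card = n → PI x y A ∧ PII x y A ∧ PIII x y A := by
  induction n using Nat.strong_induction_on with
  | _ n ih =>
    intro A hA
    have IH : ∀ B : Finset ι, B.card < A.card → PI x y B ∧ PII x y B ∧ PIII x y B :=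
      fun B hB => ih B.card (by omega) B rfl
    have h1 := pI x y hX hY A (fun B hB => (IH B hB).1) (fun B hB => (IH B hB).2.1)
    have h2 := pII x y hX hY A h1 (fun B hB => (IH B hB).2.1) (fun B hB => (IH B hB).2.2)
    exact ⟨h1, h2, pIII x y hX hY A h2 (fun B hB => (IH B hB).2.2)⟩

lemma good_of_sum_zero (x y : ι → ℚ) (hX : ∀ i, |x i| ≤ 1) (hY : ∀ i, |y i| ≤ 1)
    (A : Finset ι) (hsx : ∑ i ∈ A, x i = 0) (hsy : ∑ i ∈ A, y i = 0) :
    Good x y A := by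
  rcases A.eq_empty_or_nonempty with h0 | ⟨a, ha⟩
  · rw [h0]; exact Good.empty
  refine (all_good x y hX hY A.card A rfl).2.1 (by rw [hsx]; norm_num) 0 0 0 0 (by norm_num)
    (by norm_num) le_rfl (by norm_num) a ha le_rfl zero_le_one ?_ ?_
  · rw [hsx]; ring
  · rw [hsy]; ring

end Dav

namespace Dav

set_option linter.unusedSectionVars false

variable {ι : Type*} [DecidableEq ι]

lemma good_chain (x y : ι → ℚ) (A : Finset ι) (h : Good x y A) :
    ∃ S : Finset (Finset ι), S.card = A.card ∧
      (∀ B ∈ S, B.Nonempty ∧ B ⊆ A ∧ |∑ i ∈ B, x i| ≤ 1 ∧ |∑ i ∈ B, y i| ≤ 2) ∧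
      (∀ B ∈ S, ∀ C ∈ S, B ⊆ C ∨ C ⊆ B) := by
  induction h with
  | empty => exact ⟨∅, by simp⟩
  | cons A c hc hx hy _ ih =>
    obtain ⟨S, hS, h1, h2⟩ := ih
    have hnot : A ∉ S := fun hA => Finset.notMem_erase c A ((h1 A hA).2.1 hc)
    refine ⟨insert A S, ?_, ?_, ?_⟩
    · rw [Finset.card_insert_of_notMem hnot, hS, Finset.card_erase_add_one hc]
    · intro B hB
      rcases Finset.mem_insert.1 hB with rfl | hB
      · exact ⟨⟨c, hc⟩, subset_rfl, hx, hy⟩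
      · obtain ⟨g1, g2, g3⟩ := h1 B hB
        exact ⟨g1, g2.trans (Finset.erase_subset _ _), g3⟩
    · intro B hB C hC
      rcases Finset.mem_insert.1 hB with rfl | hB
      · rcases Finset.mem_insert.1 hC with rfl | hC
        · exact Or.inl subset_rfl
        · exact Or.inr ((h1 C hC).2.1.trans (Finset.erase_subset _ _))
      · rcases Finset.mem_insert.1 hC with hC' | hC
        · rw [hC']
          exact Or.inl ((h1 B hB).2.1.trans (Finset.erase_subset _ _))
        · exact h2 B hB C hC

lemma upper_index [Fintype ι] (m : ℕ) (hm : 0 < m) (v : ι → ℤ × ℤ)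
    (hv : ∀ i, v i ∈ (Set.Icc (-(m : ℤ)) m) ×ˢ (Set.Icc (-(m : ℤ)) m))
    (hsum : ∑ i, v i = 0)
    (hmin : ∀ B : Finset ι, B.Nonempty → B ≠ Finset.univ → ∑ i ∈ B, v i ≠ 0) :
    Fintype.card ι ≤ (2 * m + 1) * (4 * m + 1) := by
  have hm' : (0 : ℚ) < m := by exact_mod_cast hm
  set x : ι → ℚ := fun i => ((v i).1 : ℚ) / m with hxdef
  set y : ι → ℚ := fun i => ((v i).2 : ℚ) / m with hydef
  have sx : ∀ B : Finset ι, ∑ i ∈ B, x i = (((∑ i ∈ B, v i).1 : ℤ) : ℚ) / m := by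
    intro B
    rw [Prod.fst_sum, Int.cast_sum, Finset.sum_div]
  have sy : ∀ B : Finset ι, ∑ i ∈ B, y i = (((∑ i ∈ B, v i).2 : ℤ) : ℚ) / m := by
    intro B
    rw [Prod.snd_sum, Int.cast_sum, Finset.sum_div]
  have hX : ∀ i, |x i| ≤ 1 := by
    intro i
    obtain ⟨⟨h1, h2⟩, -⟩ := hv i
    have h1' : (-(m : ℚ)) ≤ ((v i).1 : ℚ) := by exact_mod_cast h1
    have h2' : ((v i).1 : ℚ) ≤ (m : ℚ) := by exact_mod_cast h2
    simp only [hxdef]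
    rw [abs_div, abs_of_pos hm', div_le_one hm']
    exact abs_le.2 ⟨h1', h2'⟩
  have hY : ∀ i, |y i| ≤ 1 := by
    intro i
    obtain ⟨-, ⟨h1, h2⟩⟩ := hv i
    have h1' : (-(m : ℚ)) ≤ ((v i).2 : ℚ) := by exact_mod_cast h1
    have h2' : ((v i).2 : ℚ) ≤ (m : ℚ) := by exact_mod_cast h2
    simp only [hydef]
    rw [abs_div, abs_of_pos hm', div_le_one hm']
    exact abs_le.2 ⟨h1', h2'⟩
  have hg : Good x y Finset.univ := by
    refine good_of_sum_zero x y hX hY _ ?_ ?_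
    · rw [sx, hsum]; simp
    · rw [sy, hsum]; simp
  obtain ⟨S, hS, h1, h2⟩ := good_chain x y _ hg
  have hcard : S.card ≤ ((Finset.Icc (-(m : ℤ)) m) ×ˢ (Finset.Icc (-(2 * m : ℤ)) (2 * m))).card := by
    refine Finset.card_le_card_of_injOn (fun B => ∑ i ∈ B, v i) ?_ ?_
    · intro B hB
      obtain ⟨-, -, g1, g2⟩ := h1 B hB
      rw [sx, abs_div, abs_of_pos hm', div_le_one hm', abs_le] at g1
      rw [sy, abs_div, abs_of_pos hm', div_le_iff₀ hm', abs_le] at g2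
      simp only [Finset.coe_product, Finset.coe_Icc, Set.mem_prod, Set.mem_Icc]
      refine ⟨⟨?_, ?_⟩, ?_, ?_⟩
      · exact_mod_cast g1.1
      · exact_mod_cast g1.2
      · exact_mod_cast g2.1
      · exact_mod_cast g2.2
    · have key : ∀ B ∈ S, ∀ C ∈ S, B ⊆ C → ∑ i ∈ B, v i = ∑ i ∈ C, v i → B = C := by
        intro B hB C hC hBC heq
        by_contra hne
        have hsd := Finset.sum_sdiff hBC (f := v)
        rw [heq] at hsd
        have hz : ∑ i ∈ C \ B, v i = 0 := by simpa using hsd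
        refine hmin (C \ B) ?_ ?_ hz
        · rw [Finset.sdiff_nonempty]
          exact fun h => hne (subset_antisymm hBC h)
        · intro hu
          obtain ⟨b, hb⟩ := (h1 B hB).1
          have : b ∈ C \ B := by rw [hu]; exact Finset.mem_univ b
          exact (Finset.mem_sdiff.1 this).2 hb
      intro B hB C hC heq
      rcases h2 B hB C hC with h | h
      · exact key B hB C hC h heq
      · exact (key C hC B hB h heq.symm).symm
  rw [hS, Finset.card_product, Int.card_Icc, Int.card_Icc, Finset.card_univ] at hcard
  have e1 : ((m : ℤ) + 1 - -(m : ℤ)).toNat = 2 * m + 1 := by omega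
  have e2 : ((2 * m : ℤ) + 1 - -(2 * m : ℤ)).toNat = 4 * m + 1 := by omega
  rw [e1, e2] at hcard
  exact hcard

lemma upper (m : ℕ) (hm : 0 < m) (s : Multiset (ℤ × ℤ))
    (hs : IsMinZeroSumSeq ((Set.Icc (-(m : ℤ)) m) ×ˢ (Set.Icc (-(m : ℤ)) m)) s) :
    Multiset.card s ≤ (2 * m + 1) * (4 * m + 1) := by
  classical
  obtain ⟨-, hX, h0, hmin⟩ := hs
  rw [← Multiset.card_coe s]
  refine upper_index (ι := s) m hm (fun i => i.1) (fun i => hX _ (Multiset.coe_mem)) ?_ ?_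
  · have := Multiset.map_univ_coe s
    rw [← h0]
    conv_rhs => rw [← this]
    rfl
  · intro B hB hBu hz
    have hlt : B < Finset.univ := lt_of_le_of_ne (Finset.subset_univ B) hBu
    have hval : B.val.map (fun i : s => i.1) < s := by
      have h1 : B.val < (Finset.univ : Finset s).val := Finset.val_lt_iff.2 hlt
      have h2 := Multiset.map_lt_map (f := fun i : s => (i.1 : ℤ × ℤ)) h1
      rwa [Multiset.map_univ_coe s] at h2
    refine hmin _ hval ?_ hz
    intro h
    rw [Multiset.map_eq_zero, Finset.val_eq_zero] at h
    exact hB.ne_empty h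

lemma sub_replicate3 {α : Type*} [DecidableEq α] (a b c : α) (k l n : ℕ) (t : Multiset α)
    (h : t ≤ Multiset.replicate k a + Multiset.replicate l b + Multiset.replicate n c) :
    ∃ k' ≤ k, ∃ l' ≤ l, ∃ n' ≤ n,
      t = Multiset.replicate k' a + Multiset.replicate l' b + Multiset.replicate n' c := by
  have split : ∀ t u w : Multiset α, t ≤ u + w → ∃ t1 ≤ u, ∃ t2 ≤ w, t = t1 + t2 := by
    intro t u w h
    refine ⟨t ∩ u, Multiset.inter_le_right, t - u, ?_, ?_⟩
    · exact tsub_le_iff_left.2 h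
    · rw [add_comm, Multiset.sub_add_inter]
  obtain ⟨t1, h1, t2, h2, rfl⟩ := split _ _ _ h
  obtain ⟨t3, h3, t4, h4, rfl⟩ := split _ _ _ h1
  obtain ⟨n', hn, rfl⟩ := Multiset.le_replicate_iff.1 h2
  obtain ⟨k', hk, rfl⟩ := Multiset.le_replicate_iff.1 h3
  obtain ⟨l', hl, rfl⟩ := Multiset.le_replicate_iff.1 h4
  exact ⟨k', hk, l', hl, n', hn, rfl⟩

lemma lower (j : ℕ) (hj : 1 ≤ j) :
    ∃ s : Multiset (ℤ × ℤ), IsMinZeroSumSeq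
      ((Set.Icc (-((j + 1 : ℕ) : ℤ)) ((j + 1 : ℕ) : ℤ)) ×ˢ
        (Set.Icc (-((j + 1 : ℕ) : ℤ)) ((j + 1 : ℕ) : ℤ))) s ∧
      Multiset.card s = (2 * j + 1) ^ 2 := by
  set v1 : ℤ × ℤ := ((j : ℤ) + 1, -(j : ℤ)) with hv1
  set v2 : ℤ × ℤ := (-(j : ℤ), -(j : ℤ)) with hv2
  set v3 : ℤ × ℤ := ((j : ℤ), (j : ℤ) + 1) with hv3
  have hsum : ∀ k l n : ℕ, (Multiset.replicate k v1 + Multiset.replicate l v2 +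
      Multiset.replicate n v3).sum =
      (((j : ℤ) + 1) * k - j * l + j * n, - ((j : ℤ) * k) - j * l + ((j : ℤ) + 1) * n) := by
    intro k l n
    simp only [Multiset.sum_add, Multiset.sum_replicate, hv1, hv2, hv3]
    ext
    · simp; ring
    · simp; ring
  refine ⟨Multiset.replicate j v1 + Multiset.replicate ((j + 1) ^ 2 + j ^ 2) v2 +
    Multiset.replicate (j * (2 * j + 1)) v3, ⟨?_, ?_, ?_, ?_⟩, ?_⟩
  · intro h
    have := congrArg Multiset.card h
    simp at this
  · intro z hz
    simp only [Multiset.mem_add] at hz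
    rcases hz with (hz | hz) | hz <;> rw [Multiset.eq_of_mem_replicate hz] <;>
      simp only [hv1, hv2, hv3, Set.mem_prod, Set.mem_Icc] <;> push_cast <;>
      refine ⟨⟨?_, ?_⟩, ?_, ?_⟩ <;> linarith
  · rw [hsum]
    ext
    · push_cast; simp only [Prod.fst_zero]; ring
    · push_cast; simp only [Prod.snd_zero]; ring
  · intro t ht ht0 hts
    obtain ⟨k, hk, l, hl, n, hn, rfl⟩ := sub_replicate3 _ _ _ _ _ _ _ ht.le
    rw [hsum, Prod.ext_iff] at hts
    obtain ⟨e1, e2⟩ := hts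
    simp only [Prod.fst_zero, Prod.snd_zero] at e1 e2
    have hj' : (j : ℤ) ≠ 0 := by exact_mod_cast (by omega : j ≠ 0)
    have hdvd : (j : ℤ) ∣ k := ⟨l - n - k, by linear_combination e1⟩
    have hdvd' : j ∣ k := by exact_mod_cast hdvd
    obtain ⟨r, rfl⟩ := hdvd'
    have hr : r ≤ 1 := by
      by_contra hr
      push Not at hr
      nlinarith
    have hln : (l : ℤ) = (j + 1) * r + n := by
      have : (j : ℤ) * (l - ((j + 1) * r + n)) = 0 := by
        push_cast at e1
        linear_combination -e1
      rcases mul_eq_zero.1 this with h | h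
      · exact absurd h hj'
      · linarith
    have hnn : (n : ℤ) = j * (2 * j + 1) * r := by
      push_cast at e2
      rw [hln] at e2
      linear_combination e2
    interval_cases r
    · apply ht0
      have hn0 : n = 0 := by simpa using hnn
      have hl0 : l = 0 := by rw [hn0] at hln; simpa using hln
      simp [hn0, hl0]
    · apply ht.ne
      have hn1 : n = j * (2 * j + 1) := by
        have : (n : ℤ) = ((j * (2 * j + 1) : ℕ) : ℤ) := by rw [hnn]; push_cast; ring
        exact_mod_cast this
      have hl1 : l = (j + 1) ^ 2 + j ^ 2 := by
        have : (l : ℤ) = (((j + 1) ^ 2 + j ^ 2 : ℕ) : ℤ) := by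
          rw [hln, hnn]; push_cast; ring
        exact_mod_cast this
      rw [hn1, hl1, mul_one]
  · simp only [Multiset.card_add, Multiset.card_replicate]
    ring

end Dav

theorem davenport_square_bounds (m : ℕ) (hm : 2 ≤ m) :
    ((((2 * m - 1) ^ 2 : ℕ)) : ℕ∞) ≤
        davenport ((Set.Icc (-(m : ℤ)) m) ×ˢ (Set.Icc (-(m : ℤ)) m)) ∧
    davenport ((Set.Icc (-(m : ℤ)) m) ×ˢ (Set.Icc (-(m : ℤ)) m)) ≤
        (((2 * m + 1) * (4 * m + 1) : ℕ) : ℕ∞) := by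
  constructor
  · obtain ⟨j, rfl⟩ : ∃ j, m = j + 1 := ⟨m - 1, by omega⟩
    obtain ⟨s, hs, hcard⟩ := Dav.lower j (by omega)
    rw [show 2 * (j + 1) - 1 = 2 * j + 1 by omega, ← hcard]
    exact le_iSup₂ (f := fun (s : Multiset (ℤ × ℤ)) (_ : IsMinZeroSumSeq
      ((Set.Icc (-((j + 1 : ℕ) : ℤ)) ((j + 1 : ℕ) : ℤ)) ×ˢ
        (Set.Icc (-((j + 1 : ℕ) : ℤ)) ((j + 1 : ℕ) : ℤ))) s) => (Multiset.card s : ℕ∞)) s hs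
  · exact iSup₂_le (fun s hs => by exact_mod_cast Dav.upper m (by omega) s hs)
end

section
/- Let d ≥ 3 be an integer and m a positive integer. Then (2m − 1 + δ_m)^d ≤ D(⟦−m, m⟧^d) ≤ (2(d + 1/d − 1)m + 1)^d, where δ_m = 1 if m = 1 and δ_m = 0 otherwise. -/
open Finset in
theorem reduce_frac {ι W : Type*} [Fintype ι] [DecidableEq ι] [AddCommGroup W] [Module ℝ W]
    [FiniteDimensional ℝ W] (M : (ι → ℝ) →ₗ[ℝ] W) (φ : (ι → ℝ) →ₗ[ℝ] ℝ) :
    ∀ (n : ℕ) (x : ι → ℝ), (∀ i, 0 ≤ x i ∧ x i ≤ 1) →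
      (univ.filter (fun i => 0 < x i ∧ x i < 1)).card ≤ n →
    ∃ y : ι → ℝ, (∀ i, 0 ≤ y i ∧ y i ≤ 1) ∧ (∀ i, x i = 0 → y i = 0) ∧ M y = M x ∧ φ y ≤ φ x ∧
      (univ.filter (fun i => 0 < y i ∧ y i < 1)).card ≤ Module.finrank ℝ W := by
  intro n
  induction n with
  | zero =>
    intro x hx h
    exact ⟨x, hx, fun _ h => h, rfl, le_rfl, h.trans (Nat.zero_le _)⟩
  | succ n ih =>
    intro x hx h
    by_cases hc : (univ.filter (fun i => 0 < x i ∧ x i < 1)).card ≤ Module.finrank ℝ W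
    · exact ⟨x, hx, fun _ h => h, rfl, le_rfl, hc⟩
    push Not at hc
    set F := univ.filter (fun i => 0 < x i ∧ x i < 1) with hF
    -- a nonzero direction supported on F
    obtain ⟨μ, hμ0, hμF, hμM⟩ : ∃ μ : ι → ℝ, μ ≠ 0 ∧ (∀ i, i ∉ F → μ i = 0) ∧ M μ = 0 := by
      let e : (F → ℝ) →ₗ[ℝ] (ι → ℝ) := Function.ExtendByZero.linearMap ℝ (Subtype.val : F → ι)
      have hinj : Function.Injective (Subtype.val : F → ι) := Subtype.val_injective
      have hk : LinearMap.ker (M ∘ₗ e) ≠ ⊥ := by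
        apply LinearMap.ker_ne_bot_of_finrank_lt
        simpa using hc
      obtain ⟨g, hg, hg0⟩ := (Submodule.ne_bot_iff _).1 hk
      refine ⟨e g, ?_, ?_, by simpa using hg⟩
      · intro h0
        apply hg0
        funext i
        have := congrFun h0 i.1
        simpa [e, hinj.extend_apply] using this
      · intro i hi
        simp only [e, Function.ExtendByZero.linearMap_apply]
        rw [Function.extend_apply']
        · rfl
        · rintro ⟨a, rfl⟩; exact hi a.2
    obtain ⟨μ, hμ0, hμF, hμM, hμφ⟩ : ∃ μ : ι → ℝ, μ ≠ 0 ∧ (∀ i, i ∉ F → μ i = 0) ∧ M μ = 0 ∧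
        φ μ ≤ 0 := by
      rcases le_total (φ μ) 0 with h1 | h1
      · exact ⟨μ, hμ0, hμF, hμM, h1⟩
      · exact ⟨-μ, by simpa using hμ0, fun i hi => by simp [hμF i hi], by simp [hμM],
          by simpa using h1⟩
    let τ : ι → ℝ := fun i => if 0 < μ i then (1 - x i) / μ i else x i / (- μ i)
    let G := univ.filter (fun i => μ i ≠ 0)
    have hG : G.Nonempty := by
      obtain ⟨i, hi⟩ := Function.ne_iff.1 hμ0
      exact ⟨i, by simpa [G] using hi⟩
    obtain ⟨j, hj, hmin⟩ := Finset.exists_min_image G τ hG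
    have hjμ : μ j ≠ 0 := by simpa [G] using hj
    have hjF : j ∈ F := by
      by_contra hh; exact hjμ (hμF j hh)
    have hτ : 0 ≤ τ j := by
      simp only [τ]
      split_ifs with h1
      · exact div_nonneg (by linarith [(hx j).2]) h1.le
      · exact div_nonneg (hx j).1 (by linarith)
    have hy : ∀ i, 0 ≤ x i + τ j * μ i ∧ x i + τ j * μ i ≤ 1 := by
      intro i
      rcases lt_trichotomy (μ i) 0 with h1 | h1 | h1
      · have h2 := hmin i (by simp [G, h1.ne])
        have h3 : τ i = x i / (- μ i) := by simp [τ, h1.le.not_gt]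
        rw [h3, le_div_iff₀ (by linarith)] at h2
        constructor
        · linarith
        · nlinarith [(hx i).2]
      · simpa [h1] using hx i
      · have h2 := hmin i (by simp [G, h1.ne'])
        have h3 : τ i = (1 - x i) / μ i := by simp [τ, h1]
        rw [h3, le_div_iff₀ (by linarith)] at h2
        constructor
        · nlinarith [(hx i).1]
        · linarith
    have hjb : x j + τ j * μ j = 0 ∨ x j + τ j * μ j = 1 := by
      rcases lt_or_gt_of_ne hjμ with h1 | h1
      · left
        have h3 : τ j = x j / (- μ j) := by simp [τ, h1.le.not_gt]
        rw [h3]; field_simp; ring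
      · right
        have h3 : τ j = (1 - x j) / μ j := by simp [τ, h1]
        rw [h3]; field_simp; ring
    obtain ⟨y, y1, y2, y3, y4, y5⟩ := ih (x + τ j • μ) (by simpa using hy) (by
      have : univ.filter (fun i => 0 < (x + τ j • μ) i ∧ (x + τ j • μ) i < 1) ⊆ F.erase j := by
        intro i hi
        simp only [Finset.mem_filter, mem_univ, true_and, Pi.add_apply, Pi.smul_apply,
          smul_eq_mul] at hi
        rw [Finset.mem_erase]
        constructor
        · rintro rfl
          rcases hjb with h | h <;> rw [h] at hi <;> linarith [hi.1, hi.2]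
        · by_contra hh
          rw [hμF i hh] at hi
          apply hh
          simpa [hF] using hi
      have h2 := Finset.card_le_card this
      rw [Finset.card_erase_of_mem hjF] at h2
      omega)
    refine ⟨y, y1, ?_, ?_, ?_, y5⟩
    · intro i hi
      apply y2
      have : i ∉ F := by simp [hF, hi]
      simp [hi, hμF i this]
    · rw [y3]; simp [hμM]
    · refine y4.trans ?_
      simp only [map_add, map_smul, smul_eq_mul]
      nlinarith

open Finset in
theorem count_frac {ι : Type*} [Fintype ι] [DecidableEq ι] (A : Finset ι) (y : ι → ℝ)
    (hy : ∀ i, 0 ≤ y i ∧ y i ≤ 1) (hA : ∀ i, i ∉ A → y i = 0) (hp : ∀ i ∈ A, y i ≠ 0) :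
    ∑ i, y i = A.card - (univ.filter (fun i => 0 < y i ∧ y i < 1)).card +
      ∑ i ∈ univ.filter (fun i => 0 < y i ∧ y i < 1), y i := by
  set F := univ.filter (fun i => 0 < y i ∧ y i < 1) with hF
  have hFA : F ⊆ A := by
    intro i hi
    by_contra h
    simp [hF, hA i h] at hi
  have h1 : ∑ i, y i = ∑ i ∈ A, y i :=
    (Finset.sum_subset (subset_univ A) (fun i _ hi => hA i hi)).symm
  rw [h1, ← Finset.sum_sdiff hFA]
  have h2 : ∑ i ∈ A \ F, y i = ∑ i ∈ A \ F, (1 : ℝ) := by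
    apply Finset.sum_congr rfl
    intro i hi
    rw [Finset.mem_sdiff] at hi
    by_contra h
    apply hi.2
    simp only [hF, mem_filter, mem_univ, true_and]
    exact ⟨lt_of_le_of_ne (hy i).1 (Ne.symm (hp i hi.1)), lt_of_le_of_ne (hy i).2 h⟩
  rw [h2, Finset.sum_const, Finset.card_sdiff_of_subset hFA, nsmul_eq_mul, mul_one,
    Nat.cast_sub (Finset.card_le_card hFA)]

/-- weak state: a relation with coefficients in `[0,1]` supported on `A`. -/
def RelOn {ι E : Type*} [Fintype ι] [AddCommGroup E] [Module ℝ E] (v : ι → E)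
    (A : Finset ι) (x : ι → ℝ) : Prop :=
  (∀ i, 0 ≤ x i ∧ x i ≤ 1) ∧ (∀ i, i ∉ A → x i = 0) ∧ ∑ i, x i • v i = 0

/-- the invariant. -/
def GoodState {ι E : Type*} [Fintype ι] [AddCommGroup E] [Module ℝ E] (v : ι → E) (d : ℝ)
    (A : Finset ι) (w : ι) (x : ι → ℝ) : Prop :=
  w ∈ A ∧ RelOn v A x ∧ (A.card : ℝ) - d - 1 / d ≤ ∑ i, x i - 2 * x w ∧ x w ≤ 1 / d

/-- the map of relations -/
noncomputable def relMap {ι E : Type*} [Fintype ι] [AddCommGroup E] [Module ℝ E] (v : ι → E) :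
    (ι → ℝ) →ₗ[ℝ] E := Fintype.linearCombination ℝ v

theorem relMap_apply {ι E : Type*} [Fintype ι] [AddCommGroup E] [Module ℝ E] (v : ι → E)
    (x : ι → ℝ) : relMap v x = ∑ i, x i • v i := by
  simp [relMap, Fintype.linearCombination_apply]

/-- sum functional -/
noncomputable def sumMap (ι : Type*) [Fintype ι] : (ι → ℝ) →ₗ[ℝ] ℝ := ∑ i, LinearMap.proj i

theorem sumMap_apply {ι : Type*} [Fintype ι] (x : ι → ℝ) : sumMap ι x = ∑ i, x i := by
  simp [sumMap]

theorem RelOn.smul {ι E : Type*} [Fintype ι] [AddCommGroup E] [Module ℝ E] {v : ι → E}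
    {A : Finset ι} {x : ι → ℝ} (h : RelOn v A x) {t : ℝ} (h0 : 0 ≤ t) (h1 : t ≤ 1) :
    RelOn v A (t • x) := by
  refine ⟨fun i => ⟨?_, ?_⟩, fun i hi => by simp [h.2.1 i hi], ?_⟩
  · exact mul_nonneg h0 (h.1 i).1
  · exact mul_le_one₀ h1 (h.1 i).1 (h.1 i).2
  · simp only [Pi.smul_apply, smul_assoc, ← Finset.smul_sum, h.2.2, smul_zero]

open Finset in
theorem exists_small {ι : Type*} (F : Finset ι) (hF : F.Nonempty) (y : ι → ℝ) :
    ∃ w ∈ F, F.card * y w ≤ ∑ i ∈ F, y i := by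
  obtain ⟨w, hw, h⟩ := Finset.exists_min_image F y hF
  refine ⟨w, hw, ?_⟩
  have := Finset.card_nsmul_le_sum F y (y w) h
  simpa using this

open Finset in
theorem reselect_high {ι E : Type*} [Fintype ι] [DecidableEq ι] [AddCommGroup E] [Module ℝ E]
    [FiniteDimensional ℝ E] (v : ι → E) (d : ℕ) (hd : 2 ≤ d) (hdE : Module.finrank ℝ E = d)
    (A : Finset ι) (hA : d + 1 ≤ A.card) (x : ι → ℝ) (hx : RelOn v A x)
    (hs : (A.card : ℝ) - d + 1 / d ≤ ∑ i, x i) : ∃ w y, GoodState v d A w y := by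
  have hd' : (2 : ℝ) ≤ d := by exact_mod_cast hd
  have hdi : (0 : ℝ) < 1 / d := by positivity
  have hdm : (d : ℝ) * (1 / d) = 1 := by field_simp
  have hA' : (d : ℝ) + 1 ≤ A.card := by exact_mod_cast hA
  set T : ℝ := (A.card : ℝ) - d + 1 / d with hT
  have hTpos : 0 < T := by linarith
  have hxpos : 0 < ∑ i, x i := by linarith
  have hx' := hx.smul (t := T / ∑ i, x i) (by positivity) (by rw [div_le_one hxpos]; exact hs)
  obtain ⟨y, y1, y2, y3, -, y5⟩ := reduce_frac ((relMap v).prod (sumMap ι)) 0 _ _ hx'.1 le_rfl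
  have y3 := Prod.ext_iff.1 y3
  change relMap v y = relMap v _ ∧ sumMap ι y = sumMap ι _ at y3
  simp only [relMap_apply, sumMap_apply] at y3
  rw [Module.finrank_prod, hdE, Module.finrank_self] at y5
  have hsum : ∑ i, y i = T := by
    rw [y3.2]
    simp only [Pi.smul_apply, smul_eq_mul, ← Finset.mul_sum]
    field_simp
  have hrel : RelOn v A y := ⟨y1, fun i hi => y2 i (hx'.2.1 i hi), y3.1.trans hx'.2.2⟩
  by_cases hz : ∃ z ∈ A, y z = 0
  · obtain ⟨z, hz, hz0⟩ := hz
    exact ⟨z, y, hz, hrel, by rw [hsum, hz0]; linarith, by rw [hz0]; exact hdi.le⟩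
  push Not at hz
  have hc := count_frac A y y1 hrel.2.1 hz
  set F := univ.filter (fun i => 0 < y i ∧ y i < 1) with hF
  have y5' : (F.card : ℝ) ≤ d + 1 := by exact_mod_cast y5
  have hFne : F.Nonempty := by
    by_contra hh
    rw [Finset.not_nonempty_iff_eq_empty] at hh
    rw [hh] at hc
    simp only [Finset.card_empty, Finset.sum_empty, Nat.cast_zero] at hc
    have : (1 : ℝ) / d ≤ 1 := by rw [div_le_one (by linarith)]; linarith
    linarith
  obtain ⟨w, hw, hmin⟩ := exists_small F hFne y
  have hwA : w ∈ A := by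
    by_contra h
    simp [hF, hrel.2.1 w h] at hw
  have hyw : y w ≤ 1 / d := by
    by_contra hh
    push Not at hh
    have h1 : (0 : ℝ) < F.card := by exact_mod_cast hFne.card_pos
    have h2 : (F.card : ℝ) * (1 / d) < F.card * y w := mul_lt_mul_of_pos_left hh h1
    have h3 : (F.card : ℝ) * (1 / d) < F.card - d + 1 / d := by linarith
    have h4 : ((d : ℝ) + 1 - F.card) * (1 - 1 / d) ≥ 0 := by
      apply mul_nonneg (by linarith)
      have : (1 : ℝ) / d ≤ 1 := by rw [div_le_one (by linarith)]; linarith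
      linarith
    nlinarith
  exact ⟨w, y, hwA, hrel, by rw [hsum]; linarith, hyw⟩

open Finset in
theorem reselect {ι E : Type*} [Fintype ι] [DecidableEq ι] [AddCommGroup E] [Module ℝ E]
    [FiniteDimensional ℝ E] (v : ι → E) (d : ℕ) (hd : 2 ≤ d) (hdE : Module.finrank ℝ E = d)
    (A : Finset ι) (hA : d + 1 ≤ A.card) (x : ι → ℝ) (hx : RelOn v A x)
    (hs : (A.card : ℝ) - d - 1 / d ≤ ∑ i, x i) : ∃ w y, GoodState v d A w y := by
  have hd' : (2 : ℝ) ≤ d := by exact_mod_cast hd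
  have hdi : (0 : ℝ) < 1 / d := by positivity
  have hdm : (d : ℝ) * (1 / d) = 1 := by field_simp
  have hd1 : (1 : ℝ) / d ≤ 1 := by rw [div_le_one (by linarith)]; linarith
  obtain ⟨y, y1, y2, y3, y4, y5⟩ := reduce_frac (relMap v) (-sumMap ι) _ _ hx.1 le_rfl
  simp only [relMap_apply, sumMap_apply, LinearMap.neg_apply] at y3 y4
  rw [hdE] at y5
  have hrel : RelOn v A y := ⟨y1, fun i hi => y2 i (hx.2.1 i hi), y3.trans hx.2.2⟩
  by_cases hh : (A.card : ℝ) - d + 1 / d ≤ ∑ i, y i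
  · exact reselect_high v d hd hdE A hA y hrel hh
  push Not at hh
  by_cases hz : ∃ z ∈ A, y z = 0
  · obtain ⟨z, hz, hz0⟩ := hz
    exact ⟨z, y, hz, hrel, by rw [hz0]; linarith, by rw [hz0]; exact hdi.le⟩
  push Not at hz
  have hc := count_frac A y y1 hrel.2.1 hz
  set F := univ.filter (fun i => 0 < y i ∧ y i < 1) with hF
  have hnn : 0 ≤ ∑ i ∈ F, y i := Finset.sum_nonneg (fun i _ => (y1 i).1)
  have hfd : F.card = d := by
    apply le_antisymm y5
    have : (d : ℝ) < F.card + 1 := by linarith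
    have : d < F.card + 1 := by exact_mod_cast this
    omega
  have hFne : F.Nonempty := by rw [← Finset.card_pos]; omega
  obtain ⟨w, hw, hmin⟩ := exists_small F hFne y
  rw [hfd] at hmin hc
  have hwA : w ∈ A := by
    by_contra h
    simp [hF, hrel.2.1 w h] at hw
  have hw0 := (y1 w).1
  have h5 : 2 * y w ≤ d * y w := mul_le_mul_of_nonneg_right hd' hw0
  exact ⟨w, y, hwA, hrel, by linarith, by linarith⟩

open Finset in
theorem good_step {ι E : Type*} [Fintype ι] [DecidableEq ι] [AddCommGroup E] [Module ℝ E]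
    [FiniteDimensional ℝ E] (v : ι → E) (d : ℕ) (hd : 2 ≤ d) (hdE : Module.finrank ℝ E = d)
    (A : Finset ι) (hA : d + 2 ≤ A.card) (w : ι) (x : ι → ℝ) (hx : GoodState v d A w x) :
    ∃ A' w' x' z, GoodState v d A' w' x' ∧ A'.card + 1 = A.card ∧ z ∉ A'.erase w' ∧
      A.erase w = insert z (A'.erase w') := by
  obtain ⟨hwA, hrx, hQ, hxw⟩ := hx
  have hd' : (2 : ℝ) ≤ d := by exact_mod_cast hd
  have hdi : (0 : ℝ) < 1 / d := by positivity
  have hd1 : (1 : ℝ) / d < 1 := by rw [div_lt_one (by linarith)]; linarith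
  have hA' : (d : ℝ) + 2 ≤ A.card := by exact_mod_cast hA
  set Q : ℝ := ∑ i, x i - 2 * x w with hQdef
  set T : ℝ := (A.card : ℝ) - 1 - d - 1 / d with hT
  have hTpos : 0 < T := by linarith
  have hQpos : 0 < Q := by linarith
  have ht1 : T / Q ≤ 1 := by rw [div_le_one hQpos]; linarith
  have hx' := hrx.smul (t := T / Q) (by positivity) ht1
  obtain ⟨y, y1, y2, y3, y4, y5⟩ := reduce_frac
    ((relMap v).prod (sumMap ι - (2 : ℝ) • LinearMap.proj w)) (LinearMap.proj w) _ _ hx'.1 le_rfl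
  have y3 := Prod.ext_iff.1 y3
  change relMap v y = relMap v _ ∧
    (sumMap ι - (2 : ℝ) • LinearMap.proj w : (ι → ℝ) →ₗ[ℝ] ℝ) y =
    (sumMap ι - (2 : ℝ) • LinearMap.proj w : (ι → ℝ) →ₗ[ℝ] ℝ) _ at y3
  simp only [relMap_apply, sumMap_apply,
    LinearMap.sub_apply, LinearMap.smul_apply, LinearMap.proj_apply, smul_eq_mul] at y3 y4
  rw [Module.finrank_prod, hdE, Module.finrank_self] at y5
  have hsum : ∑ i, y i - 2 * y w = T := by
    rw [y3.2]
    simp only [Pi.smul_apply, smul_eq_mul, ← Finset.mul_sum]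
    have : T / Q * ∑ i, x i - 2 * (T / Q * x w) = T / Q * Q := by rw [hQdef]; ring
    rw [this]; field_simp
  have hyw : y w ≤ 1 / d := by
    refine y4.trans (le_trans ?_ hxw)
    exact mul_le_of_le_one_left (hrx.1 w).1 ht1
  have hrel : RelOn v A y := ⟨y1, fun i hi => y2 i (hx'.2.1 i hi), y3.1.trans hx'.2.2⟩
  have hcard : ∀ z ∈ A, (A.erase z).card + 1 = A.card := fun z hz => Finset.card_erase_add_one hz
  have hcardR : ∀ z ∈ A, ((A.erase z).card : ℝ) = A.card - 1 := fun z hz => by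
    rw [← hcard z hz]; push_cast; ring
  have hrel' : ∀ z, y z = 0 → RelOn v (A.erase z) y := by
    intro z hz
    refine ⟨y1, fun i hi => ?_, hrel.2.2⟩
    by_cases h : i = z
    · rw [h, hz]
    · exact hrel.2.1 i (fun h' => hi (Finset.mem_erase.2 ⟨h, h'⟩))
  by_cases hw0 : y w = 0
  · obtain ⟨w', x', hg⟩ := reselect v d hd hdE (A.erase w) (by have := hcard w hwA; omega) y
      (hrel' w hw0) (by rw [hcardR w hwA]; linarith)
    exact ⟨A.erase w, w', x', w', hg, hcard w hwA, by simp, (Finset.insert_erase hg.1).symm⟩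
  by_cases hz : ∃ z ∈ A, y z = 0
  · obtain ⟨z, hz, hz0⟩ := hz
    have hzw : w ≠ z := by rintro rfl; exact hw0 hz0
    refine ⟨A.erase z, w, y, z, ⟨Finset.mem_erase.2 ⟨hzw, hwA⟩, hrel' z hz0, ?_, hyw⟩, hcard z hz,
      by simp, ?_⟩
    · rw [hcardR z hz, hsum]
    · rw [Finset.erase_right_comm, Finset.insert_erase]
      exact Finset.mem_erase.2 ⟨hzw.symm, hz⟩
  exfalso
  push Not at hz
  have hc := count_frac A y y1 hrel.2.1 hz
  set F := univ.filter (fun i => 0 < y i ∧ y i < 1) with hF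
  have hwF : w ∈ F := by
    simp only [hF, mem_filter, mem_univ, true_and]
    exact ⟨lt_of_le_of_ne (y1 w).1 (Ne.symm hw0), by linarith⟩
  have h1 := Finset.add_sum_erase F y hwF
  have hnn : 0 ≤ ∑ i ∈ F.erase w, y i := Finset.sum_nonneg (fun i _ => (y1 i).1)
  have hfd : F.card = d + 1 := by
    apply le_antisymm y5
    have : ((d + 1 : ℕ) : ℝ) ≤ F.card := by push_cast; linarith
    exact_mod_cast this
  have hpos : 0 < ∑ i ∈ F.erase w, y i := by
    apply Finset.sum_pos
    · intro i hi
      have := Finset.mem_of_mem_erase hi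
      simp only [hF, mem_filter, mem_univ, true_and] at this
      exact this.1
    · rw [← Finset.card_pos, Finset.card_erase_of_mem hwF]; omega
  rw [hfd] at hc
  push_cast at hc
  linarith

open Finset in
theorem good_bound {ι E : Type*} [Fintype ι] [DecidableEq ι] [NormedAddCommGroup E]
    [NormedSpace ℝ E] (v : ι → E) (C : ℝ) (hv : ∀ i, ‖v i‖ ≤ C) (hC : 0 ≤ C) (d : ℝ)
    (A : Finset ι) (w : ι) (x : ι → ℝ) (hx : GoodState v d A w x) :
    ‖∑ i ∈ A.erase w, v i‖ ≤ (d + 1 / d - 1) * C := by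
  obtain ⟨hwA, ⟨h1, h2, h3⟩, hQ, -⟩ := hx
  have hsA : ∑ i, x i = ∑ i ∈ A, x i :=
    (Finset.sum_subset (subset_univ A) (fun i _ hi => h2 i hi)).symm
  have hsA' : ∑ i, x i • v i = ∑ i ∈ A, x i • v i :=
    (Finset.sum_subset (subset_univ A) (fun i _ hi => by rw [h2 i hi, zero_smul])).symm
  rw [hsA', ← Finset.add_sum_erase A _ hwA] at h3
  rw [hsA, ← Finset.add_sum_erase A _ hwA] at hQ
  have key : ∑ i ∈ A.erase w, v i = ∑ i ∈ A.erase w, (1 - x i) • v i - x w • v w := by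
    simp only [sub_smul, one_smul, Finset.sum_sub_distrib]
    rw [sub_sub, add_comm, h3, sub_zero]
  have hb : ‖∑ i ∈ A.erase w, (1 - x i) • v i‖ ≤ ∑ i ∈ A.erase w, (1 - x i) * C := by
    refine norm_sum_le_of_le _ (fun i _ => ?_)
    rw [norm_smul, Real.norm_eq_abs, abs_of_nonneg (by linarith [(h1 i).2])]
    exact mul_le_mul_of_nonneg_left (hv i) (by linarith [(h1 i).2])
  have hb2 : ‖x w • v w‖ ≤ x w * C := by
    rw [norm_smul, Real.norm_eq_abs, abs_of_nonneg (h1 w).1]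
    exact mul_le_mul_of_nonneg_left (hv w) (h1 w).1
  rw [key]
  refine (norm_sub_le _ _).trans ((add_le_add hb hb2).trans ?_)
  rw [← Finset.sum_mul, ← add_mul]
  apply mul_le_mul_of_nonneg_right _ hC
  rw [Finset.sum_sub_distrib, Finset.sum_const, nsmul_eq_mul, mul_one]
  have : ((A.erase w).card : ℝ) = A.card - 1 := by
    rw [← Finset.card_erase_add_one hwA]; push_cast; ring
  linarith

/-- All suffix sums bounded. -/
def NiceList {ι E : Type*} [NormedAddCommGroup E] (v : ι → E) (R : ℝ) (l : List ι) : Prop :=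
  l.Nodup ∧ ∀ t, t <:+ l → ‖(t.map v).sum‖ ≤ R

theorem NiceList.cons {ι E : Type*} [NormedAddCommGroup E] {v : ι → E} {R : ℝ} {l : List ι}
    (h : NiceList v R l) (z : ι) (hz : z ∉ l) (hb : ‖((z :: l).map v).sum‖ ≤ R) :
    NiceList v R (z :: l) := by
  refine ⟨List.nodup_cons.2 ⟨hz, h.1⟩, fun t ht => ?_⟩
  rcases List.suffix_cons_iff.1 ht with rfl | ht
  · exact hb
  · exact h.2 t ht

theorem norm_list_sum_le' {ι E : Type*} [NormedAddCommGroup E] (v : ι → E) (C : ℝ)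
    (hv : ∀ i, ‖v i‖ ≤ C) (l : List ι) : ‖(l.map v).sum‖ ≤ l.length * C := by
  induction l with
  | nil => simp
  | cons a l ih =>
    simp only [List.map_cons, List.sum_cons, List.length_cons]
    refine (norm_add_le _ _).trans ?_
    push_cast
    linarith [hv a]

theorem niceList_short {ι E : Type*} [NormedAddCommGroup E] (v : ι → E) (C : ℝ) (hC : 0 ≤ C)
    (hv : ∀ i, ‖v i‖ ≤ C) (d : ℕ) (l : List ι) (hl : l.Nodup) (hlen : l.length ≤ d)
    (hs : ‖(l.map v).sum‖ ≤ ((d : ℝ) + 1 / d - 1) * C) :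
    NiceList v (((d : ℝ) + 1 / d - 1) * C) l := by
  refine ⟨hl, fun t ht => ?_⟩
  by_cases h : t.length = l.length
  · rw [ht.eq_of_length h]; exact hs
  · have h1 := ht.length_le
    refine (norm_list_sum_le' v C hv t).trans ?_
    apply mul_le_mul_of_nonneg_right _ hC
    have : ((t.length + 1 : ℕ) : ℝ) ≤ d := by exact_mod_cast (by omega)
    push_cast at this
    have : (0 : ℝ) ≤ 1 / d := by positivity
    linarith

open Finset in
theorem nice_chain {ι E : Type*} [Fintype ι] [DecidableEq ι] [NormedAddCommGroup E]
    [NormedSpace ℝ E] [FiniteDimensional ℝ E] (v : ι → E) (C : ℝ) (hv : ∀ i, ‖v i‖ ≤ C)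
    (hC : 0 ≤ C) (d : ℕ) (hd : 2 ≤ d) (hdE : Module.finrank ℝ E = d) :
    ∀ (k : ℕ) (A : Finset ι) (w : ι) (x : ι → ℝ), A.card = d + 1 + k → GoodState v d A w x →
      ∃ l : List ι, l.toFinset = A.erase w ∧ NiceList v (((d : ℝ) + 1 / d - 1) * C) l := by
  intro k
  induction k with
  | zero =>
    intro A w x hA hx
    refine ⟨(A.erase w).toList, by simp, ?_⟩
    apply niceList_short v C hC hv d _ (Finset.nodup_toList _)
    · rw [Finset.length_toList, Finset.card_erase_of_mem hx.1]; omega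
    · rw [Finset.sum_map_toList]
      exact good_bound v C hv hC d A w x hx
  | succ k ih =>
    intro A w x hA hx
    obtain ⟨A', w', x', z, hg, hc, hz, he⟩ := good_step v d hd hdE A (by omega) w x hx
    obtain ⟨l, hl, hn⟩ := ih A' w' x' (by omega) hg
    have hzl : z ∉ l := by rw [← List.mem_toFinset, hl]; exact hz
    refine ⟨z :: l, by rw [List.toFinset_cons, hl, he], hn.cons z hzl ?_⟩
    rw [← List.sum_toFinset _ (List.nodup_cons.2 ⟨hzl, hn.1⟩), List.toFinset_cons, hl, ← he]
    exact good_bound v C hv hC d A w x hx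

open Finset in
theorem steinitz {ι E : Type*} [Fintype ι] [DecidableEq ι] [NormedAddCommGroup E]
    [NormedSpace ℝ E] [FiniteDimensional ℝ E] (v : ι → E) (C : ℝ) (hv : ∀ i, ‖v i‖ ≤ C)
    (hC : 0 ≤ C) (d : ℕ) (hd : 2 ≤ d) (hdE : Module.finrank ℝ E = d) (h0 : ∑ i, v i = 0) :
    ∃ l : List ι, l.toFinset = univ ∧ NiceList v (((d : ℝ) + 1 / d - 1) * C) l := by
  have hd' : (2 : ℝ) ≤ d := by exact_mod_cast hd
  have hdi : (0 : ℝ) < 1 / d := by positivity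
  have hd1 : (1 : ℝ) / d ≤ 1 := by rw [div_le_one (by linarith)]; linarith
  have hR : 0 ≤ ((d : ℝ) + 1 / d - 1) * C := mul_nonneg (by linarith) hC
  by_cases hn : Fintype.card ι ≤ d
  · refine ⟨univ.toList, by simp, ?_⟩
    apply niceList_short v C hC hv d _ (Finset.nodup_toList _)
    · rw [Finset.length_toList]; exact hn
    · rw [Finset.sum_map_toList, h0, norm_zero]; exact hR
  push Not at hn
  obtain ⟨w, x, hx⟩ := reselect v d hd hdE univ hn (fun _ => 1)
    ⟨by simp, by simp, by simpa using h0⟩ (by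
      simp only [Finset.sum_const, nsmul_eq_mul, mul_one]; linarith)
  obtain ⟨l, hl, hn⟩ := nice_chain v C hv hC d hd hdE (Fintype.card ι - (d + 1)) univ w x
    (by rw [Finset.card_univ]; omega) hx
  have hzl : w ∉ l := by rw [← List.mem_toFinset, hl]; simp
  have hl' : (w :: l).toFinset = univ := by
    rw [List.toFinset_cons, hl, Finset.insert_erase (mem_univ _)]
  refine ⟨w :: l, hl', hn.cons w hzl ?_⟩
  rw [← List.sum_toFinset _ (List.nodup_cons.2 ⟨hzl, hn.1⟩), hl', h0, norm_zero]
  exact hR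

open Finset in
theorem upper_card (d : ℕ) (hd : 2 ≤ d) (m : ℕ) (s : Multiset (Fin d → ℤ))
    (hs : IsMinZeroSumSeq {v : Fin d → ℤ | ∀ i, v i ∈ Set.Icc (-(m : ℤ)) m} s) :
    (Multiset.card s : ℝ) ≤ (2 * ((d : ℝ) + 1 / d - 1) * (m : ℝ) + 1) ^ d := by
  obtain ⟨hs0, hsX, hsum, hmin⟩ := hs
  have hd' : (2 : ℝ) ≤ d := by exact_mod_cast hd
  have hdi : (0 : ℝ) < 1 / d := by positivity
  induction s using Quotient.inductionOn with
  | h L =>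
  change (L : Multiset (Fin d → ℤ)) ≠ 0 at hs0
  let u : Fin L.length → (Fin d → ℤ) := L.get
  let v : Fin L.length → (Fin d → ℝ) := fun i j => (u i j : ℝ)
  have hLu : (List.finRange L.length).map u = L := by
    rw [← List.ofFn_eq_map]; exact List.ofFn_get L
  have husum : ∑ i, u i = 0 := by
    have : (L : Multiset (Fin d → ℤ)).sum = 0 := hsum
    rw [Multiset.sum_coe] at this
    rw [← this]
    conv_rhs => rw [← hLu]
    exact (Fin.sum_univ_def u)
  have hvu : ∀ l : List (Fin L.length), ∀ j, (l.map v).sum j = (((l.map u).sum j : ℤ) : ℝ) := by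
    intro l j
    induction l with
    | nil => simp
    | cons a l ih => simp [ih, v]
  have hmem : ∀ i, ∀ j, u i j ∈ Set.Icc (-(m : ℤ)) m := fun i => hsX (u i) (by
    change L.get i ∈ (L : Multiset (Fin d → ℤ))
    exact List.get_mem L i)
  obtain ⟨l, hl, hnd, hb⟩ := steinitz v (m : ℝ) (fun i => by
      rw [pi_norm_le_iff_of_nonneg (by positivity)]
      intro j
      rw [Real.norm_eq_abs, abs_le]
      change -(m : ℝ) ≤ (u i j : ℝ) ∧ (u i j : ℝ) ≤ m
      exact ⟨by exact_mod_cast (hmem i j).1, by exact_mod_cast (hmem i j).2⟩)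
    (by positivity) d hd (by simp) (by
      funext j
      have := congrFun husum j
      simp only [Finset.sum_apply, Pi.zero_apply] at this ⊢
      change ∑ c, (u c j : ℝ) = 0
      exact_mod_cast this)
  set R : ℝ := ((d : ℝ) + 1 / d - 1) * m with hR
  have hR0 : 0 ≤ R := mul_nonneg (by linarith) (by positivity)
  have hperm : (l : Multiset (Fin L.length)) = (List.finRange L.length : Multiset _) := by
    rw [Multiset.coe_eq_coe]
    exact (List.perm_ext_iff_of_nodup hnd (List.nodup_finRange _)).2 (fun a => by
      rw [← List.mem_toFinset, hl]; simp)
  have hlu : ((l.map u : List _) : Multiset (Fin d → ℤ)) = (L : Multiset (Fin d → ℤ)) := by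
    rw [← Multiset.map_coe, hperm, Multiset.map_coe, hLu]
  have hlen : l.length = L.length := by
    have := congrArg Multiset.card hperm
    simpa using this
  -- injectivity
  let f : ℕ → (Fin d → ℤ) := fun j => ((l.drop j).map u).sum
  have hinj' : ∀ i j, i < j → j < L.length → f i ≠ f j := by
    intro i j hij hj he
    let t := ((l.drop i).take (j - i)).map u
    have hsplit : f i = t.sum + f j := by
      simp only [f, t]
      rw [← List.sum_append, ← List.map_append]
      congr 2
      conv_lhs => rw [← List.take_append_drop (j - i) (l.drop i)]
      rw [List.drop_drop]
      congr 2
      omega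
    have ht0 : t.sum = 0 := by
      rw [he] at hsplit
      simpa using hsplit
    have htlen : t.length = j - i := by
      simp [t]; omega
    have hle : (t : Multiset (Fin d → ℤ)) ≤ (L : Multiset (Fin d → ℤ)) := by
      rw [← hlu, Multiset.coe_le]
      apply List.Sublist.subperm
      exact ((List.take_sublist _ _).trans (List.drop_sublist _ _)).map u
    refine hmin t (lt_of_le_of_ne hle ?_) ?_ (by simpa using ht0)
    · intro h
      have h2 : Multiset.card (t : Multiset (Fin d → ℤ)) = Multiset.card (L : Multiset (Fin d → ℤ)) :=
        congrArg Multiset.card h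
      rw [Multiset.coe_card, Multiset.coe_card] at h2
      omega
    · intro h
      have := congrArg Multiset.card h
      rw [Multiset.coe_card] at this
      simp only [Multiset.card_zero] at this
      omega
  have hcard : (Finset.range L.length).card ≤
      (Fintype.piFinset (fun _ : Fin d => Finset.Icc (-(⌊R⌋₊ : ℤ)) (⌊R⌋₊ : ℤ))).card := by
    apply Finset.card_le_card_of_injOn f
    · intro j _
      rw [Finset.mem_coe, Fintype.mem_piFinset]
      intro i
      have h1 := hb (l.drop j) (List.drop_suffix _ _)
      have h2 := (norm_le_pi_norm _ i).trans h1
      rw [hvu, Real.norm_eq_abs] at h2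
      have h3 : ((f j i).natAbs : ℝ) ≤ R := by
        rw [Nat.cast_natAbs, Int.cast_abs]; exact h2
      have h4 := Nat.le_floor h3
      rw [Finset.mem_Icc]
      omega
    · intro i hi j hj he
      simp only [Finset.coe_range, Set.mem_Iio] at hi hj
      rcases lt_trichotomy i j with h | h | h
      · exact absurd he (hinj' i j h hj)
      · exact h
      · exact absurd he.symm (hinj' j i h hi)
  rw [Finset.card_range, Fintype.card_piFinset] at hcard
  simp only [Int.card_Icc, Finset.prod_const, Finset.card_univ, Fintype.card_fin] at hcard
  have h5 : ((⌊R⌋₊ : ℤ) + 1 - -(⌊R⌋₊ : ℤ)).toNat = 2 * ⌊R⌋₊ + 1 := by omega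
  rw [h5] at hcard
  have h6 : (L.length : ℝ) ≤ ((2 * ⌊R⌋₊ + 1 : ℕ) : ℝ) ^ d := by exact_mod_cast hcard
  change (L.length : ℝ) ≤ _
  refine h6.trans ?_
  apply pow_le_pow_left₀ (by positivity)
  push_cast
  have := Nat.floor_le hR0
  rw [hR] at this ⊢
  linarith

/-- the vectors for the lower bound -/
def lowVec (d : ℕ) (p q : ℤ) (i : ℕ) : Fin d → ℤ := fun j =>
  if (j : ℕ) + 1 < i then 0 else if (j : ℕ) + 1 = i then p else -q

/-- the multiplicities for the lower bound -/
def lowMult (d p q : ℕ) : ℕ → ℕ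
  | 0 => p ^ d
  | (j + 1) => q * (p + q) ^ j * p ^ (d - 1 - j)

theorem lowMult_sum (d p q : ℕ) : ∀ j ≤ d,
    ∑ i ∈ Finset.range (j + 1), lowMult d p q i = (p + q) ^ j * p ^ (d - j) := by
  intro j
  induction j with
  | zero => intro _; simp [lowMult]
  | succ j ih =>
    intro hj
    rw [Finset.sum_range_succ, ih (by omega)]
    simp only [lowMult]
    have h1 : d - j = (d - (j + 1)) + 1 := by omega
    have h2 : d - 1 - j = d - (j + 1) := by omega
    rw [h1, h2]
    ring

/-- the functional -/
def lowFun (d : ℕ) (p q : ℤ) : (Fin d → ℤ) →+ ℤ where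
  toFun v := ∑ j : Fin d, p ^ (j : ℕ) * (p + q) ^ (d - 1 - (j : ℕ)) * v j
  map_zero' := by simp
  map_add' a b := by simp [mul_add, Finset.sum_add_distrib]

theorem lowFun_partial (d : ℕ) (p q : ℤ) (i : ℕ) : ∀ k ≤ d,
    ∑ j ∈ Finset.range k, p ^ j * (p + q) ^ (d - 1 - j) *
      (if j + 1 < i then 0 else if j + 1 = i then p else -q) =
      if k < i then 0 else p ^ k * (p + q) ^ (d - k) - if i = 0 then (p + q) ^ d else 0 := by
  intro k
  induction k with
  | zero =>
    intro _
    rcases Nat.eq_zero_or_pos i with rfl | h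
    · simp
    · simp [h]
  | succ k ih =>
    intro hk
    rw [Finset.sum_range_succ, ih (by omega)]
    have h1 : d - k = (d - (k + 1)) + 1 := by omega
    have h2 : d - 1 - k = d - (k + 1) := by omega
    rw [h1, h2]
    rcases lt_trichotomy (k + 1) i with h | h | h
    · simp [h, show k < i by omega]
    · have h0 : i ≠ 0 := by omega
      simp [h0, show k < i by omega, show ¬ (k + 1 < i) by omega, h]
      rw [← h]; ring
    · simp only [show ¬ k < i by omega, show ¬ (k + 1 < i) by omega, show ¬ (k + 1 = i) by omega,
        if_false]
      ring

theorem lowFun_lowVec (d : ℕ) (p q : ℤ) (i : ℕ) (hi : i ≤ d) :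
    lowFun d p q (lowVec d p q i) = p ^ d - if i = 0 then (p + q) ^ d else 0 := by
  have h := lowFun_partial d p q i d le_rfl
  rw [← Fin.sum_univ_eq_sum_range (fun j => p ^ j * (p + q) ^ (d - 1 - j) *
      (if j + 1 < i then 0 else if j + 1 = i then p else -q))] at h
  simp only [lowFun, lowVec, AddMonoidHom.coe_mk, ZeroHom.coe_mk]
  rw [h]
  simp [show ¬ d < i by omega]

/-- the sequence for the lower bound -/
def lowSeq (d p q : ℕ) : Multiset (Fin d → ℤ) :=
  ∑ i ∈ Finset.range (d + 1), Multiset.replicate (lowMult d p q i) (lowVec d p q i)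

theorem lowSeq_card (d p q : ℕ) : Multiset.card (lowSeq d p q) = (p + q) ^ d := by
  rw [lowSeq, Multiset.card_sum]
  simp only [Multiset.card_replicate]
  rw [lowMult_sum d p q d le_rfl]; simp

theorem lowSeq_mem (d p q : ℕ) (v) (hv : v ∈ lowSeq d p q) : ∃ i ≤ d, v = lowVec d p q i := by
  simp only [lowSeq, Multiset.mem_sum] at hv
  obtain ⟨i, hi, hv⟩ := hv
  exact ⟨i, by simpa [Nat.lt_succ_iff] using hi, Multiset.eq_of_mem_replicate hv⟩

theorem lowSeq_coord (d p q : ℕ) (j : ℕ) : ∀ k, 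
    ∑ i ∈ Finset.range (k + 1), (lowMult d p q i : ℤ) *
      (if j + 1 < i then 0 else if j + 1 = i then (p : ℤ) else -q) =
    if k ≤ j then -q * ∑ i ∈ Finset.range (k + 1), (lowMult d p q i : ℤ) else
      p * lowMult d p q (j + 1) - q * ∑ i ∈ Finset.range (j + 1), (lowMult d p q i : ℤ) := by
  intro k
  induction k with
  | zero => simp; ring
  | succ k ih =>
    rw [Finset.sum_range_succ, ih]
    rcases lt_trichotomy k j with h | h | h
    · rw [if_pos (by omega), if_neg (by omega), if_neg (by omega), if_pos (by omega),
        Finset.sum_range_succ _ (k + 1)]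
      ring
    · subst h
      rw [if_pos (by omega), if_neg (by omega), if_pos rfl, if_neg (by omega)]
      ring
    · rw [if_neg (by omega), if_pos (by omega), if_neg (by omega)]
      ring

theorem lowSeq_sum (d p q : ℕ) : (lowSeq d p q).sum = 0 := by
  have h : (lowSeq d p q).sum =
      ∑ i ∈ Finset.range (d + 1), (lowMult d p q i) • (lowVec d p q i) := by
    simp only [lowSeq]
    rw [Multiset.sum_sum]
    simp
  rw [h]
  funext j
  simp only [Finset.sum_apply, Pi.smul_apply, Pi.zero_apply]
  simp only [nsmul_eq_mul, lowVec]
  have hj := j.2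
  rw [lowSeq_coord d p q j d, if_neg (by omega)]
  have h2 : (∑ i ∈ Finset.range ((j : ℕ) + 1), (lowMult d p q i : ℤ)) =
      (((p + q) ^ (j : ℕ) * p ^ (d - j) : ℕ) : ℤ) := by
    rw [← lowMult_sum d p q j (by omega)]; push_cast; rfl
  rw [h2]
  simp only [lowMult]
  have h3 : d - (j : ℕ) = (d - 1 - j) + 1 := by omega
  rw [h3]
  push_cast
  ring

theorem low_dvd (d p q : ℕ) (hpq : Nat.Coprime p (p + q)) (t : Multiset (Fin d → ℤ))
    (ht : ∀ v ∈ t, ∃ i ≤ d, v = lowVec d p q i) (h0 : t.sum = 0) :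
    (p + q) ^ d ∣ Multiset.card t := by
  have key : ∀ t : Multiset (Fin d → ℤ), (∀ v ∈ t, ∃ i ≤ d, v = lowVec d p q i) →
      ((p : ℤ) + q) ^ d ∣ (p : ℤ) ^ d * Multiset.card t - lowFun d p q t.sum := by
    intro t
    induction t using Multiset.induction_on with
    | empty => intro _; simp
    | cons a t ih =>
      intro h
      have h1 := ih (fun v hv => h v (Multiset.mem_cons_of_mem hv))
      obtain ⟨i, hi, rfl⟩ := h a (Multiset.mem_cons_self a t)
      rw [Multiset.sum_cons, map_add, lowFun_lowVec d p q i hi, Multiset.card_cons]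
      have : (p : ℤ) ^ d * ((Multiset.card t + 1 : ℕ) : ℤ) -
          ((p : ℤ) ^ d - (if i = 0 then ((p : ℤ) + q) ^ d else 0) + lowFun d p q t.sum) =
          ((p : ℤ) ^ d * Multiset.card t - lowFun d p q t.sum) +
          (if i = 0 then ((p : ℤ) + q) ^ d else 0) := by push_cast; ring
      rw [this]
      apply dvd_add h1
      split_ifs <;> simp
  have h := key t ht
  rw [h0, map_zero, sub_zero] at h
  have h' : (p + q) ^ d ∣ p ^ d * Multiset.card t := by exact_mod_cast h
  exact (Nat.Coprime.pow d d hpq.symm).dvd_of_dvd_mul_left h'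

theorem lower_gen (d p q m : ℕ) (hpq : Nat.Coprime p (p + q)) (hpos : 0 < p + q) (hp : p ≤ m)
    (hq : q ≤ m) : (((p + q) ^ d : ℕ) : ℕ∞) ≤
        davenport {v : Fin d → ℤ | ∀ i, v i ∈ Set.Icc (-(m : ℤ)) m} := by
  rw [← lowSeq_card d p q]
  refine le_iSup₂_of_le (lowSeq d p q) ⟨?_, ?_, lowSeq_sum d p q, ?_⟩ le_rfl
  · intro h
    have := lowSeq_card d p q
    rw [h, Multiset.card_zero] at this
    exact (pow_pos hpos d).ne this
  · intro v hv
    obtain ⟨i, -, rfl⟩ := lowSeq_mem d p q v hv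
    intro j
    simp only [lowVec, Set.mem_Icc]
    split_ifs <;> constructor <;> omega
  · intro t ht ht0 hs
    have h1 := low_dvd d p q hpq t
      (fun v hv => lowSeq_mem d p q v (Multiset.mem_of_le ht.le hv)) hs
    have h2 := Multiset.card_lt_card ht
    rw [lowSeq_card] at h2
    have h3 := Nat.le_of_dvd (Multiset.card_pos.2 ht0) h1
    omega

open scoped ENNReal

theorem davenport_hypercube_bounds (d : ℕ) (hd : 3 ≤ d) (m : ℕ) (hm : 0 < m) :
    ((((2 * m - 1 + if m = 1 then 1 else 0) ^ d : ℕ)) : ℕ∞) ≤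
        davenport {v : Fin d → ℤ | ∀ i, v i ∈ Set.Icc (-(m : ℤ)) m} ∧
    ((davenport {v : Fin d → ℤ | ∀ i, v i ∈ Set.Icc (-(m : ℤ)) m} : ℕ∞) : ℝ≥0∞) ≤
        ENNReal.ofReal ((2 * ((d : ℝ) + 1 / d - 1) * (m : ℝ) + 1) ^ d) := by
  constructor
  · by_cases h : m = 1
    · subst h
      exact lower_gen d 1 1 1 (by norm_num) (by norm_num) le_rfl le_rfl
    · have h1 := lower_gen d m (m - 1) m (by
        have : m + (m - 1) = 2 * (m - 1) + 1 := by omega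
        rw [this]
        obtain ⟨k, rfl⟩ : ∃ k, m = k + 1 := ⟨m - 1, by omega⟩
        have h2 : 2 * (k + 1 - 1) + 1 = k + (k + 1) * 1 := by
          simp; omega
        rw [h2, Nat.coprime_add_mul_left_right]
        simp) (by omega) le_rfl (by omega)
      have h2 : (2 * m - 1 + if m = 1 then 1 else 0) = m + (m - 1) := by
        rw [if_neg h]; omega
      rw [h2]
      exact h1
  · set B : ℝ := (2 * ((d : ℝ) + 1 / d - 1) * (m : ℝ) + 1) ^ d with hB
    have hD : davenport {v : Fin d → ℤ | ∀ i, v i ∈ Set.Icc (-(m : ℤ)) m} ≤ ((⌊B⌋₊ : ℕ) : ℕ∞) := by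
      refine iSup₂_le fun s hs => ?_
      exact_mod_cast Nat.le_floor (upper_card d (by omega) m s hs)
    have hB0 : 0 ≤ B := by
      have hd' : (3 : ℝ) ≤ d := by exact_mod_cast hd
      have hdi : (0 : ℝ) < 1 / d := by positivity
      have h3 : (0 : ℝ) ≤ (d : ℝ) + 1 / d - 1 := by linarith
      rw [hB]; positivity
    refine (ENat.toENNReal_le.2 hD).trans ?_
    rw [ENat.toENNReal_coe, ← ENNReal.ofReal_natCast]
    exact ENNReal.ofReal_le_ofReal (Nat.floor_le hB0)
end
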